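/- Conventions. Let $(M,g)$ be a smooth real 4-manifold with a smooth metric of signature $(+,-,-,-)$ and Levi-Civita connection $\nabla$; curvature is taken with $(\nabla_a\nabla_b-\nabla_b\nabla_a)V^d=R_{abc}{}^dV^c$, $R_{ab}=R_{acb}{}^c$, $R=g^{ab}R_{ab}$, and $C_{abcd}$ is the Weyl tensor. Let $(o^A,\iota^A)$ be a smooth spin dyad with $o_A\iota^A=1$ and $l,n,m,\bar m$ its null tetrad, $l=o\bar o$, $n=\iota\bar\iota$, $m=o\bar\iota$ ($l\cdot n=1$, $m\cdot\bar m=-1$, other products zero). Put $\kappa=m^al^b\nabla_bl_a$, $\sigma=m^am^b\nabla_bl_a$, $\rho=m^a\bar m^b\nabla_bl_a$, $\tau=m^an^b\nabla_bl_a$, $\rho'=\bar m^am^b\nabla_bn_a$, $\tau'=\bar m^al^b\nabla_bn_a$, $\sigma'=\bar m^a\bar m^b\nabla_bn_a$, $\varepsilon=\frac12(n^al^b\nabla_bl_a+m^al^b\nabla_b\bar m_a)$, $\beta=\frac12(n^am^b\nabla_bl_a+m^am^b\nabla_b\bar m_a)$, $\varepsilon'=\frac12(l^an^b\nabla_bn_a+\bar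 m^an^b\nabla_bm_a)$, $\beta'=\frac12(l^a\bar m^b\nabla_bn_a+\bar m^a\bar m^b\nabla_bm_a)$, $\Psi_0=C_{abcd}l^am^bl^cm^d$, $\Psi_1=C_{abcd}l^am^bl^cn^d$, $\Psi_2=C_{abcd}l^am^b\bar m^cn^d$. On a scalar $\eta$ of GHP weight $\{p,q\}$ the GHP derivatives are þ$\eta=(l^a\nabla_a-p\varepsilon-q\bar\varepsilon)\eta$, þ$'\eta=(n^a\nabla_a+p\varepsilon'+q\bar\varepsilon')\eta$, ð$\eta=(m^a\nabla_a-p\beta+q\bar\beta')\eta$, ð$'\eta=(\bar m^a\nabla_a+p\beta'-q\bar\beta)\eta$, of weights $\{p+1,q+1\}$, $\{p-1,q-1\}$, $\{p+1,q-1\}$, $\{p-1,q+1\}$. Here $l,n,m$ have weights $\{1,1\}$, $\{-1,-1\}$, $\{1,-1\}$, $\rho,\rho',\tau,\tau',\sigma'$ have weights $\{1,1\}$, $\{-1,-1\}$, $\{1,-1\}$, $\{-1,1\}$, $\{-3,1\}$, $\Psi_2$ has weight $\{0,0\}$, and complex conjugation exchanges $p$ and $q$. For a smooth complex symmetric 2-tensor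 field $x_{ab}$ (with $x_{ll}=l^al^bx_{ab}$, etc.) and a smooth scalar $\Phi$ of weight $\{4,0\}$ define - $\mathcal S(x)=(ð-4\tau-\bar\tau')\big((þ-2\bar\rho)x_{lm}-(ð-\bar\tau')x_{ll}\big)+(þ-4\rho-\bar\rho)\big(\bar\sigma'x_{ll}+(ð-2\bar\tau')x_{lm}-(þ-\bar\rho)x_{mm}\big)$, - $\mathcal E(x)_{ab}=(-\frac12\Box+6\Lambda)x_{ab}-\frac12\nabla_a\nabla_b(g^{cd}x_{cd})+\nabla^c\nabla_{(a}x_{b)c}-\frac12g_{ab}\big(\nabla^c\nabla^dx_{cd}-\Box(g^{cd}x_{cd})\big)$, - $\mathcal O(\Phi)=2\big[(þ-4\rho-\bar\rho)(þ'-\rho')-(ð-4\tau-\bar\tau')(ð'-\tau')-3\Psi_2\big]\Phi$, - $\mathcal T(x)=\frac12\big((ð-2\bar\tau')ð-\bar\sigma'(þ-2\bar\rho)-2(þ\bar\sigma')\big)x_{ll}+\frac12(þ-2\bar\rho)þ\,x_{mm}-\big((þ-2\bar\rho)(ð-\bar\tau')-(ð\bar\rho)\big)x_{lm}$. Theorem.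 Suppose that $(M,g)$ is Einstein, i.e. $R_{ab}=\frac14Rg_{ab}$ with $R=24\Lambda$ constant (cosmological constant $6\Lambda$), and of Petrov type II with repeated principal spinor $o^A$, i.e. $\Psi_0=\Psi_1=0$ and $\Psi_2\neq0$ everywhere (this implies $\kappa=\sigma=0$). Then: 1. $\mathcal S(\mathcal E(x))=\mathcal O(\mathcal T(x))$ for every smooth complex symmetric 2-tensor field $x_{ab}$. 2. On smooth scalars $\chi$ of weight $\{-4,0\}$ the formal adjoints of $\mathcal O$ and $\mathcal S$ are $$\mathcal O^\dagger\chi=2\big[(þ'-\bar\rho')(þ+3\rho)-(ð'-\bar\tau)(ð+3\tau)-3\Psi_2\big]\chi,\qquad \mathcal S^\dagger(\chi)_{ab}=h_{nn}l_al_b-2h_{n\bar m}l_{(a}m_{b)}+h_{\bar m\bar m}m_am_b,$$ $$h_{nn}=-(ð+2\tau)ð\chi-\bar\sigma'þ\chi,\quad h_{n\bar m}=-(þ+\rho)ð\chi-(\tau+\bar\tau')þ\chi,\quad h_{\bar m\bar m}=-(þ+2\rho)þ\chi;$$ that is, $\chi\,\mathcal O(\Phi)-\mathcal O^\dagger(\chi)\,\Phi$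 and $\chi\,\mathcal S(x)-\mathcal S^\dagger(\chi)^{ab}x_{ab}$ are divergences $\nabla_aw^a$ of smooth compactly supported complex vector fields $w$ whenever $\Phi$, respectively $x$, is smooth with compact support. 3. Consequently, if $\chi$ is a smooth complex scalar field of weight $\{-4,0\}$ solving the Debye equation $\mathcal O^\dagger\chi=0$, then the complex symmetric tensor $h_{ab}=\mathcal S^\dagger(\chi)_{ab}$ solves the linearized Einstein equations with cosmological constant: $\mathcal E(h)_{ab}=0$. -/

import Mathlib

open Bundle VectorField
open scoped Manifold ContDiff

noncomputable section

namespace GHP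

/-- Pointwise complex conjugate of a scalar field. -/
def bar {M : Type*} (f : M → ℂ) : M → ℂ := fun x ↦ (starRingEnd ℂ) (f x)

/-! ### Lorentzian metrics and complex vector fields on a real 4-manifold -/

section Manifold

variable (M : Type*) [TopologicalSpace M] [ChartedSpace (EuclideanSpace ℝ (Fin 4)) M]

/-- A (not necessarily smooth) real vector field on `M`. -/
abbrev RealField := (x : M) → TangentSpace (𝓡 4) x

/-- A smooth metric of signature `(+,-,-,-)` on the 4-manifold `M`. -/
structure LorentzMetric [IsManifold (𝓡 4) ∞ M] where
  /-- the bilinear form on each tangent space -/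
  val (x : M) : TangentSpace (𝓡 4) x →L[ℝ] TangentSpace (𝓡 4) x →L[ℝ] ℝ
  symm (x : M) (v w : TangentSpace (𝓡 4) x) : val x v w = val x w v
  signature (x : M) : ∃ t : TangentSpace (𝓡 4) x, 0 < val x t t ∧
    ∀ v : TangentSpace (𝓡 4) x, v ≠ 0 → val x t v = 0 → val x v v < 0
  smooth : ContMDiff (𝓡 4)
    ((𝓡 4).prod 𝓘(ℝ, EuclideanSpace ℝ (Fin 4) →L[ℝ] EuclideanSpace ℝ (Fin 4) →L[ℝ] ℝ)) ∞
    (fun x ↦ TotalSpace.mk'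
      (EuclideanSpace ℝ (Fin 4) →L[ℝ] EuclideanSpace ℝ (Fin 4) →L[ℝ] ℝ) x (val x))

/-- A complex vector field `re + i im`, i.e. a section of `TM ⊗ ℂ`. -/
structure ComplexField where
  /-- the real part -/
  re : RealField M
  /-- the imaginary part -/
  im : RealField M

end Manifold

section Fields

variable {M : Type*} [TopologicalSpace M] [ChartedSpace (EuclideanSpace ℝ (Fin 4)) M]

/-- Smoothness of a real vector field. -/
def SmoothField [IsManifold (𝓡 4) ∞ M] (X : RealField M) : Prop :=
  ContMDiff (𝓡 4) (𝓡 4).tangent ∞ (fun x ↦ (⟨x, X x⟩ : TangentBundle (𝓡 4) M))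

/-- Smoothness of a complex-valued function. -/
def Smooth (f : M → ℂ) : Prop := ContMDiff (𝓡 4) 𝓘(ℝ, ℂ) ∞ f

/-- A real vector field seen as a complex one. -/
def ComplexField.ofReal (X : RealField M) : ComplexField M := ⟨X, 0⟩

/-- The complex conjugate field. -/
def ComplexField.conj (V : ComplexField M) : ComplexField M := ⟨V.re, -V.im⟩

/-- The derivative `V(f)` of a complex-valued function along a complex vector field. -/
def ComplexField.deriv (V : ComplexField M) (f : M → ℂ) : M → ℂ := fun x ↦
  mvfderiv (𝓡 4) f x (V.re x) + Complex.I * mvfderiv (𝓡 4) f x (V.im x)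

/-- The Lie bracket, extended complex-bilinearly. -/
def ComplexField.bracket (V W : ComplexField M) : ComplexField M :=
  ⟨mlieBracket (𝓡 4) V.re W.re - mlieBracket (𝓡 4) V.im W.im,
   mlieBracket (𝓡 4) V.re W.im + mlieBracket (𝓡 4) V.im W.re⟩

variable [IsManifold (𝓡 4) ∞ M]

/-- The metric, extended complex-bilinearly: the function `g(V, W)`. -/
def LorentzMetric.inner (g : LorentzMetric M) (V W : ComplexField M) : M → ℂ := fun x ↦
  ((g.val x (V.re x) (W.re x) - g.val x (V.im x) (W.im x) : ℝ) : ℂ)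
    + Complex.I * ((g.val x (V.re x) (W.im x) + g.val x (V.im x) (W.re x) : ℝ) : ℂ)

/-- The Levi-Civita connection of `g`, through the Koszul formula:
`g.nabla V W Z = g(∇_V W, Z)`. -/
def LorentzMetric.nabla (g : LorentzMetric M) (V W Z : ComplexField M) : M → ℂ :=
  (1 / 2 : ℂ) • (V.deriv (g.inner W Z) + W.deriv (g.inner V Z) - Z.deriv (g.inner V W)
    + g.inner (V.bracket W) Z - g.inner (V.bracket Z) W - g.inner (W.bracket Z) V)

/-- A smooth null tetrad `l, n, m, m̄` with `l, n` real, `m = mRe + i mIm`, `l·n = 1`,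
`m·m̄ = -1` and all other products zero. It is the tetrad
`l = o ō, n = ι ῑ, m = o ῑ, m̄ = ι ō` of a spin dyad `(o, ι)` with `o_A ι^A = 1` of the spin
structure (and orientations) that it determines, and it determines the dyad up to a sign, which
does not enter scalars of weight `{p,q}` with `p - q` even. -/
structure NullTetrad (g : LorentzMetric M) where
  /-- `l` -/
  l : RealField M
  /-- `n` -/
  n : RealField M
  /-- real part of `m` -/
  mRe : RealField M
  /-- imaginary part of `m` -/
  mIm : RealField M
  smooth_l : SmoothField l
  smooth_n : SmoothField n
  smooth_mRe : SmoothField mRe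
  smooth_mIm : SmoothField mIm
  ll (x : M) : g.inner (.ofReal l) (.ofReal l) x = 0
  nn (x : M) : g.inner (.ofReal n) (.ofReal n) x = 0
  ln (x : M) : g.inner (.ofReal l) (.ofReal n) x = 1
  lm (x : M) : g.inner (.ofReal l) ⟨mRe, mIm⟩ x = 0
  nm (x : M) : g.inner (.ofReal n) ⟨mRe, mIm⟩ x = 0
  mm (x : M) : g.inner ⟨mRe, mIm⟩ ⟨mRe, mIm⟩ x = 0
  mmbar (x : M) : g.inner ⟨mRe, mIm⟩ (ComplexField.conj ⟨mRe, mIm⟩) x = -1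

end Fields

/-! ### Tetrad components: connection, curvature, spin coefficients

Tetrad indices are `0 = l, 1 = n, 2 = m, 3 = m̄`. -/

/-- Tetrad components of the metric; this matrix is its own inverse, so it also gives `g^{ab}`. -/
def eta : Matrix (Fin 4) (Fin 4) ℂ :=
  !![0, 1, 0, 0; 1, 0, 0, 0; 0, 0, 0, -1; 0, 0, -1, 0]

/-- Complex covariant 2-tensor fields, given by their components `x a b = x(e_a, e_b)` in the
tetrad `e = (l, n, m, m̄)`. -/
abbrev Tensor2 (M : Type*) := Fin 4 → Fin 4 → M → ℂ

/-- The trace `g^{cd} x_{cd}`. -/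
def tr {M : Type*} (x : Tensor2 M) : M → ℂ := ∑ c, ∑ d, eta c d • x c d

namespace NullTetrad

variable {M : Type*} [TopologicalSpace M] [ChartedSpace (EuclideanSpace ℝ (Fin 4)) M]
  [IsManifold (𝓡 4) ∞ M] {g : LorentzMetric M} (t : NullTetrad g)

/-- The complex vector field `m`. -/
def m : ComplexField M := ⟨t.mRe, t.mIm⟩

/-- The frame `e_0 = l, e_1 = n, e_2 = m, e_3 = m̄`. -/
def e : Fin 4 → ComplexField M := ![.ofReal t.l, .ofReal t.n, t.m, t.m.conj]

/-- Directional derivative `e_a(f)`. -/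
def D (a : Fin 4) (f : M → ℂ) : M → ℂ := (t.e a).deriv f

/-- Rotation coefficients `γ_{abc} = g(∇_{e_a} e_b, e_c)`. -/
def gam (a b c : Fin 4) : M → ℂ := g.nabla (t.e a) (t.e b) (t.e c)

/-- Connection coefficients: `∇_{e_a} e_b = ∑_c Γ_{ab}^c e_c`. -/
def Gam (a b c : Fin 4) : M → ℂ := ∑ d, eta c d • t.gam a b d

/-- Structure functions: `[e_a, e_b] = ∑_c C_{ab}^c e_c`. -/
def strc (a b c : Fin 4) : M → ℂ := ∑ d, eta c d • g.inner ((t.e a).bracket (t.e b)) (t.e d)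

/-- Components of the curvature,
`(∇_{e_a} ∇_{e_b} - ∇_{e_b} ∇_{e_a} - ∇_{[e_a,e_b]}) e_c = ∑_d R_{abc}^d e_d`. -/
def riemUp (a b c d : Fin 4) : M → ℂ :=
  t.D a (t.Gam b c d) - t.D b (t.Gam a c d)
    + ∑ h, (t.Gam b c h * t.Gam a h d - t.Gam a c h * t.Gam b h d)
    - ∑ h, t.strc a b h * t.Gam h c d

/-- `R_{abcd}`, the last index of `R_{abc}^d` lowered. -/
def riem (a b c d : Fin 4) : M → ℂ := ∑ h, eta d h • t.riemUp a b c h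

/-- The Ricci tensor in the convention of Penrose and Rindler, `R_{ab} = R_{acb}^c`. -/
def ricci (a b : Fin 4) : M → ℂ := ∑ c, t.riemUp a c b c

/-- The scalar curvature `R = g^{ab} R_{ab}`. -/
def scal : M → ℂ := ∑ a, ∑ b, eta a b • t.ricci a b

/-- The Weyl tensor `C_{abcd}`. -/
def weyl (a b c d : Fin 4) : M → ℂ :=
  t.riem a b c d
    - (1 / 2 : ℂ) • (eta a c • t.ricci b d - eta a d • t.ricci b c
        + eta b d • t.ricci a c - eta b c • t.ricci a d)
    + ((eta a c * eta b d - eta a d * eta b c) / 6) • t.scal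

/-- `Ψ₀ = C(l,m,l,m) = Ψ_{ABCD} o^A o^B o^C o^D`. -/
def Psi0 : M → ℂ := t.weyl 0 2 0 2
/-- `Ψ₁ = C(l,m,l,n) = Ψ_{ABCD} o^A o^B o^C ι^D`. -/
def Psi1 : M → ℂ := t.weyl 0 2 0 1
/-- `Ψ₂ = C(l,m,m̄,n) = Ψ_{ABCD} o^A o^B ι^C ι^D`. -/
def Psi2 : M → ℂ := t.weyl 0 2 3 1

/-- Einstein: the trace-free Ricci tensor vanishes and `R / 24` is the constant `Λ`. -/
structure IsEinstein (Λ : ℝ) : Prop where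
  tracefree (a b : Fin 4) (x : M) : t.ricci a b x - eta a b / 4 * t.scal x = 0
  scal_eq (x : M) : t.scal x = 24 * (Λ : ℂ)

/-- Petrov type II with repeated principal spinor `o`: `Ψ₀ = Ψ₁ = 0` and `Ψ₂ ≠ 0`. -/
structure IsTypeII : Prop where
  psi0 (x : M) : t.Psi0 x = 0
  psi1 (x : M) : t.Psi1 x = 0
  psi2 (x : M) : t.Psi2 x ≠ 0

/-- `ρ = m^a m̄^b ∇_b l_a`. -/
def rho : M → ℂ := t.gam 3 0 2
/-- `τ = m^a n^b ∇_b l_a`. -/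
def tau : M → ℂ := t.gam 1 0 2
/-- `ρ' = m̄^a m^b ∇_b n_a`. -/
def rho' : M → ℂ := t.gam 2 1 3
/-- `τ' = m̄^a l^b ∇_b n_a`. -/
def tau' : M → ℂ := t.gam 0 1 3
/-- `σ' = m̄^a m̄^b ∇_b n_a`. -/
def sigma' : M → ℂ := t.gam 3 1 3
/-- `ε = ½ (n^a l^b ∇_b l_a + m^a l^b ∇_b m̄_a)`. -/
def eps : M → ℂ := (1 / 2 : ℂ) • (t.gam 0 0 1 + t.gam 0 3 2)
/-- `β = ½ (n^a m^b ∇_b l_a + m^a m^b ∇_b m̄_a)`. -/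
def beta : M → ℂ := (1 / 2 : ℂ) • (t.gam 2 0 1 + t.gam 2 3 2)
/-- `ε' = ½ (l^a n^b ∇_b n_a + m̄^a n^b ∇_b m_a)`. -/
def eps' : M → ℂ := (1 / 2 : ℂ) • (t.gam 1 1 0 + t.gam 1 2 3)
/-- `β' = ½ (l^a m̄^b ∇_b n_a + m̄^a m̄^b ∇_b m_a)`. -/
def beta' : M → ℂ := (1 / 2 : ℂ) • (t.gam 3 1 0 + t.gam 3 2 3)

/-! ### The weighted GHP derivatives on scalars of weight `{p,q}` -/

/-- `þ` on scalars of weight `{p,q}`; the result has weight `{p+1,q+1}`. -/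
def tho (p q : ℤ) (f : M → ℂ) : M → ℂ :=
  t.D 0 f - ((p : ℂ) • t.eps + (q : ℂ) • bar t.eps) * f
/-- `þ'` on scalars of weight `{p,q}`; the result has weight `{p-1,q-1}`. -/
def tho' (p q : ℤ) (f : M → ℂ) : M → ℂ :=
  t.D 1 f + ((p : ℂ) • t.eps' + (q : ℂ) • bar t.eps') * f
/-- `ð` on scalars of weight `{p,q}`; the result has weight `{p+1,q-1}`. -/
def edt (p q : ℤ) (f : M → ℂ) : M → ℂ :=
  t.D 2 f - ((p : ℂ) • t.beta - (q : ℂ) • bar t.beta') * f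
/-- `ð'` on scalars of weight `{p,q}`; the result has weight `{p-1,q+1}`. -/
def edt' (p q : ℤ) (f : M → ℂ) : M → ℂ :=
  t.D 3 f + ((p : ℂ) • t.beta' - (q : ℂ) • bar t.beta) * f

/-! ### The linearized Einstein operator -/

/-- `cov2 x c a b = ∇_c x_{ab}`. -/
def cov2 (x : Tensor2 M) (c a b : Fin 4) : M → ℂ :=
  t.D c (x a b) - ∑ h, t.Gam c a h * x h b - ∑ h, t.Gam c b h * x a h

/-- `cov22 x d c a b = ∇_d ∇_c x_{ab}`. -/
def cov22 (x : Tensor2 M) (d c a b : Fin 4) : M → ℂ :=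
  t.D d (t.cov2 x c a b) - ∑ h, t.Gam d c h * t.cov2 x h a b
    - ∑ h, t.Gam d a h * t.cov2 x c h b - ∑ h, t.Gam d b h * t.cov2 x c a h

/-- `hess f a b = ∇_a ∇_b f` for a scalar `f`. -/
def hess (f : M → ℂ) (a b : Fin 4) : M → ℂ :=
  t.D a (t.D b f) - ∑ h, t.Gam a b h * t.D h f

/-- `E(x)_{ab} = (-½□ + 6Λ) x_{ab} - ½ ∇_a ∇_b (g^{cd} x_{cd}) + ∇^c ∇_{(a} x_{b)c}
- ½ g_{ab} (∇^c ∇^d x_{cd} - □ (g^{cd} x_{cd}))`. -/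
def E (Λ : ℝ) (x : Tensor2 M) : Tensor2 M := fun a b ↦
  (-(1 / 2 : ℂ)) • (∑ c, ∑ d, eta c d • t.cov22 x c d a b) + (6 * (Λ : ℂ)) • x a b
    - (1 / 2 : ℂ) • t.hess (tr x) a b
    + (1 / 2 : ℂ) • (∑ c, ∑ d, eta c d • (t.cov22 x d a b c + t.cov22 x d b a c))
    - (eta a b / 2) •
      ((∑ c, ∑ d, ∑ h, ∑ k, (eta c h * eta d k) • t.cov22 x h k c d)
        - ∑ c, ∑ d, eta c d • t.hess (tr x) c d)

/-! ### The operators `S`, `T`, `O` and the adjoints `O†`, `S†` -/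

/-- `S(x) = (ð - 4τ - τ̄')((þ - 2ρ̄) x_lm - (ð - τ̄') x_ll)
+ (þ - 4ρ - ρ̄)(σ̄' x_ll + (ð - 2τ̄') x_lm - (þ - ρ̄) x_mm)`. -/
def S (x : Tensor2 M) : M → ℂ :=
  let y : M → ℂ := (t.tho 2 0 (x 0 2) - 2 * bar t.rho * x 0 2)
    - (t.edt 2 2 (x 0 0) - bar t.tau' * x 0 0)
  let z : M → ℂ := bar t.sigma' * x 0 0 + (t.edt 2 0 (x 0 2) - 2 * bar t.tau' * x 0 2)
    - (t.tho 2 (-2) (x 2 2) - bar t.rho * x 2 2)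
  (t.edt 3 1 y - (4 * t.tau + bar t.tau') * y) + (t.tho 3 (-1) z - (4 * t.rho + bar t.rho) * z)

/-- `T(x) = ½ ((ð - 2τ̄')ð - σ̄'(þ - 2ρ̄) - 2(þσ̄')) x_ll + ½ (þ - 2ρ̄)þ x_mm
- ((þ - 2ρ̄)(ð - τ̄') - (ðρ̄)) x_lm`. -/
def T (x : Tensor2 M) : M → ℂ :=
  let u : M → ℂ := t.edt 2 2 (x 0 0)
  let v : M → ℂ := t.tho 2 (-2) (x 2 2)
  let w : M → ℂ := t.edt 2 0 (x 0 2) - bar t.tau' * x 0 2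
  (1 / 2 : ℂ) • ((t.edt 3 1 u - 2 * bar t.tau' * u)
      - bar t.sigma' * (t.tho 2 2 (x 0 0) - 2 * bar t.rho * x 0 0)
      - 2 * t.tho 1 (-3) (bar t.sigma') * x 0 0)
    + (1 / 2 : ℂ) • (t.tho 3 (-1) v - 2 * bar t.rho * v)
    - ((t.tho 3 (-1) w - 2 * bar t.rho * w) - t.edt 1 1 (bar t.rho) * x 0 2)

/-- `O(Φ) = 2[(þ - 4ρ - ρ̄)(þ' - ρ') - (ð - 4τ - τ̄')(ð' - τ') - 3Ψ₂]Φ` on weight `{4,0}`. -/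
def O (Φ : M → ℂ) : M → ℂ :=
  let y : M → ℂ := t.tho' 4 0 Φ - t.rho' * Φ
  let z : M → ℂ := t.edt' 4 0 Φ - t.tau' * Φ
  2 * ((t.tho 3 (-1) y - (4 * t.rho + bar t.rho) * y)
    - (t.edt 3 1 z - (4 * t.tau + bar t.tau') * z) - 3 * t.Psi2 * Φ)

/-- `O†(χ) = 2[(þ' - ρ̄')(þ + 3ρ) - (ð' - τ̄)(ð + 3τ) - 3Ψ₂]χ` on weight `{-4,0}`. -/
def Odag (χ : M → ℂ) : M → ℂ :=
  let y : M → ℂ := t.tho (-4) 0 χ + 3 * t.rho * χ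
  let z : M → ℂ := t.edt (-4) 0 χ + 3 * t.tau * χ
  2 * ((t.tho' (-3) 1 y - bar t.rho' * y) - (t.edt' (-3) (-1) z - bar t.tau * z)
    - 3 * t.Psi2 * χ)

/-- `h_nn = -(ð + 2τ)ðχ - σ̄'þχ`. -/
def hnn (χ : M → ℂ) : M → ℂ :=
  -(t.edt (-3) (-1) (t.edt (-4) 0 χ) + 2 * t.tau * t.edt (-4) 0 χ)
    - bar t.sigma' * t.tho (-4) 0 χ

/-- `h_nm̄ = -(þ + ρ)ðχ - (τ + τ̄')þχ`. -/
def hnmbar (χ : M → ℂ) : M → ℂ :=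
  -(t.tho (-3) (-1) (t.edt (-4) 0 χ) + t.rho * t.edt (-4) 0 χ)
    - (t.tau + bar t.tau') * t.tho (-4) 0 χ

/-- `h_m̄m̄ = -(þ + 2ρ)þχ`. -/
def hmbarmbar (χ : M → ℂ) : M → ℂ :=
  -(t.tho (-3) 1 (t.tho (-4) 0 χ) + 2 * t.rho * t.tho (-4) 0 χ)

/-- `S†(χ)_{ab} = h_nn l_a l_b - 2 h_nm̄ l_{(a} m_{b)} + h_m̄m̄ m_a m_b`; as `l_a` and `m_a` are
nonzero only on `n` and on `m̄`, with `l·n = 1` and `m·m̄ = -1`, its nonzero components are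
`h_nn`, `h_nm̄`, `h_m̄m̄`. -/
def Sdag (χ : M → ℂ) : Tensor2 M := fun a b ↦
  !![0, 0, 0, 0; 0, t.hnn χ, 0, t.hnmbar χ; 0, 0, 0, 0; 0, t.hnmbar χ, 0, t.hmbarmbar χ] a b

/-! ### Formal adjoints -/

/-- The divergence `∇_a w^a` of the complex vector field `w = ∑ w^a e_a`. -/
def div (w : Fin 4 → M → ℂ) : M → ℂ :=
  ∑ a, (t.D a (w a) + ∑ b, t.Gam b a b * w a)

/-- `f` is the divergence of a smooth compactly supported complex vector field, so that it
integrates to zero against the metric volume. -/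
def IsCompactDivergence (f : M → ℂ) : Prop :=
  ∃ w : Fin 4 → M → ℂ, (∀ a, Smooth (w a) ∧ HasCompactSupport (w a)) ∧ f = t.div w

/-- `A'` is the formal adjoint of the operator `A` on scalar fields: `∫ χ A(Φ) = ∫ A'(χ) Φ` for
`Φ` of compact support, up to the divergence of a compactly supported field. -/
def IsScalarAdjoint (A A' : (M → ℂ) → M → ℂ) : Prop :=
  ∀ Φ χ : M → ℂ, Smooth Φ → Smooth χ → HasCompactSupport Φ →
    t.IsCompactDivergence (χ * A Φ - A' χ * Φ)

/-- `A'` is the formal adjoint of the operator `A` from symmetric 2-tensor fields to scalar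
fields: `∫ χ A(x) = ∫ A'(χ)^{ab} x_{ab}` for `x` of compact support, up to the divergence of a
compactly supported field. -/
def IsTensorAdjoint (A : Tensor2 M → M → ℂ) (A' : (M → ℂ) → Tensor2 M) : Prop :=
  ∀ (x : Tensor2 M) (χ : M → ℂ), (∀ a b, x a b = x b a) → (∀ a b, Smooth (x a b)) →
    Smooth χ → (∀ a b, HasCompactSupport (x a b)) →
    t.IsCompactDivergence
      (χ * A x - ∑ a, ∑ b, ∑ c, ∑ d, (eta a c * eta b d) • (A' χ a b * x c d))

end NullTetrad

end GHP

end

set_option linter.unusedSectionVars false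
set_option linter.unusedSimpArgs false

noncomputable section

namespace GHP

section

/-- The involution of tetrad indices with `g(e_a, e_b) ≠ 0` iff `b = dual a`. -/
def dual : Fin 4 → Fin 4 := ![1, 0, 3, 2]

/-- The sign `g(e_a, e_{dual a})`. -/
def sgn : Fin 4 → ℤ := ![1, 1, -1, -1]

/-- The algebra of smooth functions with the derivations along a null tetrad and the rotation
coefficients of the Levi-Civita connection. -/
structure TetradAlgebra (R : Type*) [CommRing R] where
  D : Fin 4 → Derivation ℤ R R
  gam : Fin 4 → Fin 4 → Fin 4 → R
  gam_symm (a b c : Fin 4) : gam a b c = -gam a c b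
  gam_self (a b : Fin 4) : gam a b b = 0
  comm (a b : Fin 4) (f : R) : D a (D b f) - D b (D a f) =
    ∑ h, ((sgn h : R) * gam a b (dual h) - (sgn h : R) * gam b a (dual h)) * D h f
  jacobi (a b c d : Fin 4) :
    let C := fun a b h ↦ (sgn h : R) * gam a b (dual h) - (sgn h : R) * gam b a (dual h)
    D a (C b c d) + D b (C c a d) + D c (C a b d)
      + ∑ h, (C b c h * C a h d + C c a h * C b h d + C a b h * C c h d) = 0

namespace TetradAlgebra

variable {R : Type*} [CommRing R] (F : TetradAlgebra R)

/-- Connection coefficients `Γ_{ab}^c`. -/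
def Gam (a b c : Fin 4) : R := (sgn c : R) * F.gam a b (dual c)

/-- Structure functions `C_{ab}^c`. -/
def strc (a b c : Fin 4) : R := F.Gam a b c - F.Gam b a c

/-- The curvature `R_{abc}^d`. -/
def riemUp (a b c d : Fin 4) : R :=
  F.D a (F.Gam b c d) - F.D b (F.Gam a c d)
    + ∑ h, (F.Gam b c h * F.Gam a h d - F.Gam a c h * F.Gam b h d)
    - ∑ h, F.strc a b h * F.Gam h c d

/-- The curvature `R_{abcd}`. -/
def riem (a b c d : Fin 4) : R := (sgn d : R) * F.riemUp a b c (dual d)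

theorem comm' (a b : Fin 4) (f : R) :
    F.D a (F.D b f) = F.D b (F.D a f) + ∑ h, F.strc a b h * F.D h f := by
  rw [← sub_eq_iff_eq_add']; exact F.comm a b f

theorem jacobi' (a b c d : Fin 4) :
    F.D a (F.strc b c d) + F.D b (F.strc c a d) + F.D c (F.strc a b d)
      + ∑ h, (F.strc b c h * F.strc a h d + F.strc c a h * F.strc b h d
        + F.strc a b h * F.strc c h d) = 0 := F.jacobi a b c d

/-- An `R`-module on which the derivations of `F` act compatibly with their commutators. -/
structure Conn (F : TetradAlgebra R) (V : Type*) [AddCommGroup V] [Module R V] where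
  D : Fin 4 → V →+ V
  leibniz (a : Fin 4) (f : R) (v : V) : D a (f • v) = F.D a f • v + f • D a v
  comm (a b : Fin 4) (v : V) :
    D a (D b v) = D b (D a v) + ∑ h, F.strc a b h • D h v

namespace Conn

variable {F} {V : Type*} [AddCommGroup V] [Module R V] (N : F.Conn V)

/-- `∇_c x_{ab}`. -/
def cov2 (x : Fin 4 → Fin 4 → V) (c a b : Fin 4) : V :=
  N.D c (x a b) - ∑ h, F.Gam c a h • x h b - ∑ h, F.Gam c b h • x a h

/-- `∇_d y_{cab}`. -/
def cov3 (y : Fin 4 → Fin 4 → Fin 4 → V) (d c a b : Fin 4) : V :=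
  N.D d (y c a b) - ∑ h, F.Gam d c h • y h a b - ∑ h, F.Gam d a h • y c h b
    - ∑ h, F.Gam d b h • y c a h

/-- `g^{cd} x_{cd}`. -/
def tr (x : Fin 4 → Fin 4 → V) : V := ∑ c, sgn c • x c (dual c)

/-- `∇_a ∇_b v`. -/
def hess (v : V) (a b : Fin 4) : V := N.D a (N.D b v) - ∑ h, F.Gam a b h • N.D h v

theorem ricci_identity (x : Fin 4 → Fin 4 → V) (d c a b : Fin 4) :
    N.cov3 (N.cov2 x) d c a b = N.cov3 (N.cov2 x) c d a b
      - ∑ h, F.riemUp d c a h • x h b - ∑ h, F.riemUp d c b h • x a h := by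
  have h := N.comm d c (x a b)
  simp only [Fin.sum_univ_four] at h
  simp only [cov3, cov2, riemUp, strc, Fin.sum_univ_four, map_add, map_sub, N.leibniz] at h ⊢
  rw [h]
  module

end Conn

theorem gam_swap (a : Fin 4) : F.gam a 1 0 = -F.gam a 0 1 ∧ F.gam a 2 0 = -F.gam a 0 2 ∧
    F.gam a 3 0 = -F.gam a 0 3 ∧ F.gam a 2 1 = -F.gam a 1 2 ∧ F.gam a 3 1 = -F.gam a 1 3 ∧
    F.gam a 2 3 = -F.gam a 3 2 :=
  ⟨F.gam_symm .., F.gam_symm .., F.gam_symm .., F.gam_symm .., F.gam_symm .., F.gam_symm ..⟩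

theorem Gam_eval (a : Fin 4) :
    F.Gam a 0 0 = F.gam a 0 1 ∧ F.Gam a 0 1 = 0 ∧ F.Gam a 0 2 = -F.gam a 0 3 ∧
    F.Gam a 0 3 = -F.gam a 0 2 ∧
    F.Gam a 1 0 = 0 ∧ F.Gam a 1 1 = -F.gam a 0 1 ∧ F.Gam a 1 2 = -F.gam a 1 3 ∧
    F.Gam a 1 3 = -F.gam a 1 2 ∧
    F.Gam a 2 0 = -F.gam a 1 2 ∧ F.Gam a 2 1 = -F.gam a 0 2 ∧ F.Gam a 2 2 = F.gam a 3 2 ∧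
    F.Gam a 2 3 = 0 ∧
    F.Gam a 3 0 = -F.gam a 1 3 ∧ F.Gam a 3 1 = -F.gam a 0 3 ∧ F.Gam a 3 2 = 0 ∧
    F.Gam a 3 3 = -F.gam a 3 2 := by
  have := F.gam_swap a
  simp [Gam, sgn, dual, F.gam_self, this]

end TetradAlgebra

namespace TetradAlgebra.Conn
variable {R : Type*} [CommRing R] {F : TetradAlgebra R}
variable {V : Type*} [AddCommGroup V] [Module R V] (N : F.Conn V)

theorem D_tr (x : Fin 4 → Fin 4 → V) (a : Fin 4) :
    N.D a (tr x) = ∑ c, sgn c • N.cov2 x a c (dual c) := by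
  simp [tr, cov2, Fin.sum_univ_four, dual, sgn, F.Gam_eval a]
  module

theorem hess_tr (x : Fin 4 → Fin 4 → V) (a b : Fin 4) :
    N.hess (tr x) a b = ∑ c, sgn c • N.cov3 (N.cov2 x) a b c (dual c) := by
  simp only [hess, D_tr]
  generalize N.cov2 x = y
  simp [cov3, Fin.sum_univ_four, dual, sgn, F.Gam_eval a]
  module

/-- Twice the linearized Einstein operator with cosmological term, for `L = 2Λ`. -/
def E2 (L : R) (x : Fin 4 → Fin 4 → V) (a b : Fin 4) : V :=
  -(∑ c, sgn c • N.cov3 (N.cov2 x) c (dual c) a b) + (6 * L) • x a b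
    - N.hess (tr x) a b
    + (∑ c, sgn c • (N.cov3 (N.cov2 x) (dual c) a b c + N.cov3 (N.cov2 x) (dual c) b a c))
    - (if b = dual a then sgn a else 0) •
      ((∑ c, ∑ d, (sgn c * sgn d) • N.cov3 (N.cov2 x) (dual c) (dual d) c d)
        - ∑ c, sgn c • N.hess (tr x) c (dual c))

/-- Twice the perturbation of the rotation coefficients,
`ω_{b,cd} = ∇_d x_{cb} - ∇_c x_{db}`. -/
def om (x : Fin 4 → Fin 4 → V) (b c d : Fin 4) : V := N.cov2 x d c b - N.cov2 x c d b

/-- Twice the linearized curvature, `∇_a ω_{b,cd} - ∇_b ω_{a,cd}`. -/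
def lin (x : Fin 4 → Fin 4 → V) (a b c d : Fin 4) : V :=
  N.cov3 (N.om x) a b c d - N.cov3 (N.om x) b a c d

theorem lin_eq (x : Fin 4 → Fin 4 → V) (a b c d : Fin 4) :
    N.lin x a b c d = N.cov3 (N.cov2 x) a d c b - N.cov3 (N.cov2 x) a c d b
      - N.cov3 (N.cov2 x) b d c a + N.cov3 (N.cov2 x) b c d a := by
  simp only [lin, cov3, om]
  generalize N.cov2 x = y
  simp only [Fin.sum_univ_four, map_sub, smul_sub]
  module

theorem cov2_symm {x : Fin 4 → Fin 4 → V} (hx : ∀ a b, x a b = x b a) (c a b : Fin 4) :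
    N.cov2 x c a b = N.cov2 x c b a := by
  simp only [cov2, hx a b, fun h ↦ hx h b, fun h ↦ hx a h]
  module

theorem cov22_symm {x : Fin 4 → Fin 4 → V} (hx : ∀ a b, x a b = x b a) (d c a b : Fin 4) :
    N.cov3 (N.cov2 x) d c a b = N.cov3 (N.cov2 x) d c b a := by
  simp only [cov3, N.cov2_symm hx c a b, fun h ↦ N.cov2_symm hx h a b,
    fun h ↦ N.cov2_symm hx c h b, fun h ↦ N.cov2_symm hx c a h]
  module

/-- The contribution of the curvature to a commutator of covariant derivatives. -/
def curv (x : Fin 4 → Fin 4 → V) (d c a b : Fin 4) : V :=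
  ∑ h, F.riemUp d c a h • x h b + ∑ h, F.riemUp d c b h • x a h

theorem cov22_comm (x : Fin 4 → Fin 4 → V) (d c a b : Fin 4) :
    N.cov3 (N.cov2 x) d c a b = N.cov3 (N.cov2 x) c d a b - curv (F := F) x d c a b := by
  rw [ricci_identity, curv]; abel

theorem lin_pair {x : Fin 4 → Fin 4 → V} (hx : ∀ a b, x a b = x b a) (a b c d : Fin 4) :
    N.lin x a b c d = N.lin x c d a b - curv (F := F) x a d b c + curv (F := F) x a c b d
      + curv (F := F) x b d a c - curv (F := F) x b c a d := by
  simp only [lin_eq]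
  linear_combination (norm := module) N.cov22_comm x a d b c - N.cov22_comm x a c b d
    - N.cov22_comm x b d a c + N.cov22_comm x b c a d
    + N.cov22_symm hx a d c b - N.cov22_symm hx a c d b
    - N.cov22_symm hx b d c a + N.cov22_symm hx b c d a

theorem lin_anti (x : Fin 4 → Fin 4 → V) (a b c d : Fin 4) :
    N.lin x a b c d = -N.lin x b a c d ∧ N.lin x a b c d = -N.lin x a b d c := by
  constructor <;> simp only [lin_eq] <;> abel

/-- Off the diagonal blocks of the metric, the linearized Einstein operator is the trace of the
linearized curvature. -/
theorem E2_eq_lin {x : Fin 4 → Fin 4 → V} (hx : ∀ a b, x a b = x b a) (L : R) (a b : Fin 4)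
    (h : b ≠ dual a) :
    N.E2 L x a b = (6 * L) • x a b + ∑ c, sgn c • N.lin x a (dual c) b c
      - ∑ c, sgn c • curv (F := F) x (dual c) a b c := by
  rw [E2, if_neg h]
  simp only [hess_tr, lin_eq, Fin.sum_univ_four, sgn, dual]
  simp
  linear_combination (norm := module) N.cov22_comm x 1 a b 0 + N.cov22_comm x 0 a b 1
    - N.cov22_comm x 3 a b 2 - N.cov22_comm x 2 a b 3
    - N.cov22_symm hx 0 1 a b - N.cov22_symm hx 1 0 a b + N.cov22_symm hx 2 3 a b
    + N.cov22_symm hx 3 2 a b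
    + N.cov22_symm hx 0 b a 1 + N.cov22_symm hx 1 b a 0 - N.cov22_symm hx 2 b a 3
    - N.cov22_symm hx 3 b a 2

/-- `t_a = Γ_{a0}^0 + Γ_{a2}^2`, the connection on scalars of weight `{2,0}`. -/
def _root_.GHP.TetradAlgebra.wt (F : TetradAlgebra R) (a : Fin 4) : R := F.gam a 0 1 + F.gam a 3 2

theorem lin_02 (x : Fin 4 → Fin 4 → V) (a b : Fin 4) :
    N.lin x a b 0 2 = N.D a (N.om x b 0 2) - N.D b (N.om x a 0 2)
      - ∑ h, F.strc a b h • N.om x h 0 2 - F.wt a • N.om x b 0 2 + F.wt b • N.om x a 0 2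
      + F.gam a 0 2 • (N.om x b 0 1 + N.om x b 3 2)
      - F.gam b 0 2 • (N.om x a 0 1 + N.om x a 3 2) := by
  have e0 : ∀ a b, N.om x a b b = 0 := fun a b ↦ by simp only [om]; abel
  simp only [lin, cov3, strc, wt, Fin.sum_univ_four, F.Gam_eval a, F.Gam_eval b, e0]
  module

theorem lin_01 (x : Fin 4 → Fin 4 → V) (a b : Fin 4) :
    N.lin x a b 0 1 + N.lin x a b 3 2 = N.D a (N.om x b 0 1 + N.om x b 3 2)
      - N.D b (N.om x a 0 1 + N.om x a 3 2)
      - ∑ h, F.strc a b h • (N.om x h 0 1 + N.om x h 3 2)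
      + (2 * F.gam a 0 2) • N.om x b 3 1 + (2 * F.gam a 1 3) • N.om x b 0 2
      - (2 * F.gam b 0 2) • N.om x a 3 1 - (2 * F.gam b 1 3) • N.om x a 0 2 := by
  have e : ∀ a b c, N.om x a b c = -N.om x a c b := fun a b c ↦ by simp only [om]; abel
  have e0 : ∀ a b, N.om x a b b = 0 := fun a b ↦ by simp only [om]; abel
  simp only [lin, cov3, strc, Fin.sum_univ_four, F.Gam_eval a, F.Gam_eval b, e0, map_add]
  simp only [fun a ↦ e a 1 2, fun a ↦ e a 3 0]
  module

end TetradAlgebra.Conn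

end

section

namespace TetradAlgebra.Conn
variable {R : Type*} [CommRing R] {F : TetradAlgebra R}
variable {V : Type*} [AddCommGroup V] [Module R V] (N : F.Conn V)

/-- The `ll`-part of the exterior covariant derivative of a perturbation `(A, B)` of the self-dual
connection. -/
def ext0 (A B : Fin 4 → V) (a b : Fin 4) : V :=
  N.D a (A b) - N.D b (A a) - ∑ h, F.strc a b h • A h - F.wt a • A b + F.wt b • A a
      + F.gam a 0 2 • B b - F.gam b 0 2 • B a

/-- The diagonal part of the exterior covariant derivative of a perturbation `(A, B, C)` of the
self-dual connection. -/
def ext1 (A B C : Fin 4 → V) (a b : Fin 4) : V :=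
  N.D a (B b) - N.D b (B a) - ∑ h, F.strc a b h • B h
      + (2 * F.gam a 0 2) • C b + (2 * F.gam a 1 3) • A b
      - (2 * F.gam b 0 2) • C a - (2 * F.gam b 1 3) • A a

theorem bianchi (A B C : Fin 4 → V) (a b c : Fin 4) :
    N.D a (N.ext0 A B b c) + N.D b (N.ext0 A B c a) + N.D c (N.ext0 A B a b)
      - ∑ h, (F.strc a b h • N.ext0 A B h c + F.strc b c h • N.ext0 A B h a
          + F.strc c a h • N.ext0 A B h b)
      - F.wt a • N.ext0 A B b c - F.wt b • N.ext0 A B c a - F.wt c • N.ext0 A B a b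
      + F.gam a 0 2 • N.ext1 A B C b c + F.gam b 0 2 • N.ext1 A B C c a
      + F.gam c 0 2 • N.ext1 A B C a b =
    F.riem a b 0 2 • B c + F.riem b c 0 2 • B a + F.riem c a 0 2 • B b
     - (F.riemUp a b 0 0 + F.riemUp a b 2 2) • A c
     - (F.riemUp b c 0 0 + F.riemUp b c 2 2) • A a
     - (F.riemUp c a 0 0 + F.riemUp c a 2 2) • A b := by
  have e : ∀ a b c, F.strc a b c = -F.strc b a c := fun a b c ↦ by simp only [strc]; ring
  have eA := fun i j k ↦ N.comm i j (A k)
  have j := F.jacobi' a b c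
  simp only [Fin.sum_univ_four] at eA j
  simp only [ext0, ext1, riem, sgn, dual, riemUp, wt, Fin.sum_univ_four, N.leibniz,
    F.Gam_eval, map_add, map_sub, map_neg, Matrix.cons_val, Int.cast_one, Int.cast_neg, one_mul,
    neg_mul, zero_mul, mul_zero]
  simp only [e 0 c, e 1 c, e 2 c, e 3 c, e 0 a, e 1 a, e 2 a, e 3 a,
    e 0 b, e 1 b, e 2 b, e 3 b] at j ⊢
  linear_combination (norm := module) eA a b c + eA b c a + eA c a b - j 0 • A 0 - j 1 • A 1
    - j 2 • A 2 - j 3 • A 3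

end TetradAlgebra.Conn

namespace TetradAlgebra
variable {R : Type*} [CommRing R] (F : TetradAlgebra R)

/-- The tetrad components of the curvature, the shear-free condition and the Bianchi identities
for `Ψ₂` in an Einstein spacetime of Petrov type II; `L = 2Λ`. -/
structure TypeII where
  L : R
  psi2 : R
  psi2b : R
  psi3 : R
  psi3b : R
  psi4 : R
  psi4b : R
  kappa : F.gam 0 0 2 = 0
  kappab : F.gam 0 0 3 = 0
  sigma : F.gam 2 0 2 = 0
  sigmab : F.gam 3 0 3 = 0
  D_L (a : Fin 4) : F.D a L = 0
  D0_psi2 : F.D 0 psi2 = 3 * F.gam 3 0 2 * psi2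
  D2_psi2 : F.D 2 psi2 = 3 * F.gam 1 0 2 * psi2
  riem_01 : F.riem 0 1 0 1 = psi2 + psi2b - L ∧ F.riem 0 1 0 2 = 0 ∧ F.riem 0 1 0 3 = 0 ∧
    F.riem 0 1 1 2 = psi3b ∧ F.riem 0 1 1 3 = psi3 ∧ F.riem 0 1 2 3 = psi2b - psi2
  riem_02 : F.riem 0 2 0 1 = 0 ∧ F.riem 0 2 0 2 = 0 ∧ F.riem 0 2 0 3 = 0 ∧
    F.riem 0 2 1 2 = 0 ∧ F.riem 0 2 1 3 = -(psi2 + L) ∧ F.riem 0 2 2 3 = 0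
  riem_03 : F.riem 0 3 0 1 = 0 ∧ F.riem 0 3 0 2 = 0 ∧ F.riem 0 3 0 3 = 0 ∧
    F.riem 0 3 1 2 = -(psi2b + L) ∧ F.riem 0 3 1 3 = 0 ∧ F.riem 0 3 2 3 = 0
  riem_12 : F.riem 1 2 0 1 = psi3b ∧ F.riem 1 2 0 2 = 0 ∧ F.riem 1 2 0 3 = -(psi2b + L) ∧
    F.riem 1 2 1 2 = psi4b ∧ F.riem 1 2 1 3 = 0 ∧ F.riem 1 2 2 3 = psi3b
  riem_13 : F.riem 1 3 0 1 = psi3 ∧ F.riem 1 3 0 2 = -(psi2 + L) ∧ F.riem 1 3 0 3 = 0 ∧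
    F.riem 1 3 1 2 = 0 ∧ F.riem 1 3 1 3 = psi4 ∧ F.riem 1 3 2 3 = -psi3
  riem_23 : F.riem 2 3 0 1 = psi2b - psi2 ∧ F.riem 2 3 0 2 = 0 ∧ F.riem 2 3 0 3 = 0 ∧
    F.riem 2 3 1 2 = psi3b ∧ F.riem 2 3 1 3 = -psi3 ∧ F.riem 2 3 2 3 = psi2 + psi2b - L

theorem riem_swap_left (a b c d : Fin 4) : F.riem a b c d = -F.riem b a c d := by
  simp only [riem, riemUp, strc, Fin.sum_univ_four]; ring

theorem riem_self_left (a c d : Fin 4) : F.riem a a c d = 0 := by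
  simp only [riem, riemUp, strc, Fin.sum_univ_four]; ring

theorem riemUp_eval (a b : Fin 4) :
    F.riemUp a b 0 0 = F.riem a b 0 1 ∧ F.riemUp a b 0 1 = 0 ∧ F.riemUp a b 0 2 = -F.riem a b 0 3 ∧
    F.riemUp a b 0 3 = -F.riem a b 0 2 ∧
    F.riemUp a b 1 0 = 0 ∧ F.riemUp a b 1 1 = -F.riem a b 0 1 ∧
    F.riemUp a b 1 2 = -F.riem a b 1 3 ∧ F.riemUp a b 1 3 = -F.riem a b 1 2 ∧
    F.riemUp a b 2 0 = -F.riem a b 1 2 ∧ F.riemUp a b 2 1 = -F.riem a b 0 2 ∧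
    F.riemUp a b 2 2 = -F.riem a b 2 3 ∧ F.riemUp a b 2 3 = 0 ∧
    F.riemUp a b 3 0 = -F.riem a b 1 3 ∧ F.riemUp a b 3 1 = -F.riem a b 0 3 ∧
    F.riemUp a b 3 2 = 0 ∧ F.riemUp a b 3 3 = F.riem a b 2 3 := by
  simp only [riem, riemUp, sgn, dual, Fin.sum_univ_four, Matrix.cons_val, F.Gam_eval, map_neg,
    map_zero, Int.cast_one, Int.cast_neg]
  refine ⟨?_, ?_, ?_, ?_, ?_, ?_, ?_, ?_, ?_, ?_, ?_, ?_, ?_, ?_, ?_, ?_⟩ <;> ring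

end TetradAlgebra

namespace TetradAlgebra.Conn
variable {R : Type*} [CommRing R] {F : TetradAlgebra R}
variable {V : Type*} [AddCommGroup V] [Module R V] (N : F.Conn V)

/-- The covariant derivative along `e_a` of a scalar of boost weight `p` and spin weight `q`. -/
def d (p q : ℤ) (a : Fin 4) (v : V) : V :=
  N.D a v - ((p : R) * F.gam a 0 1 + (q : R) * F.gam a 3 2) • v

/-- The first-order operator applied by `ð - 4τ - τ̄'` in `S`. -/
def Sy (x : Fin 4 → Fin 4 → V) : V :=
  N.d 1 1 0 (x 0 2) - (2 * F.gam 2 0 3) • x 0 2 - (N.d 2 0 2 (x 0 0) - F.gam 0 1 2 • x 0 0)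

/-- The first-order operator applied by `þ - 4ρ - ρ̄` in `S`. -/
def Sz (x : Fin 4 → Fin 4 → V) : V :=
  F.gam 2 1 2 • x 0 0 + (N.d 1 1 2 (x 0 2) - (2 * F.gam 0 1 2) • x 0 2)
    - (N.d 0 2 0 (x 2 2) - F.gam 2 0 3 • x 2 2)

/-- The operator `S`. -/
def S (x : Fin 4 → Fin 4 → V) : V :=
  (N.d 2 1 2 (N.Sy x) - (4 * F.gam 1 0 2 + F.gam 0 1 2) • N.Sy x)
    + (N.d 1 2 0 (N.Sz x) - (4 * F.gam 3 0 2 + F.gam 2 0 3) • N.Sz x)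

theorem lin_diff (H : F.TypeII) {x : Fin 4 → Fin 4 → V} (hx : ∀ a b, x a b = x b a) :
    N.lin x 0 1 0 2 - N.lin x 2 3 0 2 = N.lin x 0 2 0 1 + N.lin x 0 2 3 2  := by
  rw [N.lin_pair hx 0 1 0 2, N.lin_pair hx 2 3 0 2, (N.lin_anti x 0 2 2 3).2]
  simp only [curv, Fin.sum_univ_four, F.riemUp_eval, F.riem_swap_left 1 0, F.riem_swap_left 2 0,
     F.riem_swap_left 3 0, F.riem_swap_left 2 1, F.riem_swap_left 3 1, F.riem_swap_left 3 2,
     F.riem_self_left,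
    H.riem_01, H.riem_02, H.riem_03, H.riem_12,
    H.riem_13, H.riem_23, hx 1 0, hx 2 0, hx 3 0, hx 2 1, hx 3 1, hx 3 2]
  module

theorem E2_ll (H : F.TypeII) {x : Fin 4 → Fin 4 → V} (hx : ∀ a b, x a b = x b a) :
    N.E2 H.L x 0 0 = (2 * (H.L + H.psi2)) • x 0 0 - (2:R) • N.lin x 0 3 0 2 := by
  rw [N.E2_eq_lin hx _ _ _ (by decide)]
  have h (a b c) : N.lin x a a b c = 0 := by rw [lin]; abel
  have h' (a b c) : N.lin x a b c c = 0 := by simp only [lin_eq]; abel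
  simp only [Fin.sum_univ_four, sgn, dual, Matrix.cons_val, h, h', (N.lin_anti x _ _ 2 0).2]
  rw [N.lin_pair hx 0 2 0 3]
  simp only [curv, Fin.sum_univ_four, F.riemUp_eval, F.riem_swap_left 1 0, F.riem_swap_left 2 0,
     F.riem_swap_left 3 0, F.riem_swap_left 2 1, F.riem_swap_left 3 1, F.riem_swap_left 3 2,
     F.riem_self_left,
    H.riem_01, H.riem_02, H.riem_03, H.riem_12,
    H.riem_13, H.riem_23, hx 1 0, hx 2 0, hx 3 0, hx 2 1, hx 3 1, hx 3 2]
  module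

theorem E2_lm (H : F.TypeII) {x : Fin 4 → Fin 4 → V} (hx : ∀ a b, x a b = x b a) :
    N.E2 H.L x 0 2 = (2 * (H.L + H.psi2)) • x 0 2 - N.lin x 0 1 0 2 - N.lin x 2 3 0 2 := by
  rw [N.E2_eq_lin hx _ _ _ (by decide)]
  have h (a b c) : N.lin x a a b c = 0 := by rw [lin]; abel
  have h' (a b c) : N.lin x a b c c = 0 := by simp only [lin_eq]; abel
  simp only [Fin.sum_univ_four, sgn, dual, Matrix.cons_val, h, h', (N.lin_anti x _ _ 2 0).2]
  rw [N.lin_pair hx 2 3 0 2]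
  simp only [curv, Fin.sum_univ_four, F.riemUp_eval, F.riem_swap_left 1 0, F.riem_swap_left 2 0,
     F.riem_swap_left 3 0, F.riem_swap_left 2 1, F.riem_swap_left 3 1, F.riem_swap_left 3 2,
     F.riem_self_left,
    H.riem_01, H.riem_02, H.riem_03, H.riem_12,
    H.riem_13, H.riem_23, hx 1 0, hx 2 0, hx 3 0, hx 2 1, hx 3 1, hx 3 2]
  module

theorem E2_mm (H : F.TypeII) {x : Fin 4 → Fin 4 → V} (hx : ∀ a b, x a b = x b a) :
    N.E2 H.L x 2 2 = (2 * (H.L + H.psi2)) • x 2 2 + (2:R) • N.lin x 1 2 0 2 := by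
  rw [N.E2_eq_lin hx _ _ _ (by decide)]
  have h (a b c) : N.lin x a a b c = 0 := by rw [lin]; abel
  have h' (a b c) : N.lin x a b c c = 0 := by simp only [lin_eq]; abel
  simp only [Fin.sum_univ_four, sgn, dual, Matrix.cons_val, h, h', (N.lin_anti x _ _ 2 0).2,(N.lin_anti x 2 0 _ _).1,
   (N.lin_anti x 2 1 _ _).1, (N.lin_anti x _ _ 2 1).2]
  rw [N.lin_pair hx 0 2 1 2]
  simp only [curv, Fin.sum_univ_four, F.riemUp_eval, F.riem_swap_left 1 0, F.riem_swap_left 2 0,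
     F.riem_swap_left 3 0, F.riem_swap_left 2 1, F.riem_swap_left 3 1, F.riem_swap_left 3 2,
     F.riem_self_left,
    H.riem_01, H.riem_02, H.riem_03, H.riem_12,
    H.riem_13, H.riem_23, hx 1 0, hx 2 0, hx 3 0, hx 2 1, hx 3 1, hx 3 2]
  module
end TetradAlgebra.Conn

end

section

namespace TetradAlgebra
variable {R : Type*} [CommRing R] {F : TetradAlgebra R}
variable {V : Type*} [AddCommGroup V] [Module R V] (N : F.Conn V)

theorem Conn.lin_eq_ext0 (x : Fin 4 → Fin 4 → V) (a b : Fin 4) : N.lin x a b 0 2 =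
    N.ext0 (fun c ↦ N.om x c 0 2) (fun c ↦ N.om x c 0 1 + N.om x c 3 2) a b := N.lin_02 x a b

theorem Conn.lin_eq_ext1 (x : Fin 4 → Fin 4 → V) (a b : Fin 4) :
    N.lin x a b 0 1 + N.lin x a b 3 2 =
    N.ext1 (fun c ↦ N.om x c 0 2) (fun c ↦ N.om x c 0 1 + N.om x c 3 2)
      (fun c ↦ N.om x c 3 1) a b := N.lin_01 x a b

namespace TypeII

theorem om_lm_l (H : F.TypeII) {x : Fin 4 → Fin 4 → V} (hx : ∀ a b, x a b = x b a) :
    N.om x 0 0 2 = -N.Sy x := by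
  simp only [Conn.om, Conn.cov2, Conn.Sy, Conn.d, Fin.sum_univ_four, F.Gam_eval, H.kappa, H.kappab, H.sigma,
    H.sigmab, hx 1 0, hx 2 0, hx 3 0, hx 2 1, hx 3 1, hx 3 2]
  module

theorem om_lm_m (H : F.TypeII) {x : Fin 4 → Fin 4 → V} (hx : ∀ a b, x a b = x b a) :
    N.om x 2 0 2 = N.Sz x := by
  simp only [Conn.om, Conn.cov2, Conn.Sz, Conn.d, Fin.sum_univ_four, F.Gam_eval, H.kappa, H.kappab, H.sigma,
    H.sigmab, hx 1 0, hx 2 0, hx 3 0, hx 2 1, hx 3 1, hx 3 2]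
  module

theorem D_ofNat (a : Fin 4) (n : ℕ) [n.AtLeastTwo] : F.D a (ofNat(n) : R) = 0 :=
  (F.D a).map_natCast n

theorem lin_lnlm (H : F.TypeII) {x : Fin 4 → Fin 4 → V} (hx : ∀ a b, x a b = x b a) :
    N.lin x 0 1 0 2 = N.lin x 2 3 0 2 + (N.lin x 0 2 0 1 + N.lin x 0 2 3 2) := by
  rw [← N.lin_diff H hx]; abel

theorem Sy_E2 (H : F.TypeII) {x : Fin 4 → Fin 4 → V} (hx : ∀ a b, x a b = x b a) :
    N.Sy (N.E2 H.L x) =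
      (2 : R) • (N.d 2 2 3 (N.lin x 0 2 0 2) - F.gam 0 1 3 • N.lin x 0 2 0 2)
      - (N.d 1 1 0 (N.lin x 0 2 0 1 + N.lin x 0 2 3 2)
        - (4 * F.gam 3 0 2) • (N.lin x 0 2 0 1 + N.lin x 0 2 3 2))
      + (6 * H.psi2) • (N.Sy x + F.gam 3 0 2 • x 0 2 - F.gam 1 0 2 • x 0 0) := by
  have b := N.bianchi (fun c ↦ N.om x c 0 2) (fun c ↦ N.om x c 0 1 + N.om x c 3 2)
      (fun c ↦ N.om x c 3 1) 0 2 3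
  simp only [← Conn.lin_eq_ext0, ← Conn.lin_eq_ext1, H.om_lm_l N hx, H.om_lm_m N hx] at b
  have h (a b c) : N.lin x a a b c = 0 := by rw [Conn.lin]; abel
  rw [Conn.Sy, N.E2_ll H hx, N.E2_lm H hx]
  simp only [Fin.sum_univ_four, strc, F.Gam_eval, H.kappa, H.sigma, H.kappab, H.sigmab, wt, h,
    F.riemUp_eval, F.riem_swap_left 3 0, H.riem_02, H.riem_03, H.riem_23,
    (N.lin_anti x 3 0 _ _).1, (N.lin_anti x 3 2 _ _).1, (N.lin_anti x 2 0 _ _).1,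
    (N.lin_anti x 1 0 _ _).1, map_neg] at b
  simp only [Conn.d, Conn.Sy, map_add, map_sub, N.leibniz, H.D_L, H.D0_psi2, H.D2_psi2,
    Derivation.leibniz, D_ofNat, H.lin_lnlm N hx] at b ⊢
  linear_combination (norm := module) (-2 : R) • b

theorem Sz_E2 (H : F.TypeII) {x : Fin 4 → Fin 4 → V} (hx : ∀ a b, x a b = x b a) :
    N.Sz (N.E2 H.L x) =
      -(2 : R) • (N.d 2 2 1 (N.lin x 0 2 0 2) - F.gam 2 1 3 • N.lin x 0 2 0 2)
      + (N.d 1 1 2 (N.lin x 0 2 0 1 + N.lin x 0 2 3 2)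
        - (4 * F.gam 1 0 2) • (N.lin x 0 2 0 1 + N.lin x 0 2 3 2))
      + (6 * H.psi2) • (N.Sz x + F.gam 1 0 2 • x 0 2 - F.gam 3 0 2 • x 2 2) := by
  have b := N.bianchi (fun c ↦ N.om x c 0 2) (fun c ↦ N.om x c 0 1 + N.om x c 3 2)
      (fun c ↦ N.om x c 3 1) 0 1 2
  simp only [← Conn.lin_eq_ext0, ← Conn.lin_eq_ext1, H.om_lm_l N hx, H.om_lm_m N hx] at b
  have h (a b c) : N.lin x a a b c = 0 := by rw [Conn.lin]; abel
  rw [Conn.Sz, N.E2_ll H hx, N.E2_lm H hx, N.E2_mm H hx]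
  simp only [Fin.sum_univ_four, strc, F.Gam_eval, H.kappa, H.sigma, H.kappab, H.sigmab, wt, h,
    F.riemUp_eval, F.riem_swap_left 2 0, H.riem_02, H.riem_01, H.riem_12,
    (N.lin_anti x 3 0 _ _).1, (N.lin_anti x 3 2 _ _).1, (N.lin_anti x 2 0 _ _).1,
    (N.lin_anti x 1 0 _ _).1, (N.lin_anti x 2 1 _ _).1, (N.lin_anti x 3 1 _ _).1, map_neg] at b
  simp only [Conn.d, Conn.Sz, map_add, map_sub, N.leibniz, H.D_L, H.D0_psi2, H.D2_psi2,
    Derivation.leibniz, D_ofNat, H.lin_lnlm N hx] at b ⊢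
  linear_combination (norm := module) (-2 : R) • b

end TypeII
end TetradAlgebra

end

section

namespace TetradAlgebra
variable {R : Type*} [CommRing R] {F : TetradAlgebra R}
variable {V : Type*} [AddCommGroup V] [Module R V] (N : F.Conn V)

/-- Twice the operator `T`. -/
def Conn.T2 (x : Fin 4 → Fin 4 → V) : V :=
  (N.d 2 1 2 (N.d 2 0 2 (x 0 0)) - (2 * F.gam 0 1 2) • N.d 2 0 2 (x 0 0)
    - F.gam 2 1 2 • (N.d 2 0 0 (x 0 0) - (2 * F.gam 2 0 3) • x 0 0)
    - (2 * (F.D 0 (F.gam 2 1 2) + F.gam 0 0 1 * F.gam 2 1 2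
        - 2 * F.gam 0 3 2 * F.gam 2 1 2)) • x 0 0)
  + (N.d 1 2 0 (N.d 0 2 0 (x 2 2)) - (2 * F.gam 2 0 3) • N.d 0 2 0 (x 2 2))
  - (2 : R) • ((N.d 1 2 0 (N.d 1 1 2 (x 0 2) - F.gam 0 1 2 • x 0 2)
        - (2 * F.gam 2 0 3) • (N.d 1 1 2 (x 0 2) - F.gam 0 1 2 • x 0 2))
      - (F.D 2 (F.gam 2 0 3) - F.gam 2 0 1 * F.gam 2 0 3) • x 0 2)

namespace TypeII

/-- The Ricci identities along `l` and `m`. -/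
theorem ricci_eqs (H : F.TypeII) :
    F.D 0 (F.gam 2 0 1) = F.D 2 (F.gam 0 0 1) - F.gam 2 0 1 * F.gam 0 0 1
      + F.gam 2 0 1 * F.gam 2 0 3 + F.gam 2 0 1 * F.gam 0 3 2 - F.gam 0 0 1 * F.gam 0 1 2
      - F.gam 2 0 3 * F.gam 0 1 2 ∧
    F.D 0 (F.gam 2 3 2) = F.D 2 (F.gam 0 3 2) - F.gam 2 0 1 * F.gam 0 3 2
      + F.gam 2 0 3 * F.gam 0 1 2 + F.gam 2 0 3 * F.gam 2 3 2 - F.gam 0 1 2 * F.gam 0 3 2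
      + F.gam 0 3 2 * F.gam 2 3 2 ∧
    F.D 0 (F.gam 1 0 2) = F.gam 0 3 2 * F.gam 1 0 2 + F.gam 3 0 2 * (F.gam 1 0 2 - F.gam 0 1 2) ∧
    F.D 2 (F.gam 3 0 2) = F.gam 2 0 1 * F.gam 3 0 2 + F.gam 1 0 2 * (F.gam 3 0 2 - F.gam 2 0 3) ∧
    F.D 0 (F.gam 2 1 2) = F.D 2 (F.gam 0 1 2) - F.gam 0 0 1 * F.gam 2 1 2
      + F.gam 2 0 3 * F.gam 2 1 2 - F.gam 0 1 2 * F.gam 2 3 2 - F.gam 0 1 2 ^ 2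
      + 2 * F.gam 2 1 2 * F.gam 0 3 2 ∧
    F.D 0 (F.gam 2 0 3) = F.gam 0 0 1 * F.gam 2 0 3 + F.gam 2 0 3 ^ 2 ∧
    F.D 0 (F.gam 3 0 2) = F.gam 0 0 1 * F.gam 3 0 2 + F.gam 3 0 2 ^ 2 ∧
    F.D 2 (F.gam 1 0 2) = F.gam 2 3 2 * F.gam 1 0 2 + F.gam 1 0 2 ^ 2
      - F.gam 2 1 2 * F.gam 3 0 2 := by
  have r1 := H.riem_02.1
  have r2 := H.riem_02.2.2.2.2.2
  have r3 := H.riem_01.2.1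
  have r4 := H.riem_23.2.1
  have r5 := H.riem_02.2.2.2.1
  have r6 := H.riem_02.2.2.1
  have r7 := H.riem_03.2.1
  have r8 := H.riem_12.2.1
  simp only [riem, riemUp, strc, sgn, dual, Fin.sum_univ_four, F.Gam_eval, H.kappa, H.sigma,
    H.kappab, H.sigmab, Matrix.cons_val, map_zero, map_neg, Int.cast_one, Int.cast_neg]
    at r1 r2 r3 r4 r5 r6 r7 r8
  refine ⟨?_, ?_, ?_, ?_, ?_, ?_, ?_, ?_⟩
  · linear_combination r1
  · linear_combination -r2
  · linear_combination r3
  · linear_combination r4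
  · linear_combination r5
  · linear_combination r6
  · linear_combination r7
  · linear_combination -r8

theorem comm_lm (H : F.TypeII) (v : V) : N.D 0 (N.D 2 v) = N.D 2 (N.D 0 v)
    - (F.gam 0 1 2 + F.gam 2 0 1) • N.D 0 v + (F.gam 0 3 2 + F.gam 2 0 3) • N.D 2 v := by
  rw [N.comm 0 2 v]
  simp only [strc, Fin.sum_univ_four, F.Gam_eval, H.kappa, H.sigma]
  module

/-- The operators `þ - 4ρ` and `ð - 4τ` on weight `{2,0}` commute up to lower-order terms. -/
theorem tho_edt_comm (H : F.TypeII) (v : V) :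
    (N.d 2 1 2 (N.d 1 1 0 v - (4 * F.gam 3 0 2) • v)
      - (4 * F.gam 1 0 2 + F.gam 0 1 2) • (N.d 1 1 0 v - (4 * F.gam 3 0 2) • v)) =
    (N.d 1 2 0 (N.d 1 1 2 v - (4 * F.gam 1 0 2) • v)
      - (4 * F.gam 3 0 2 + F.gam 2 0 3) • (N.d 1 1 2 v - (4 * F.gam 1 0 2) • v)) := by
  simp only [Conn.d, Int.cast_one, Int.cast_ofNat, Int.cast_zero, one_mul, map_sub, N.leibniz,
    Derivation.leibniz, map_add, H.ricci_eqs, D_ofNat, H.comm_lm]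
  module

theorem lin_lmlm (H : F.TypeII) {x : Fin 4 → Fin 4 → V} (hx : ∀ a b, x a b = x b a) :
    N.lin x 0 2 0 2 =
      (N.d 2 1 2 (N.Sy x + F.gam 3 0 2 • x 0 2 - F.gam 1 0 2 • x 0 0)
        - (F.gam 1 0 2 + F.gam 0 1 2) • (N.Sy x + F.gam 3 0 2 • x 0 2 - F.gam 1 0 2 • x 0 0))
      + (N.d 1 2 0 (N.Sz x + F.gam 1 0 2 • x 0 2 - F.gam 3 0 2 • x 2 2)
        - (F.gam 3 0 2 + F.gam 2 0 3) • (N.Sz x + F.gam 1 0 2 • x 0 2 - F.gam 3 0 2 • x 2 2)) := by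
  rw [N.lin_02, H.om_lm_l N hx, H.om_lm_m N hx]
  simp only [strc, Fin.sum_univ_four, F.Gam_eval, H.kappa, H.sigma, H.om_lm_l N hx,
    H.om_lm_m N hx, wt]
  simp only [Conn.d, Conn.Sy, Conn.Sz, Int.cast_one, Int.cast_ofNat, Int.cast_zero, one_mul,
    zero_mul, map_sub, N.leibniz, Derivation.leibniz, map_add, map_neg, H.ricci_eqs, D_ofNat,
    H.comm_lm]
  module

theorem T2_eq (H : F.TypeII) {x : Fin 4 → Fin 4 → V} (hx : ∀ a b, x a b = x b a) :
    N.T2 x = -N.lin x 0 2 0 2 := by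
  rw [H.lin_lmlm N hx]
  simp only [Conn.T2, Conn.d, Conn.Sy, Conn.Sz, Int.cast_one, Int.cast_ofNat, Int.cast_zero,
    one_mul, zero_mul, map_sub, N.leibniz, Derivation.leibniz, map_add, map_neg, H.ricci_eqs,
    D_ofNat, H.comm_lm]
  module

/-- The operator `O` with `Ψ₂ = H.psi2`. -/
def O (H : F.TypeII) (v : V) : V :=
  (2 : R) • ((N.d 1 2 0 (N.d 2 2 1 v - F.gam 2 1 3 • v)
      - (4 * F.gam 3 0 2 + F.gam 2 0 3) • (N.d 2 2 1 v - F.gam 2 1 3 • v))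
    - (N.d 2 1 2 (N.d 2 2 3 v - F.gam 0 1 3 • v)
      - (4 * F.gam 1 0 2 + F.gam 0 1 2) • (N.d 2 2 3 v - F.gam 0 1 3 • v))
    - (3 * H.psi2) • v)

theorem d_add (p q : ℤ) (a : Fin 4) (v w : V) : N.d p q a (v + w) = N.d p q a v + N.d p q a w := by
  simp only [Conn.d, map_add]; module

theorem d_sub (p q : ℤ) (a : Fin 4) (v w : V) : N.d p q a (v - w) = N.d p q a v - N.d p q a w := by
  simp only [Conn.d, map_sub]; module

theorem d_neg (p q : ℤ) (a : Fin 4) (v : V) : N.d p q a (-v) = -N.d p q a v := by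
  simp only [Conn.d, map_neg]; module

theorem d_smul (p q : ℤ) (a : Fin 4) (f : R) (v : V) :
    N.d p q a (f • v) = F.D a f • v + f • N.d p q a v := by
  simp only [Conn.d, N.leibniz]; module

theorem S_E2 (H : F.TypeII) {x : Fin 4 → Fin 4 → V} (hx : ∀ a b, x a b = x b a) :
    N.S (N.E2 H.L x) = H.O N (N.T2 x) := by
  rw [Conn.S, H.Sy_E2 N hx, H.Sz_E2 N hx, H.T2_eq N hx, O]
  have c := H.tho_edt_comm N (N.lin x 0 2 0 1 + N.lin x 0 2 3 2)
  have l := H.lin_lmlm N hx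
  generalize N.lin x 0 2 0 2 = f at *
  generalize N.lin x 0 2 0 1 + N.lin x 0 2 3 2 = g at *
  generalize N.Sy x + F.gam 3 0 2 • x 0 2 - F.gam 1 0 2 • x 0 0 = k at *
  generalize N.Sz x + F.gam 1 0 2 • x 0 2 - F.gam 3 0 2 • x 2 2 = k' at *
  simp only [d_add N 1 2, d_sub N 1 2, d_smul N 1 2, d_neg N 1 2, d_add N 2 1, d_sub N 2 1,
    d_smul N 2 1, d_neg N 2 1, d_neg N 2 2, D_ofNat, Derivation.leibniz, map_neg, H.D0_psi2,
    H.D2_psi2] at c ⊢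
  linear_combination (norm := module) -(6 * H.psi2) • l - c
end TypeII
end TetradAlgebra

end

section

namespace TetradAlgebra
variable {R : Type*} [CommRing R] (F : TetradAlgebra R)

theorem riemUp_cyclic (a b c d : Fin 4) :
    F.riemUp a b c d + F.riemUp b c a d + F.riemUp c a b d = 0 := by
  have j := F.jacobi' a b c d
  simp only [riemUp, strc, Fin.sum_univ_four, map_sub] at j ⊢
  linear_combination j

theorem riem_cyclic (a b c d : Fin 4) :
    F.riem a b c d + F.riem b c a d + F.riem c a b d = 0 := by
  simp only [riem, ← mul_add, riemUp_cyclic, mul_zero]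

theorem riem_swap_right (a b c d : Fin 4) : F.riem a b c d = -F.riem a b d c := by
  have e := F.riemUp_eval a b
  simp only [riem, sgn, dual, Matrix.cons_val, Int.cast_one, Int.cast_neg, one_mul, true_and,
    neg_mul, neg_neg] at e
  fin_cases c <;> fin_cases d <;> simp [riem, sgn, dual, e]

theorem riem_pair (h2 : ∀ f : R, 2 * f = 0 → f = 0) (a b c d : Fin 4) :
    F.riem a b c d = F.riem c d a b := by
  refine sub_eq_zero.1 (h2 _ ?_)
  linear_combination F.riem_cyclic a b c d + F.riem_cyclic b c d a - F.riem_cyclic c d a b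
    - F.riem_cyclic d a b c + F.riem_swap_right a b c d - F.riem_swap_right b c a d
    - F.riem_swap_right c d a b + F.riem_swap_right d a c b - F.riem_swap_left c a b d
    + F.riem_swap_right a c d b - F.riem_swap_left d b c a + F.riem_swap_right b d a c

/-- The Ricci tensor `R_{acb}^c`. -/
def ricci (a b : Fin 4) : R := ∑ c, F.riemUp a c b c

/-- The module of functions. -/
def fn : F.Conn R where
  D a := (F.D a : R →+ R)
  leibniz a f v := by simp [add_comm, mul_comm]
  comm a b v := F.comm' a b v

theorem riem_eq_ext0 (a b : Fin 4) :
    F.riem a b 0 2 = F.fn.ext0 (fun c ↦ F.gam c 0 2) 0 a b := by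
  simp [riem, riemUp, Conn.ext0, fn, sgn, dual, F.Gam_eval, Fin.sum_univ_four, wt]
  ring

theorem riem_bianchi (a b c : Fin 4) :
    F.D a (F.riem b c 0 2) + F.D b (F.riem c a 0 2) + F.D c (F.riem a b 0 2)
      - ∑ h, (F.strc a b h * F.riem h c 0 2 + F.strc b c h * F.riem h a 0 2
          + F.strc c a h * F.riem h b 0 2)
      - F.wt a * F.riem b c 0 2 - F.wt b * F.riem c a 0 2 - F.wt c * F.riem a b 0 2 =
    - (F.riem a b 0 1 - F.riem a b 2 3) * F.gam c 0 2
    - (F.riem b c 0 1 - F.riem b c 2 3) * F.gam a 0 2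
    - (F.riem c a 0 1 - F.riem c a 2 3) * F.gam b 0 2 := by
  have h := F.fn.bianchi (fun c ↦ F.gam c 0 2) 0 0 a b c
  simp only [← riem_eq_ext0, F.riemUp_eval, smul_eq_mul] at h
  simp only [Conn.ext1, fn, AddMonoidHom.coe_coe, Pi.zero_apply, map_zero, smul_eq_mul] at h
  simp only [mul_zero, Finset.sum_const_zero] at h
  linear_combination h

/-- The curvature components of an Einstein spacetime with `Ψ₀ = Ψ₁ = 0`. -/
structure Special (L : R) : Prop where
  two (f : R) : 2 * f = 0 → f = 0
  ricci_eq (a b : Fin 4) : F.ricci a b = if b = dual a then (sgn a : R) * (3 * L) else 0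
  psi0 : F.riem 0 2 0 2 = 0
  psi0b : F.riem 0 3 0 3 = 0
  psi1 : F.riem 0 2 0 1 = 0
  psi1b : F.riem 0 3 0 1 = 0
  D_L (a : Fin 4) : F.D a L = 0

namespace Special
variable {F} {L : R} (H : F.Special L)

theorem riem_values (H : F.Special L) :
    let psi2 := -F.riem 0 2 1 3 - L
    let psi2b := -F.riem 0 3 1 2 - L
    let psi3 := F.riem 0 1 1 3
    let psi3b := F.riem 0 1 1 2
    let psi4 := F.riem 1 3 1 3
    let psi4b := F.riem 1 2 1 2
    (F.riem 0 1 0 1 = psi2 + psi2b - L ∧ F.riem 0 1 0 2 = 0 ∧ F.riem 0 1 0 3 = 0 ∧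
    F.riem 0 1 1 2 = psi3b ∧ F.riem 0 1 1 3 = psi3 ∧ F.riem 0 1 2 3 = psi2b - psi2) ∧
    (F.riem 0 2 0 1 = 0 ∧ F.riem 0 2 0 2 = 0 ∧ F.riem 0 2 0 3 = 0 ∧
    F.riem 0 2 1 2 = 0 ∧ F.riem 0 2 1 3 = -(psi2 + L) ∧ F.riem 0 2 2 3 = 0) ∧
    (F.riem 0 3 0 1 = 0 ∧ F.riem 0 3 0 2 = 0 ∧ F.riem 0 3 0 3 = 0 ∧
    F.riem 0 3 1 2 = -(psi2b + L) ∧ F.riem 0 3 1 3 = 0 ∧ F.riem 0 3 2 3 = 0) ∧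
    (F.riem 1 2 0 1 = psi3b ∧ F.riem 1 2 0 2 = 0 ∧ F.riem 1 2 0 3 = -(psi2b + L) ∧
    F.riem 1 2 1 2 = psi4b ∧ F.riem 1 2 1 3 = 0 ∧ F.riem 1 2 2 3 = psi3b) ∧
    (F.riem 1 3 0 1 = psi3 ∧ F.riem 1 3 0 2 = -(psi2 + L) ∧ F.riem 1 3 0 3 = 0 ∧
    F.riem 1 3 1 2 = 0 ∧ F.riem 1 3 1 3 = psi4 ∧ F.riem 1 3 2 3 = -psi3) ∧
    (F.riem 2 3 0 1 = psi2b - psi2 ∧ F.riem 2 3 0 2 = 0 ∧ F.riem 2 3 0 3 = 0 ∧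
    F.riem 2 3 1 2 = psi3b ∧ F.riem 2 3 1 3 = -psi3 ∧ F.riem 2 3 2 3 = psi2 + psi2b - L) := by
  intro psi2 psi2b psi3 psi3b psi4 psi4b
  have p := F.riem_pair H.two
  have h00 := H.ricci_eq 0 0
  have h11 := H.ricci_eq 1 1
  have h22 := H.ricci_eq 2 2
  have h33 := H.ricci_eq 3 3
  have h01 := H.ricci_eq 0 1
  have h02 := H.ricci_eq 0 2
  have h03 := H.ricci_eq 0 3
  have h12 := H.ricci_eq 1 2
  have h13 := H.ricci_eq 1 3
  have h23 := H.ricci_eq 2 3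
  have c := F.riem_cyclic 0 1 2 3
  have z := F.riem_self_left
  simp [ricci, Fin.sum_univ_four, F.riemUp_eval, dual, sgn, z, F.riem_swap_left 1 0,
    F.riem_swap_left 2 0, F.riem_swap_left 3 0, F.riem_swap_left 2 1, F.riem_swap_left 3 1,
    F.riem_swap_left 3 2, p 0 2 0 1, p 0 3 0 1, p 1 2 0 1, p 1 3 0 1, p 2 3 0 1, p 0 3 0 2,
    p 1 2 0 2, p 1 3 0 2, p 2 3 0 2, p 1 2 0 3, p 1 3 0 3, p 2 3 0 3, p 1 3 1 2, p 2 3 1 2,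
    p 2 3 1 3, H.psi0, H.psi0b] at h00 h11 h22 h33 h01 h02 h03 h12 h13 h23 c
  have e1 : F.riem 0 1 0 2 = 0 := (p _ _ _ _).trans H.psi1
  have e2 : F.riem 0 1 0 3 = 0 := (p _ _ _ _).trans H.psi1b
  have e3 : F.riem 0 2 0 3 = 0 := H.two _ (by linear_combination -h00)
  have e4 : F.riem 1 2 1 3 = 0 := H.two _ (by linear_combination -h11)
  have e5 : F.riem 0 2 1 2 = 0 := H.two _ (by linear_combination h22)
  have e6 : F.riem 0 3 1 3 = 0 := H.two _ (by linear_combination h33)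
  have e7 : F.riem 0 1 0 1 = psi2 + psi2b - L := by simp only [psi2, psi2b]; linear_combination -h01
  have e8 : F.riem 0 2 2 3 = 0 := by linear_combination -h02 - e1
  have e9 : F.riem 0 3 2 3 = 0 := by linear_combination h03 + e2
  have e10 : F.riem 1 2 2 3 = psi3b := by simp only [psi3b]; linear_combination -h12
  have e11 : F.riem 1 3 2 3 = -psi3 := by simp only [psi3]; linear_combination h13
  have e12 : F.riem 2 3 2 3 = psi2 + psi2b - L := by
    simp only [psi2, psi2b]; linear_combination h23
  have e13 : F.riem 0 1 2 3 = psi2b - psi2 := by simp only [psi2, psi2b]; linear_combination c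
  have e14 : F.riem 0 2 1 3 = -(psi2 + L) := by simp only [psi2]; ring
  have e15 : F.riem 0 3 1 2 = -(psi2b + L) := by simp only [psi2b]; ring
  simp only [p 0 2 0 1, p 0 3 0 1, p 1 2 0 1, p 1 3 0 1, p 2 3 0 1, p 0 3 0 2,
    p 1 2 0 2, p 1 3 0 2, p 2 3 0 2, p 1 2 0 3, p 1 3 0 3, p 2 3 0 3, p 1 3 1 2, p 2 3 1 2,
    p 2 3 1 3, H.psi0, H.psi0b, e1, e2, e3, e4, e5, e6, e7, e8, e9, e10, e11, e12, e13, e14, e15,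
    psi3, psi3b, psi4, psi4b, and_self]

theorem exists_riem_values (H : F.Special L) : ∃ psi2 psi2b psi3 psi3b psi4 psi4b : R,
    psi2 = -F.riem 0 2 1 3 - L ∧
    (F.riem 0 1 0 1 = psi2 + psi2b - L ∧ F.riem 0 1 0 2 = 0 ∧ F.riem 0 1 0 3 = 0 ∧
    F.riem 0 1 1 2 = psi3b ∧ F.riem 0 1 1 3 = psi3 ∧ F.riem 0 1 2 3 = psi2b - psi2) ∧
    (F.riem 0 2 0 1 = 0 ∧ F.riem 0 2 0 2 = 0 ∧ F.riem 0 2 0 3 = 0 ∧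
    F.riem 0 2 1 2 = 0 ∧ F.riem 0 2 1 3 = -(psi2 + L) ∧ F.riem 0 2 2 3 = 0) ∧
    (F.riem 0 3 0 1 = 0 ∧ F.riem 0 3 0 2 = 0 ∧ F.riem 0 3 0 3 = 0 ∧
    F.riem 0 3 1 2 = -(psi2b + L) ∧ F.riem 0 3 1 3 = 0 ∧ F.riem 0 3 2 3 = 0) ∧
    (F.riem 1 2 0 1 = psi3b ∧ F.riem 1 2 0 2 = 0 ∧ F.riem 1 2 0 3 = -(psi2b + L) ∧
    F.riem 1 2 1 2 = psi4b ∧ F.riem 1 2 1 3 = 0 ∧ F.riem 1 2 2 3 = psi3b) ∧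
    (F.riem 1 3 0 1 = psi3 ∧ F.riem 1 3 0 2 = -(psi2 + L) ∧ F.riem 1 3 0 3 = 0 ∧
    F.riem 1 3 1 2 = 0 ∧ F.riem 1 3 1 3 = psi4 ∧ F.riem 1 3 2 3 = -psi3) ∧
    (F.riem 2 3 0 1 = psi2b - psi2 ∧ F.riem 2 3 0 2 = 0 ∧ F.riem 2 3 0 3 = 0 ∧
    F.riem 2 3 1 2 = psi3b ∧ F.riem 2 3 1 3 = -psi3 ∧ F.riem 2 3 2 3 = psi2 + psi2b - L) :=
  ⟨_, _, _, _, _, _, rfl, H.riem_values⟩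

/-- The Goldberg-Sachs theorem in the easy direction: `Ψ₂ ≠ 0` forces `κ = σ = 0`. -/
theorem kappa_sigma (H : F.Special L) (h : ∀ f, (-F.riem 0 2 1 3 - L) * f = 0 → f = 0)
    (h3 : ∀ f : R, 3 * f = 0 → f = 0) :
    F.gam 0 0 2 = 0 ∧ F.gam 2 0 2 = 0 := by
  obtain ⟨P, Pb, P3, P3b, P4, P4b, hP, v01, v02, v03, v12, v13, v23⟩ := H.exists_riem_values
  rw [← hP] at h
  have b1 := F.riem_bianchi 0 2 3
  have b2 := F.riem_bianchi 0 1 2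
  simp only [Fin.sum_univ_four, strc, F.Gam_eval, F.riem_self_left, F.riem_swap_left 1 0,
    F.riem_swap_left 2 0, F.riem_swap_left 3 0, F.riem_swap_left 2 1, F.riem_swap_left 3 1,
    F.riem_swap_left 3 2, v01, v02, v03, v12, v13, v23, map_zero, map_neg] at b1 b2
  exact ⟨h _ (h3 _ (by linear_combination -b1)), h _ (h3 _ (by linear_combination b2))⟩

/-- An Einstein tetrad algebra with `Ψ₀ = Ψ₁ = 0` and `κ = σ = 0` is of type II. -/
def typeII (H : F.Special L) (hk : F.gam 0 0 2 = 0) (hkb : F.gam 0 0 3 = 0)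
    (hs : F.gam 2 0 2 = 0) (hsb : F.gam 3 0 3 = 0) : F.TypeII where
  L := L
  psi2 := -F.riem 0 2 1 3 - L
  psi2b := -F.riem 0 3 1 2 - L
  psi3 := F.riem 0 1 1 3
  psi3b := F.riem 0 1 1 2
  psi4 := F.riem 1 3 1 3
  psi4b := F.riem 1 2 1 2
  kappa := hk
  kappab := hkb
  sigma := hs
  sigmab := hsb
  D_L := H.D_L
  D0_psi2 := by
    obtain ⟨P, Pb, P3, P3b, P4, P4b, hP, v01, v02, v03, v12, v13, v23⟩ := H.exists_riem_values
    rw [← hP]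
    have b1 := F.riem_bianchi 0 1 3
    simp only [Fin.sum_univ_four, strc, F.Gam_eval, F.riem_self_left, F.riem_swap_left 1 0,
      F.riem_swap_left 2 0, F.riem_swap_left 3 0, F.riem_swap_left 2 1, F.riem_swap_left 3 1,
      F.riem_swap_left 3 2, v01, v02, v03, v12, v13, v23, map_zero, map_neg, map_add, H.D_L,
      hk, hs, hkb, hsb, wt] at b1
    linear_combination -b1
  D2_psi2 := by
    obtain ⟨P, Pb, P3, P3b, P4, P4b, hP, v01, v02, v03, v12, v13, v23⟩ := H.exists_riem_values
    rw [← hP]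
    have b1 := F.riem_bianchi 1 2 3
    simp only [Fin.sum_univ_four, strc, F.Gam_eval, F.riem_self_left, F.riem_swap_left 1 0,
      F.riem_swap_left 2 0, F.riem_swap_left 3 0, F.riem_swap_left 2 1, F.riem_swap_left 3 1,
      F.riem_swap_left 3 2, v01, v02, v03, v12, v13, v23, map_zero, map_neg, map_add, H.D_L,
      hk, hs, hkb, hsb, wt] at b1
    linear_combination b1
  riem_01 := H.riem_values.1
  riem_02 := H.riem_values.2.1
  riem_03 := H.riem_values.2.2.1
  riem_12 := H.riem_values.2.2.2.1
  riem_13 := H.riem_values.2.2.2.2.1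
  riem_23 := H.riem_values.2.2.2.2.2

end Special
end TetradAlgebra

end

section

namespace TetradAlgebra
variable {R : Type*} [CommRing R] (F : TetradAlgebra R)

/-- The divergence of the frame vector `e_a`. -/
def dv (a : Fin 4) : R := ∑ b, F.Gam b a b

variable {F}
variable {U W V G : Type*} [AddCommGroup U] [Module R U] [AddCommGroup W] [Module R W]
  [AddCommGroup V] [Module R V] [AddCommGroup G]

namespace Conn
variable (N : F.Conn V) (K : F.Conn U) (J : F.Conn W)

/-- An additive functional that vanishes on divergences. -/
def IsIntegral (I : V →+ G) : Prop := ∀ a v, I (N.D a v) = -I (F.dv a • v)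

/-- A bilinear pairing of modules that satisfies the Leibniz rule. -/
def IsPairing (B : U →ₗ[R] W →ₗ[R] V) : Prop :=
  ∀ a u w, N.D a (B u w) = B (K.D a u) w + B u (J.D a w)

variable {N K J}

theorem IsPairing.flip {B : U →ₗ[R] W →ₗ[R] V} (hB : N.IsPairing K J B) :
    N.IsPairing J K B.flip := fun a w u ↦ by
  simp only [LinearMap.flip_apply, hB a u w]; abel

variable (N) in
/-- `∇_a w_b` for a covector `w`. -/
def cov1 (w : Fin 4 → V) (a b : Fin 4) : V := N.D a (w b) - ∑ h, F.Gam a b h • w h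

theorem IsIntegral.div {I : V →+ G} (hI : N.IsIntegral I) (w : Fin 4 → V) :
    I (∑ c, sgn c • N.cov1 w (dual c) c) = 0 := by
  simp only [Fin.sum_univ_four, sgn, dual, Matrix.cons_val, cov1, one_smul, neg_smul, F.Gam_eval,
    map_add, map_sub, map_neg, hI _ _]
  simp only [dv, Fin.sum_univ_four, F.Gam_eval, ← map_add, ← map_sub, ← map_neg]
  rw [← map_zero I]; congr 1
  module

/-- Full contraction of two 2-tensors. -/
def con2 (B : U →ₗ[R] W →ₗ[R] V) (h : Fin 4 → Fin 4 → U) (x : Fin 4 → Fin 4 → W) : V :=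
  ∑ a, ∑ b, (sgn a * sgn b) • B (h (dual a) (dual b)) (x a b)

/-- Full contraction of two 3-tensors. -/
def con3 (B : U →ₗ[R] W →ₗ[R] V) (h : Fin 4 → Fin 4 → Fin 4 → U)
    (x : Fin 4 → Fin 4 → Fin 4 → W) : V :=
  ∑ c, sgn c • con2 B (h (dual c)) (x c)

/-- Full contraction of two covectors. -/
def con1 (B : U →ₗ[R] W →ₗ[R] V) (h : Fin 4 → U) (x : Fin 4 → W) : V :=
  ∑ a, sgn a • B (h (dual a)) (x a)

theorem con1_Gam (B : U →ₗ[R] W →ₗ[R] V) (u : Fin 4 → U) (w : Fin 4 → W) (d : Fin 4) :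
    ∑ a, sgn a • B (∑ k, F.Gam d (dual a) k • u k) (w a)
      + ∑ a, sgn a • B (u (dual a)) (∑ k, F.Gam d a k • w k) = 0 := by
  simp only [Fin.sum_univ_four, sgn, dual, Matrix.cons_val, map_add, LinearMap.add_apply, map_smul,
    LinearMap.smul_apply, F.Gam_eval d]
  module

theorem con2_Gam_left (B : U →ₗ[R] W →ₗ[R] V) (u : Fin 4 → Fin 4 → U) (w : Fin 4 → Fin 4 → W)
    (d : Fin 4) :
    ∑ a, ∑ b, (sgn a * sgn b) • B (∑ k, F.Gam d (dual a) k • u k (dual b)) (w a b)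
      = -∑ a, ∑ b, (sgn a * sgn b) • B (u (dual a) (dual b)) (∑ k, F.Gam d a k • w k b) := by
  rw [← add_eq_zero_iff_eq_neg, Finset.sum_comm, Finset.sum_comm (f := fun a b ↦
    (sgn a * sgn b) • B (u (dual a) (dual b)) (∑ k, F.Gam d a k • w k b)),
    ← Finset.sum_add_distrib]
  refine Finset.sum_eq_zero fun b _ ↦ ?_
  have := congrArg (sgn b • ·) (con1_Gam (F := F) B (fun a ↦ u a (dual b)) (fun a ↦ w a b) d)
  simpa only [smul_add, Finset.smul_sum, smul_smul, smul_zero, mul_comm (sgn b)] using this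

theorem con2_Gam_right (B : U →ₗ[R] W →ₗ[R] V) (u : Fin 4 → Fin 4 → U) (w : Fin 4 → Fin 4 → W)
    (d : Fin 4) :
    ∑ a, ∑ b, (sgn a * sgn b) • B (∑ k, F.Gam d (dual b) k • u (dual a) k) (w a b)
      = -∑ a, ∑ b, (sgn a * sgn b) • B (u (dual a) (dual b)) (∑ k, F.Gam d b k • w a k) := by
  rw [← add_eq_zero_iff_eq_neg, ← Finset.sum_add_distrib]
  refine Finset.sum_eq_zero fun a _ ↦ ?_
  have := congrArg (sgn a • ·) (con1_Gam (F := F) B (u (dual a)) (w a) d)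
  simpa only [smul_add, Finset.smul_sum, smul_smul, smul_zero] using this

theorem IsPairing.cov_con2 {B : U →ₗ[R] W →ₗ[R] V} (hB : N.IsPairing K J B)
    (h : Fin 4 → Fin 4 → U) (y : Fin 4 → Fin 4 → Fin 4 → W) (d c : Fin 4) :
    N.cov1 (fun c ↦ con2 B h (y c)) d c
      = con2 B (K.cov2 h d) (y c) + con2 B h (J.cov3 y d c) := by
  have e : ∑ k, F.Gam d c k • (∑ a, ∑ b, (sgn a * sgn b) • B (h (dual a) (dual b)) (y k a b)) =
      ∑ a, ∑ b, (sgn a * sgn b) • B (h (dual a) (dual b)) (∑ k, F.Gam d c k • y k a b) := by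
    simp only [Fin.sum_univ_four, map_add, map_smul, smul_add, smul_comm (F.Gam _ _ _)]
    abel
  simp only [cov1, con2, cov2, cov3, map_sub, map_sum (N.D _), map_zsmul (N.D _), hB _ _ _,
    LinearMap.sub_apply, smul_sub, smul_add, Finset.sum_sub_distrib, Finset.sum_add_distrib, e,
    con2_Gam_left, con2_Gam_right]
  abel

theorem IsPairing.cov_con1 {B : U →ₗ[R] W →ₗ[R] V} (hB : N.IsPairing K J B)
    (h : Fin 4 → Fin 4 → U) (y : Fin 4 → W) (d c : Fin 4) :
    N.cov1 (fun c ↦ con1 B (h c) y) d c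
      = con1 B (K.cov2 h d c) y + con1 B (h c) (J.cov1 y d) := by
  simp only [cov1, con1, cov2, Fin.sum_univ_four, sgn, dual, Matrix.cons_val, map_add,
    map_sub, hB _ _ _, LinearMap.add_apply, LinearMap.sub_apply, map_smul, LinearMap.smul_apply,
    F.Gam_eval d, map_zsmul]
  module

end Conn
end TetradAlgebra

end

section

namespace TetradAlgebra
variable {R : Type*} [CommRing R] {F : TetradAlgebra R}
variable {U W V G : Type*} [AddCommGroup U] [Module R U] [AddCommGroup W] [Module R W]
  [AddCommGroup V] [Module R V] [AddCommGroup G]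

namespace Conn
variable {N : F.Conn V} {K : F.Conn U} {J : F.Conn W}

theorem con2_sum_right (B : U →ₗ[R] W →ₗ[R] V) (h : Fin 4 → Fin 4 → U)
    (y : Fin 4 → Fin 4 → Fin 4 → W) :
    con2 B h (fun a b ↦ ∑ c, sgn c • y c a b) = ∑ c, sgn c • con2 B h (y c) := by
  simp only [con2, Fin.sum_univ_four, map_add, map_zsmul, smul_add, smul_comm (sgn _) (_ * _)]
  abel

theorem con3_flip (B : U →ₗ[R] W →ₗ[R] V) (h : Fin 4 → Fin 4 → Fin 4 → U)
    (x : Fin 4 → Fin 4 → Fin 4 → W) : con3 B.flip x h = con3 B h x := by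
  simp only [con3, con2, Fin.sum_univ_four, sgn, dual, Matrix.cons_val, LinearMap.flip_apply,
    mul_one, mul_neg, neg_neg, one_smul, neg_smul]
  abel

theorem con1_flip (B : U →ₗ[R] W →ₗ[R] V) (h : Fin 4 → U) (x : Fin 4 → W) :
    con1 B.flip x h = con1 B h x := by
  simp only [con1, Fin.sum_univ_four, sgn, dual, Matrix.cons_val, LinearMap.flip_apply,
    mul_one, mul_neg, neg_neg, one_smul, neg_smul]
  abel

theorem con2_flip (B : U →ₗ[R] W →ₗ[R] V) (h : Fin 4 → Fin 4 → U) (x : Fin 4 → Fin 4 → W) :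
    con2 B.flip x h = con2 B h x := by
  simp only [con2, Fin.sum_univ_four, sgn, dual, Matrix.cons_val, LinearMap.flip_apply,
    mul_one, mul_neg, neg_neg, one_smul, neg_smul]
  abel

/-- Integration by parts against the divergence of a 3-tensor. -/
theorem IsPairing.green_div {B : U →ₗ[R] W →ₗ[R] V} (hB : N.IsPairing K J B) {I : V →+ G}
    (hI : N.IsIntegral I) (h : Fin 4 → Fin 4 → U) (y : Fin 4 → Fin 4 → Fin 4 → W) :
    I (con2 B h (fun a b ↦ ∑ c, sgn c • J.cov3 y (dual c) c a b))
      = -I (con3 B (K.cov2 h) y) := by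
  have e := hI.div (fun c ↦ con2 B h (y c))
  simp only [hB.cov_con2, smul_add, Finset.sum_add_distrib, map_add] at e
  rw [con2_sum_right B h (fun c ↦ J.cov3 y (dual c) c), con3]
  exact eq_neg_of_add_eq_zero_right e

variable (N) in
/-- The double divergence `∇^c ∇^d x_{cd}`. -/
def divdiv (x : Fin 4 → Fin 4 → V) : V :=
  ∑ c, ∑ d, (sgn c * sgn d) • N.cov3 (N.cov2 x) (dual c) (dual d) c d

theorem cov1_trace (y : Fin 4 → Fin 4 → Fin 4 → V) (d b : Fin 4) :
    N.cov1 (fun b ↦ ∑ c, sgn c • y (dual c) c b) d b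
      = ∑ c, sgn c • N.cov3 y d (dual c) c b := by
  simp only [cov1, cov3, Fin.sum_univ_four, sgn, dual, Matrix.cons_val, map_add, map_zsmul,
    F.Gam_eval d]
  module

/-- Integration by parts against a Hessian. -/
theorem IsPairing.green_hess {B : U →ₗ[R] W →ₗ[R] V} (hB : N.IsPairing K J B) {I : V →+ G}
    (hI : N.IsIntegral I) {h : Fin 4 → Fin 4 → U} (hh : ∀ a b, h a b = h b a) (f : W) :
    I (con2 B h (J.hess f)) = I (B (K.divdiv h) f) := by
  have e1 := hI.div (fun c ↦ con1 B (h c) (fun b ↦ J.D b f))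
  have e2 := hI.div (fun b ↦ B (∑ c, sgn c • K.cov2 h (dual c) c b) f)
  have k1 : ∑ c, sgn c • con1 B (h c) (J.cov1 (fun b ↦ J.D b f) (dual c))
      = con2 B h (J.hess f) := by
    simp only [con1, con2, hess, cov1, Fin.sum_univ_four, sgn, dual, Matrix.cons_val, one_smul,
      neg_smul, mul_one, mul_neg, neg_neg, smul_add, smul_neg]
    abel
  have k2 (d b : Fin 4) : N.cov1 (fun b ↦ B (∑ c, sgn c • K.cov2 h (dual c) c b) f) d b =
      B (∑ c, sgn c • K.cov3 (K.cov2 h) d (dual c) c b) f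
        + B (∑ c, sgn c • K.cov2 h (dual c) c b) (J.D d f) := by
    rw [← cov1_trace, cov1, hB, cov1]
    simp only [map_sub, LinearMap.sub_apply, map_sum, LinearMap.sum_apply, map_smul,
      LinearMap.smul_apply]
    abel
  have k3 : ∑ b, sgn b • B (∑ c, sgn c • K.cov3 (K.cov2 h) (dual b) (dual c) c b) f
      = B (K.divdiv h) f := by
    rw [divdiv]
    simp only [K.cov22_symm hh (dual _) (dual _) _ _, map_sum, LinearMap.sum_apply,
      Finset.smul_sum, map_zsmul, LinearMap.smul_apply, smul_smul]
  have k4 : ∑ b, sgn b • B (∑ c, sgn c • K.cov2 h (dual c) c b) (J.D (dual b) f)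
      = ∑ c, sgn c • con1 B (K.cov2 h (dual c) c) (fun b ↦ J.D b f) := by
    simp only [con1, Fin.sum_univ_four, sgn, dual, Matrix.cons_val, one_smul,
      neg_smul, smul_add, smul_neg, map_add, map_neg, LinearMap.add_apply, LinearMap.neg_apply]
    abel
  simp only [hB.cov_con1, smul_add, Finset.sum_add_distrib, map_add, k1] at e1
  simp only [k2, smul_add, Finset.sum_add_distrib, map_add, k3, k4] at e2
  exact add_left_cancel (e1.trans (e2.symm.trans (add_comm _ _)))

theorem IsPairing.green_box {B : U →ₗ[R] W →ₗ[R] V} (hB : N.IsPairing K J B) {I : V →+ G}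
    (hI : N.IsIntegral I) (u : U) (f : W) :
    I (B u (∑ c, sgn c • J.hess f c (dual c)))
      = -I (con1 B (fun a ↦ K.D a u) (fun a ↦ J.D a f)) := by
  have e1 := hI.div (fun c ↦ B u (J.D c f))
  have k (d b : Fin 4) : N.cov1 (fun b ↦ B u (J.D b f)) d b
      = B u (J.hess f d b) + B (K.D d u) (J.D b f) := by
    simp only [cov1, hB _ _ _, hess, map_sub, map_sum, map_smul]
    abel
  simp only [k, smul_add, Finset.sum_add_distrib, map_add] at e1
  rw [con1, ← eq_neg_of_add_eq_zero_left e1]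
  simp only [Fin.sum_univ_four, sgn, dual, Matrix.cons_val, one_smul, neg_smul, map_add, map_neg]
  abel

theorem con3_perm_flip (B : U →ₗ[R] W →ₗ[R] V) {h : Fin 4 → Fin 4 → Fin 4 → U}
    {x : Fin 4 → Fin 4 → Fin 4 → W} (hh : ∀ c a b, h c a b = h c b a)
    (hx : ∀ c a b, x c a b = x c b a) :
    con3 B h (fun c a b ↦ x a b c) = con3 B.flip x (fun c a b ↦ h a b c) := by
  simp only [con3, con2, Fin.sum_univ_four, sgn, dual, Matrix.cons_val, LinearMap.flip_apply,
    mul_one, mul_neg, neg_neg, one_smul, neg_smul, smul_add, smul_neg,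
    fun c ↦ hh c 1 0, fun c ↦ hh c 2 0, fun c ↦ hh c 3 0, fun c ↦ hh c 2 1, fun c ↦ hh c 3 1,
    fun c ↦ hh c 3 2, fun c ↦ hx c 1 0, fun c ↦ hx c 2 0, fun c ↦ hx c 3 0, fun c ↦ hx c 2 1,
    fun c ↦ hx c 3 1, fun c ↦ hx c 3 2]
  abel

theorem con3_perm_flip' (B : U →ₗ[R] W →ₗ[R] V) {h : Fin 4 → Fin 4 → Fin 4 → U}
    {x : Fin 4 → Fin 4 → Fin 4 → W} (hh : ∀ c a b, h c a b = h c b a)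
    (hx : ∀ c a b, x c a b = x c b a) :
    con3 B h (fun c a b ↦ x b a c) = con3 B.flip x (fun c a b ↦ h b a c) := by
  simp only [con3, con2, Fin.sum_univ_four, sgn, dual, Matrix.cons_val, LinearMap.flip_apply,
    mul_one, mul_neg, neg_neg, one_smul, neg_smul, smul_add, smul_neg,
    fun c ↦ hh c 1 0, fun c ↦ hh c 2 0, fun c ↦ hh c 3 0, fun c ↦ hh c 2 1, fun c ↦ hh c 3 1,
    fun c ↦ hh c 3 2, fun c ↦ hx c 1 0, fun c ↦ hx c 2 0, fun c ↦ hx c 3 0, fun c ↦ hx c 2 1,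
    fun c ↦ hx c 3 1, fun c ↦ hx c 3 2]
  abel

theorem con2_trace (B : U →ₗ[R] W →ₗ[R] V) (h : Fin 4 → Fin 4 → U) (z : W) :
    con2 B h (fun a b ↦ (if b = dual a then sgn a else 0) • z) = B (tr h) z := by
  simp [con2, tr, Fin.sum_univ_four, sgn, dual]
  abel

/-- The symmetric bilinear form of the linearized Einstein operator. -/
theorem IsPairing.con2_E2 {B : U →ₗ[R] W →ₗ[R] V} (hB : N.IsPairing K J B) {I : V →+ G}
    (hI : N.IsIntegral I) (L : R) {h : Fin 4 → Fin 4 → U} (hh : ∀ a b, h a b = h b a)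
    (x : Fin 4 → Fin 4 → W) :
    I (con2 B h (J.E2 L x)) = I (con3 B (K.cov2 h) (J.cov2 x)) + I ((6 * L) • con2 B h x)
      - I (B (K.divdiv h) (tr x)) - I (con3 B (K.cov2 h) (fun c a b ↦ J.cov2 x a b c))
      - I (con3 B (K.cov2 h) (fun c a b ↦ J.cov2 x b a c))
      - I (B (tr h) (J.divdiv x))
      - I (con1 B (fun a ↦ K.D a (tr h)) (fun a ↦ J.D a (tr x))) := by
  have e : con2 B h (J.E2 L x) =
      -con2 B h (fun a b ↦ ∑ c, sgn c • J.cov3 (J.cov2 x) (dual c) c a b) + (6 * L) • con2 B h x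
      - con2 B h (J.hess (tr x))
      + con2 B h (fun a b ↦ ∑ c, sgn c • J.cov3 (fun c a b ↦ J.cov2 x a b c) (dual c) c a b)
      + con2 B h (fun a b ↦ ∑ c, sgn c • J.cov3 (fun c a b ↦ J.cov2 x b a c) (dual c) c a b)
      - (B (tr h) (J.divdiv x) - B (tr h) (∑ c, sgn c • J.hess (tr x) c (dual c))) := by
    have e1 (a b : Fin 4) : ∑ c, sgn c • J.cov3 (J.cov2 x) c (dual c) a b
        = ∑ c, sgn c • J.cov3 (J.cov2 x) (dual c) c a b := by
      simp only [Fin.sum_univ_four, sgn, dual, Matrix.cons_val]; abel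
    have e2 (d c a b : Fin 4) : J.cov3 (fun c a b ↦ J.cov2 x a b c) d c a b
        = J.cov3 (J.cov2 x) d a b c := by
      simp only [cov3]; abel
    have e3 (d c a b : Fin 4) : J.cov3 (fun c a b ↦ J.cov2 x b a c) d c a b
        = J.cov3 (J.cov2 x) d b a c := by
      simp only [cov3]; abel
    have e4 : (6 * L) • con2 B h x = con2 B h (fun a b ↦ (6 * L) • x a b) := by
      simp only [con2, Finset.smul_sum, map_smul, smul_comm (6 * L)]
    rw [← map_sub, ← con2_trace, e4]
    simp only [e2, e3, con2, E2, e1, divdiv, map_add, map_sub, map_neg, smul_add, smul_sub, smul_neg,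
      Finset.sum_add_distrib, Finset.sum_sub_distrib, Finset.sum_neg_distrib]
    abel
  rw [e]
  simp only [map_add, map_sub, map_neg, hB.green_div hI, hB.green_hess hI hh, hB.green_box hI]
  abel

/-- Formal self-adjointness of the linearized Einstein operator. -/
theorem IsPairing.E2_adjoint {B : U →ₗ[R] W →ₗ[R] V} (hB : N.IsPairing K J B) {I : V →+ G}
    (hI : N.IsIntegral I) (L : R) {h : Fin 4 → Fin 4 → U} (hh : ∀ a b, h a b = h b a)
    {x : Fin 4 → Fin 4 → W} (hx : ∀ a b, x a b = x b a) :
    I (con2 B h (J.E2 L x)) = I (con2 B (K.E2 L h) x) := by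
  have s1 := con3_perm_flip B (K.cov2_symm hh) (J.cov2_symm hx)
  have s2 := con3_perm_flip' B (K.cov2_symm hh) (J.cov2_symm hx)
  rw [← con2_flip B (K.E2 L h) x, hB.con2_E2 hI L hh, hB.flip.con2_E2 hI L hx, con3_flip, con2_flip,
    con1_flip, s1, s2]
  simp only [LinearMap.flip_apply]
  abel

end Conn
end TetradAlgebra

end

section

namespace TetradAlgebra
variable {R : Type*} [CommRing R] {F : TetradAlgebra R}
variable {V G : Type*} [AddCommGroup V] [Module R V] [AddCommGroup G]

namespace Conn
variable {N : F.Conn V}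

theorem IsIntegral.smul_D {I : V →+ G} (hI : N.IsIntegral I) (f : R) (a : Fin 4) (v : V) :
    I (f • N.D a v) = I ((-(F.D a f) - F.dv a * f) • v) := by
  have h := hI a (f • v)
  rw [N.leibniz, map_add] at h
  rw [eq_sub_of_add_eq' h, ← map_neg, ← map_sub]
  congr 1; module

/-- The transpose of `d p q a - k`. -/
theorem IsIntegral.smul_d {I : V →+ G} (hI : N.IsIntegral I) (f k : R) (p q : ℤ) (a : Fin 4)
    (v : V) : I (f • (N.d p q a v - k • v)) =
      I ((-(F.D a f) - (F.dv a + p * F.gam a 0 1 + q * F.gam a 3 2 + k) * f) • v) := by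
  have h := hI.smul_D f a v
  rw [d, smul_sub, smul_sub, map_sub, map_sub, h, ← map_sub, ← map_sub]
  congr 1; module

theorem smul_pairing : N.IsPairing F.fn N (LinearMap.lsmul R V) := fun a u w ↦ by
  simp [N.leibniz, fn]

end Conn

namespace TypeII

theorem dv_eval : F.dv 0 = F.gam 0 0 1 - F.gam 2 0 3 - F.gam 3 0 2 ∧
    F.dv 1 = -F.gam 1 0 1 - F.gam 2 1 3 - F.gam 3 1 2 ∧
    F.dv 2 = -F.gam 0 1 2 - F.gam 1 0 2 + F.gam 2 3 2 ∧
    F.dv 3 = -F.gam 0 1 3 - F.gam 1 0 3 - F.gam 3 3 2 := by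
  simp only [dv, Fin.sum_univ_four, F.Gam_eval]
  refine ⟨?_, ?_, ?_, ?_⟩ <;> ring

/-- The operator `O†`. -/
def Odag (H : F.TypeII) (χ : R) : R :=
  2 * ((F.fn.d (-1) (-2) 1 (F.fn.d (-2) (-2) 0 χ + 3 * F.gam 3 0 2 * χ)
      - F.gam 3 1 2 * (F.fn.d (-2) (-2) 0 χ + 3 * F.gam 3 0 2 * χ))
    - (F.fn.d (-2) (-1) 3 (F.fn.d (-2) (-2) 2 χ + 3 * F.gam 1 0 2 * χ)
      - F.gam 1 0 3 * (F.fn.d (-2) (-2) 2 χ + 3 * F.gam 1 0 2 * χ))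
    - 3 * H.psi2 * χ)

theorem O_adjoint (H : F.TypeII) {N : F.Conn V} {I : V →+ G} (hI : N.IsIntegral I) (χ : R) (v : V) :
    I (χ • H.O N v) = I (H.Odag χ • v) := by
  have e (w : V) (f : R) : χ • (2 : R) • w = (2 * χ) • w := by module
  rw [O, e _ χ, smul_sub, smul_sub, map_sub, map_sub, hI.smul_d, hI.smul_d, hI.smul_d, hI.smul_d,
    ← map_sub, smul_smul, ← map_sub]
  congr 1
  rw [← sub_smul, ← sub_smul]
  congr 1
  simp only [Odag, Conn.d, fn, dv_eval, AddMonoidHom.coe_coe, smul_eq_mul, map_add, map_sub,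
    map_neg, map_zero, Derivation.map_one_eq_zero, Derivation.leibniz, D_ofNat, Int.cast_one, Int.cast_ofNat, Int.cast_neg]
  ring

/-- The component `h_nn` of `S†`. -/
def hnn (F : TetradAlgebra R) (χ : R) : R :=
  -(F.fn.d (-2) (-1) 2 (F.fn.d (-2) (-2) 2 χ) + 2 * F.gam 1 0 2 * F.fn.d (-2) (-2) 2 χ)
    - F.gam 2 1 2 * F.fn.d (-2) (-2) 0 χ

/-- The component `h_nm̄` of `S†`. -/
def hnmbar (F : TetradAlgebra R) (χ : R) : R :=
  -(F.fn.d (-2) (-1) 0 (F.fn.d (-2) (-2) 2 χ) + F.gam 3 0 2 * F.fn.d (-2) (-2) 2 χ)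
    - (F.gam 1 0 2 + F.gam 0 1 2) * F.fn.d (-2) (-2) 0 χ

/-- The component `h_m̄m̄` of `S†`. -/
def hmbarmbar (F : TetradAlgebra R) (χ : R) : R :=
  -(F.fn.d (-1) (-2) 0 (F.fn.d (-2) (-2) 0 χ) + 2 * F.gam 3 0 2 * F.fn.d (-2) (-2) 0 χ)

/-- The operator `S†`. -/
def Sdag (F : TetradAlgebra R) (χ : R) : Fin 4 → Fin 4 → R :=
  ![![0, 0, 0, 0], ![0, hnn F χ, 0, hnmbar F χ], ![0, 0, 0, 0], ![0, hnmbar F χ, 0, hmbarmbar F χ]]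

theorem Sdag_symm (χ : R) (a b : Fin 4) : Sdag F χ a b = Sdag F χ b a := by
  fin_cases a <;> fin_cases b <;> rfl

theorem S_adjoint (H : F.TypeII) {N : F.Conn V} {I : V →+ G} (hI : N.IsIntegral I) (χ : R)
    {x : Fin 4 → Fin 4 → V} (hx : ∀ a b, x a b = x b a) :
    I (χ • N.S x) = I (Conn.con2 (LinearMap.lsmul R V) (Sdag F χ) x) := by
  have e : Conn.con2 (LinearMap.lsmul R V) (Sdag F χ) x = hnn F χ • x 0 0
      - (2 * hnmbar F χ) • x 0 2 + hmbarmbar F χ • x 2 2 := by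
    simp [Conn.con2, Fin.sum_univ_four, Sdag, sgn, dual, hx 2 0]
    module
  have e' : ∀ f : R, f • N.Sz x = (f * F.gam 2 1 2) • x 0 0
      + f • (N.d 1 1 2 (x 0 2) - (2 * F.gam 0 1 2) • x 0 2)
      - f • (N.d 0 2 0 (x 2 2) - F.gam 2 0 3 • x 2 2) := fun f ↦ by
    rw [Conn.Sz]; module
  rw [e, Conn.S, smul_add, map_add, hI.smul_d, hI.smul_d, Conn.Sy, e', smul_sub, map_sub, map_sub,
    map_add, hI.smul_d, hI.smul_d, hI.smul_d, hI.smul_d, ← map_sub, ← map_add, ← map_sub, ← map_add]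
  congr 1
  have c := H.comm_lm F.fn χ
  simp only [fn, AddMonoidHom.coe_coe, smul_eq_mul] at c
  simp only [hnn, hnmbar, hmbarmbar, Conn.d, fn, dv_eval, AddMonoidHom.coe_coe, smul_eq_mul,
    map_add, map_sub, map_neg, map_zero, Derivation.map_one_eq_zero, Derivation.leibniz, D_ofNat, Int.cast_one, Int.cast_ofNat,
    Int.cast_neg, Int.cast_zero, H.ricci_eqs, c, zero_mul]
  module
end TypeII

/-- Additive functionals on functions, as a module by transposition. -/
def Dual (R : Type*) [CommRing R] : Type _ := R →+ R

instance : AddCommGroup (Dual R) := inferInstanceAs (AddCommGroup (R →+ R))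

instance : FunLike (Dual R) R R := inferInstanceAs (FunLike (R →+ R) R R)

instance : AddMonoidHomClass (Dual R) R R := inferInstanceAs (AddMonoidHomClass (R →+ R) R R)

namespace Dual

theorem ext {φ ψ : Dual R} (h : ∀ f, φ f = ψ f) : φ = ψ := AddMonoidHom.ext h

theorem add_apply (φ ψ : Dual R) (f : R) : (φ + ψ) f = φ f + ψ f := rfl

theorem zero_apply (f : R) : (0 : Dual R) f = 0 := rfl

instance : Module R (Dual R) where
  smul f φ := (φ : R →+ R).comp (AddMonoidHom.mulLeft f)
  one_smul φ := ext fun f ↦ congrArg φ (one_mul f)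
  mul_smul f g φ := ext fun h ↦ congrArg φ (by change f * g * h = g * (f * h); ring)
  smul_zero f := rfl
  smul_add f φ ψ := rfl
  add_smul f g φ := ext fun h ↦ by
    change φ ((f + g) * h) = φ (f * h) + φ (g * h); rw [add_mul, map_add]
  zero_smul φ := ext fun h ↦ by change φ (0 * h) = 0; rw [zero_mul, map_zero]

theorem smul_apply (f : R) (φ : Dual R) (h : R) : (f • φ) h = φ (f * h) := rfl

/-- The formal adjoint of the derivation `e_a`. -/
def adj (F : TetradAlgebra R) (a : Fin 4) : R →+ R where
  toFun f := -(F.D a f) - F.dv a * f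
  map_zero' := by simp
  map_add' f g := by rw [map_add]; ring

theorem dv_eq (F : TetradAlgebra R) (a : Fin 4) : F.dv a = ∑ c, F.strc c a c := by
  simp only [dv, strc, Fin.sum_univ_four, F.Gam_eval a]
  ring

theorem adj_comm (F : TetradAlgebra R) (a b : Fin 4) (f : R) :
    adj F b (adj F a f) = adj F a (adj F b f) + ∑ h, adj F h (F.strc a b h * f) := by
  have j (c : Fin 4) := F.jacobi' a b c c
  have c := F.comm' a b f
  have e : ∀ a b c, F.strc a b c = -F.strc b a c := fun a b c ↦ by simp only [strc]; ring
  have e0 : ∀ a c, F.strc a a c = 0 := fun a c ↦ by simp only [strc]; ring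
  have j0 := j 0
  have j1 := j 1
  have j2 := j 2
  have j3 := j 3
  simp only [adj, AddMonoidHom.coe_mk, ZeroHom.coe_mk, map_sub, map_neg, Derivation.leibniz,
    Fin.sum_univ_four, dv_eq, map_add, smul_eq_mul] at j0 j1 j2 j3 c ⊢
  simp only [e 0 a, e 1 a, e 2 a, e 3 a, e 0 b, e 1 b, e 2 b, e 3 b, e0, e 1 0, e 2 0, e 3 0,
    e 2 1, e 3 1, e 3 2, map_neg, map_zero] at j0 j1 j2 j3 c ⊢
  linear_combination -c + f * (j0 + j1 + j2 + j3)

/-- The action of the tetrad on functionals by transposition. -/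
def conn (F : TetradAlgebra R) : F.Conn (Dual R) where
  D a :=
    { toFun := fun φ ↦ (φ : R →+ R).comp (adj F a)
      map_zero' := rfl
      map_add' := fun φ ψ ↦ rfl }
  leibniz a f φ := ext fun h ↦ by
    change φ (f * adj F a h) = φ (F.D a f * h) + φ (adj F a (f * h))
    rw [← map_add]
    congr 1
    simp only [adj, AddMonoidHom.coe_mk, ZeroHom.coe_mk, Derivation.leibniz, smul_eq_mul]
    ring
  comm a b φ := ext fun h ↦ by
    simp only [Fin.sum_univ_four]
    change φ (adj F b (adj F a h)) = φ (adj F a (adj F b h)) + (φ (adj F 0 (F.strc a b 0 * h))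
      + φ (adj F 1 (F.strc a b 1 * h)) + φ (adj F 2 (F.strc a b 2 * h))
      + φ (adj F 3 (F.strc a b 3 * h)))
    rw [adj_comm, Fin.sum_univ_four]
    simp only [map_add]

/-- Evaluation at the constant function `1`. -/
def int (R : Type*) [CommRing R] : Dual R →+ R where
  toFun φ := φ 1
  map_zero' := rfl
  map_add' _ _ := rfl

theorem isIntegral (F : TetradAlgebra R) : (conn F).IsIntegral (int R) := fun a φ ↦ by
  change φ (adj F a 1) = -φ (F.dv a * 1)
  rw [← map_neg]
  simp [adj]

end Dual

namespace Conn

theorem hess_symm {N : F.Conn V} (v : V) (a b : Fin 4) : N.hess v a b = N.hess v b a := by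
  simp only [hess, N.comm a b, strc, Fin.sum_univ_four]
  module

theorem E2_symm {N : F.Conn V} (L : R) {x : Fin 4 → Fin 4 → V} (hx : ∀ a b, x a b = x b a)
    (a b : Fin 4) : N.E2 L x a b = N.E2 L x b a := by
  have h : (if b = dual a then sgn a else 0) = if a = dual b then sgn b else 0 := by
    revert a b; decide
  simp only [E2, hess_symm _ a b, hx a b, N.cov22_symm hx _ _ a b, h]
  simp only [Fin.sum_univ_four]
  abel_nf

end Conn

theorem TypeII.E2_Sdag (H : F.TypeII) (h2 : ∀ f : R, 2 * f = 0 → f = 0) {χ : R}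
    (hχ : H.Odag χ = 0) (a b : Fin 4) : F.fn.E2 H.L (Sdag F χ) a b = 0 := by
  let N := Dual.conn F
  have key (x : Fin 4 → Fin 4 → Dual R) (hx : ∀ a b, x a b = x b a) :
      Dual.int R (Conn.con2 (LinearMap.lsmul R (Dual R)) (F.fn.E2 H.L (Sdag F χ)) x) = 0 := by
    rw [← Conn.smul_pairing.E2_adjoint (Dual.isIntegral F) H.L (Sdag_symm χ) hx,
      ← H.S_adjoint (Dual.isIntegral F) χ (Conn.E2_symm H.L hx), H.S_E2 N hx,
      H.O_adjoint (Dual.isIntegral F), hχ, zero_smul, map_zero]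
  have e := Conn.E2_symm (N := F.fn) H.L (Sdag_symm (F := F) χ)
  let φ : Dual R := AddMonoidHom.id R
  have hφ (f : R) : Dual.int R (f • φ) = f := mul_one f
  have k := key (fun i j ↦ if (i = dual a ∧ j = dual b) ∨ (i = dual b ∧ j = dual a) then φ else 0)
    (fun i j ↦ by simp only [or_comm, and_comm])
  generalize F.fn.E2 H.L (Sdag F χ) = y at *
  apply h2
  simp only [Conn.con2, LinearMap.lsmul_apply, Fin.sum_univ_four] at k
  fin_cases a <;> fin_cases b <;> simp [dual, sgn, hφ, e 1 0, e 2 0, e 3 0, e 2 1, e 3 1, e 3 2] at k ⊢ <;>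
    first | (rw [k]; simp) | linear_combination k | linear_combination -k

end TetradAlgebra

end

section

section Calculus

variable {M : Type*} [TopologicalSpace M] [ChartedSpace (EuclideanSpace ℝ (Fin 4)) M]

/-- Smoothness of a real-valued function. -/
def RSmooth (f : M → ℝ) : Prop := ContMDiff (𝓡 4) 𝓘(ℝ, ℝ) ∞ f

theorem RSmooth.mdiff {f : M → ℝ} (h : RSmooth f) (x : M) :
    MDifferentiableAt (𝓡 4) 𝓘(ℝ, ℝ) f x := h.mdifferentiable (by simp) x

theorem Smooth.mdiff {f : M → ℂ} (h : Smooth f) (x : M) :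
    MDifferentiableAt (𝓡 4) 𝓘(ℝ, ℂ) f x := ContMDiff.mdifferentiable h (by simp) x

theorem Smooth.re {f : M → ℂ} (h : Smooth f) : RSmooth (fun x ↦ (f x).re) :=
  (Complex.reCLM.contDiff (n := ∞)).contMDiff.comp (I' := 𝓘(ℝ, ℂ)) h

theorem Smooth.im {f : M → ℂ} (h : Smooth f) : RSmooth (fun x ↦ (f x).im) :=
  (Complex.imCLM.contDiff (n := ∞)).contMDiff.comp (I' := 𝓘(ℝ, ℂ)) h

theorem RSmooth.ofReal {f : M → ℝ} (h : RSmooth f) : Smooth (fun x ↦ (f x : ℂ)) :=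
  (Complex.ofRealCLM.contDiff (n := ∞)).contMDiff.comp (I' := 𝓘(ℝ, ℝ)) h

theorem smooth_const (c : ℂ) : Smooth (fun _ : M ↦ c) := contMDiff_const

theorem Smooth.add {f h : M → ℂ} (hf : Smooth f) (hh : Smooth h) : Smooth (f + h) :=
  ContMDiff.add hf hh

theorem Smooth.sub {f h : M → ℂ} (hf : Smooth f) (hh : Smooth h) : Smooth (f - h) :=
  ContMDiff.sub hf hh

theorem Smooth.mul {f h : M → ℂ} (hf : Smooth f) (hh : Smooth h) : Smooth (f * h) := by
  have := (contDiff_mul (𝕜 := ℝ) (𝔸 := ℂ) (n := ∞)).contMDiff.comp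
    (I' := 𝓘(ℝ, ℂ × ℂ)) (hf.prodMk_space hh)
  exact this

theorem Smooth.mk_re_im {f h : M → ℝ} (hf : RSmooth f) (hh : RSmooth h) :
    Smooth (fun x ↦ (f x : ℂ) + Complex.I * (h x : ℂ)) :=
  hf.ofReal.add ((smooth_const Complex.I).mul hh.ofReal)

theorem RSmooth.add {f h : M → ℝ} (hf : RSmooth f) (hh : RSmooth h) : RSmooth (f + h) :=
  ContMDiff.add hf hh

theorem RSmooth.sub {f h : M → ℝ} (hf : RSmooth f) (hh : RSmooth h) : RSmooth (f - h) :=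
  ContMDiff.sub hf hh

theorem RSmooth.mul {f h : M → ℝ} (hf : RSmooth f) (hh : RSmooth h) : RSmooth (f * h) :=
  ContMDiff.mul hf hh

/-- The differential of a complex function in terms of its real and imaginary part. -/
theorem Smooth.mvfderiv_eq {f : M → ℂ} (h : Smooth f) (x : M) (v : TangentSpace (𝓡 4) x) :
    mvfderiv (𝓡 4) f x v = (mvfderiv (𝓡 4) (fun x ↦ (f x).re) x v : ℂ)
      + Complex.I * (mvfderiv (𝓡 4) (fun x ↦ (f x).im) x v : ℂ) := by
  have hf : f = (fun x ↦ (f x).re) • (fun _ ↦ (1 : ℂ))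
      + (fun x ↦ (f x).im) • (fun _ ↦ Complex.I) := by
    ext y
    simp [Complex.re_add_im]
  have h1 : MDifferentiableAt (𝓡 4) 𝓘(ℝ, ℂ) (fun _ : M ↦ (1 : ℂ)) x := mdifferentiableAt_const
  have h2 : MDifferentiableAt (𝓡 4) 𝓘(ℝ, ℂ) (fun _ : M ↦ Complex.I) x := mdifferentiableAt_const
  have key := congrArg (fun φ ↦ mvfderiv (𝓡 4) φ x v) hf
  refine key.trans ?_
  rw [mvfderiv_add ((h.re.mdiff x).smul h1) ((h.im.mdiff x).smul h2),
    mvfderiv_smul (h.re.mdiff x) h1, mvfderiv_smul (h.im.mdiff x) h2]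
  simp [mvfderiv_const, mul_comm]

theorem RSmooth.mvfderiv_add {f h : M → ℝ} (hf : RSmooth f) (hh : RSmooth h) (x : M)
    (v : TangentSpace (𝓡 4) x) :
    mvfderiv (𝓡 4) (f + h) x v = mvfderiv (𝓡 4) f x v + mvfderiv (𝓡 4) h x v := by
  rw [_root_.mvfderiv_add (hf.mdiff x) (hh.mdiff x)]; rfl

theorem RSmooth.mvfderiv_sub {f h : M → ℝ} (hf : RSmooth f) (hh : RSmooth h) (x : M)
    (v : TangentSpace (𝓡 4) x) :
    mvfderiv (𝓡 4) (f - h) x v = mvfderiv (𝓡 4) f x v - mvfderiv (𝓡 4) h x v := by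
  rw [_root_.mvfderiv_sub (hf.mdiff x) (hh.mdiff x)]; rfl

theorem RSmooth.mvfderiv_mul {f h : M → ℝ} (hf : RSmooth f) (hh : RSmooth h) (x : M)
    (v : TangentSpace (𝓡 4) x) :
    mvfderiv (𝓡 4) (f * h) x v = f x * mvfderiv (𝓡 4) h x v + h x * mvfderiv (𝓡 4) f x v := by
  rw [_root_.mvfderiv_mul (hf.mdiff x) (hh.mdiff x)]; rfl

theorem Smooth.mvfderiv_add {f h : M → ℂ} (hf : Smooth f) (hh : Smooth h) (x : M)
    (v : TangentSpace (𝓡 4) x) :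
    mvfderiv (𝓡 4) (f + h) x v = mvfderiv (𝓡 4) f x v + mvfderiv (𝓡 4) h x v := by
  rw [_root_.mvfderiv_add (hf.mdiff x) (hh.mdiff x)]; rfl

theorem Smooth.mvfderiv_mul {f h : M → ℂ} (hf : Smooth f) (hh : Smooth h) (x : M)
    (v : TangentSpace (𝓡 4) x) :
    mvfderiv (𝓡 4) (f * h) x v = f x * mvfderiv (𝓡 4) h x v + h x * mvfderiv (𝓡 4) f x v := by
  rw [(hf.mul hh).mvfderiv_eq, hf.mvfderiv_eq, hh.mvfderiv_eq]
  have e1 : (fun x ↦ ((f * h) x).re) = (fun x ↦ (f x).re) * (fun x ↦ (h x).re)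
      - (fun x ↦ (f x).im) * (fun x ↦ (h x).im) := by ext y; simp
  have e2 : (fun x ↦ ((f * h) x).im) = (fun x ↦ (f x).re) * (fun x ↦ (h x).im)
      + (fun x ↦ (f x).im) * (fun x ↦ (h x).re) := by ext y; simp
  rw [e1, e2, (hf.re.mul hh.re).mvfderiv_sub (hf.im.mul hh.im),
    (hf.re.mul hh.im).mvfderiv_add (hf.im.mul hh.re), hf.re.mvfderiv_mul hh.re,
    hf.im.mvfderiv_mul hh.im, hf.re.mvfderiv_mul hh.im, hf.im.mvfderiv_mul hh.re]
  apply Complex.ext <;> simp <;> ring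

end Calculus

section Fields

variable {M : Type*} [TopologicalSpace M] [ChartedSpace (EuclideanSpace ℝ (Fin 4)) M]

/-- A complex field as a pair of real fields. -/
def ComplexField.equiv : ComplexField M ≃ RealField M × RealField M where
  toFun V := (V.re, V.im)
  invFun p := ⟨p.1, p.2⟩
  left_inv _ := rfl
  right_inv _ := rfl

instance : AddCommGroup (ComplexField M) := ComplexField.equiv.addCommGroup

namespace ComplexField

@[ext] theorem ext' {V W : ComplexField M} (h1 : ∀ x, V.re x = W.re x)
    (h2 : ∀ x, V.im x = W.im x) : V = W := by
  cases V; cases W; congr 1 <;> funext x <;> [exact h1 x; exact h2 x]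

@[simp] theorem add_re (V W : ComplexField M) : (V + W).re = V.re + W.re := rfl
@[simp] theorem add_im (V W : ComplexField M) : (V + W).im = V.im + W.im := rfl
@[simp] theorem neg_re (V : ComplexField M) : (-V).re = -V.re := rfl
@[simp] theorem neg_im (V : ComplexField M) : (-V).im = -V.im := rfl
@[simp] theorem sub_re (V W : ComplexField M) : (V - W).re = V.re - W.re := rfl
@[simp] theorem sub_im (V W : ComplexField M) : (V - W).im = V.im - W.im := rfl
@[simp] theorem zero_re : (0 : ComplexField M).re = 0 := rfl
@[simp] theorem zero_im : (0 : ComplexField M).im = 0 := rfl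

/-- The product of a complex function and a complex vector field. -/
instance : SMul (M → ℂ) (ComplexField M) where
  smul f V := ⟨(fun x ↦ (f x).re) • V.re - (fun x ↦ (f x).im) • V.im,
    (fun x ↦ (f x).re) • V.im + (fun x ↦ (f x).im) • V.re⟩

theorem smul_re (f : M → ℂ) (V : ComplexField M) :
    (f • V).re = (fun x ↦ (f x).re) • V.re - (fun x ↦ (f x).im) • V.im := rfl
theorem smul_im (f : M → ℂ) (V : ComplexField M) :
    (f • V).im = (fun x ↦ (f x).re) • V.im + (fun x ↦ (f x).im) • V.re := rfl

end ComplexField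

variable [IsManifold (𝓡 4) ∞ M]

theorem SmoothField.mdiff {X : RealField M} (h : SmoothField X) (x : M) :
    MDifferentiableAt (𝓡 4) (𝓡 4).tangent (fun x ↦ (⟨x, X x⟩ : TangentBundle (𝓡 4) M)) x :=
  ContMDiff.mdifferentiable h (by simp) x

theorem SmoothField.add {X Y : RealField M} (hX : SmoothField X) (hY : SmoothField Y) :
    SmoothField (X + Y) := ContMDiff.add_section hX hY

theorem SmoothField.neg {X : RealField M} (hX : SmoothField X) :
    SmoothField (-X) := ContMDiff.neg_section hX

theorem SmoothField.sub {X Y : RealField M} (hX : SmoothField X) (hY : SmoothField Y) :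
    SmoothField (X - Y) := ContMDiff.sub_section hX hY

theorem SmoothField.smul {f : M → ℝ} {X : RealField M} (hf : RSmooth f) (hX : SmoothField X) :
    SmoothField (f • X) := ContMDiff.smul_section hf hX

theorem smoothField_zero : SmoothField (0 : RealField M) :=
  Bundle.contMDiff_zeroSection ℝ (TangentSpace (𝓡 4) : M → Type _)

instance isManifold_minSmoothness_three : IsManifold (𝓡 4) (minSmoothness ℝ 3) M :=
  .of_le (n := ∞) (by
    rw [minSmoothness_of_isRCLikeNormedField]
    exact WithTop.coe_le_coe.2 (le_top (a := (3 : ℕ∞))))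

theorem SmoothField.lie {X Y : RealField M} (hX : SmoothField X) (hY : SmoothField Y) :
    SmoothField (mlieBracket (𝓡 4) X Y) := by
  have : IsManifold (𝓡 4) (((⊤ : ℕ∞) : ℕ∞ω) + 1) M := ‹IsManifold (𝓡 4) ∞ M›
  exact ContDiff.mlieBracket_vectorField (m := ⊤) (n := ⊤) hX hY
    (by simp [minSmoothness_of_isRCLikeNormedField])

theorem SmoothField.jacobi {X Y Z : RealField M} (hX : SmoothField X) (hY : SmoothField Y)
    (hZ : SmoothField Z) :
    mlieBracket (𝓡 4) X (mlieBracket (𝓡 4) Y Z) =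
      mlieBracket (𝓡 4) (mlieBracket (𝓡 4) X Y) Z
        + mlieBracket (𝓡 4) Y (mlieBracket (𝓡 4) X Z) := by
  have h2 : minSmoothness ℝ 2 ≤ ((⊤ : ℕ∞) : ℕ∞ω) := by
    rw [minSmoothness_of_isRCLikeNormedField]
    exact WithTop.coe_le_coe.2 (le_top (a := (2 : ℕ∞)))
  funext x
  exact leibniz_identity_mlieBracket_apply ((hX.of_le h2).contMDiffAt)
    ((hY.of_le h2).contMDiffAt) ((hZ.of_le h2).contMDiffAt)

theorem lie_add_right (X : RealField M) {Y Z : RealField M} (hY : SmoothField Y)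
    (hZ : SmoothField Z) :
    mlieBracket (𝓡 4) X (Y + Z) = mlieBracket (𝓡 4) X Y + mlieBracket (𝓡 4) X Z := by
  funext x
  exact mlieBracket_add_right (hY.mdiff x) (hZ.mdiff x)

theorem lie_neg_right (X : RealField M) {Y : RealField M} (hY : SmoothField Y) :
    mlieBracket (𝓡 4) X (-Y) = -mlieBracket (𝓡 4) X Y := by
  funext x
  have := mlieBracket_const_smul_right (V := X) (c := (-1 : ℝ)) (hY.mdiff x)
  simpa using this

theorem lie_sub_right (X : RealField M) {Y Z : RealField M} (hY : SmoothField Y)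
    (hZ : SmoothField Z) :
    mlieBracket (𝓡 4) X (Y - Z) = mlieBracket (𝓡 4) X Y - mlieBracket (𝓡 4) X Z := by
  rw [sub_eq_add_neg, lie_add_right X hY hZ.neg, lie_neg_right X hZ, ← sub_eq_add_neg]

theorem lie_smul_right (X : RealField M) {f : M → ℝ} {Y : RealField M} (hf : RSmooth f)
    (hY : SmoothField Y) :
    mlieBracket (𝓡 4) X (f • Y)
      = (fun x ↦ mvfderiv (𝓡 4) f x (X x)) • Y + f • mlieBracket (𝓡 4) X Y := by
  funext x
  exact mlieBracket_smul_right (hf.mdiff x) (hY.mdiff x)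

theorem RSmooth.deriv {f : M → ℝ} {X : RealField M} (hf : RSmooth f) (hX : SmoothField X) :
    RSmooth (fun x ↦ mvfderiv (𝓡 4) f x (X x)) := by
  have h1 := ContMDiff.contMDiff_tangentMap (m := ∞) hf (by simp)
  exact (contMDiff_snd_tangentBundle_modelSpace ℝ 𝓘(ℝ, ℝ)).comp (h1.comp hX)

theorem LorentzMetric.smooth_val (g : LorentzMetric M) {X Y : RealField M} (hX : SmoothField X)
    (hY : SmoothField Y) : RSmooth (fun x ↦ g.val x (X x) (Y x)) := by
  have := ContMDiff.clm_bundle_apply₂ (F₁ := EuclideanSpace ℝ (Fin 4))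
    (F₂ := EuclideanSpace ℝ (Fin 4)) (F₃ := ℝ) (E₃ := Bundle.Trivial M ℝ) (b := id)
    g.smooth hX hY
  intro x
  have h := this x
  rw [contMDiffAt_totalSpace] at h
  exact h.2

end Fields

end

section

namespace ComplexField

variable {M : Type*} [TopologicalSpace M] [ChartedSpace (EuclideanSpace ℝ (Fin 4)) M]
  [IsManifold (𝓡 4) ∞ M]

/-- Smoothness of a complex vector field. -/
structure IsSmooth (V : ComplexField M) : Prop where
  re : SmoothField V.re
  im : SmoothField V.im

variable {V W Z : ComplexField M} {f h : M → ℂ}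

theorem IsSmooth.add (hV : V.IsSmooth) (hW : W.IsSmooth) : (V + W).IsSmooth :=
  ⟨hV.re.add hW.re, hV.im.add hW.im⟩

theorem IsSmooth.smul (hf : Smooth f) (hV : V.IsSmooth) : (f • V).IsSmooth :=
  ⟨(hV.re.smul hf.re).sub (hV.im.smul hf.im), (hV.im.smul hf.re).add (hV.re.smul hf.im)⟩

theorem IsSmooth.bracket (hV : V.IsSmooth) (hW : W.IsSmooth) : (V.bracket W).IsSmooth :=
  ⟨(hV.re.lie hW.re).sub (hV.im.lie hW.im), (hV.re.lie hW.im).add (hV.im.lie hW.re)⟩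

theorem deriv_eq (V : ComplexField M) (hf : Smooth f) : V.deriv f = fun x ↦
    (((mvfderiv (𝓡 4) (fun x ↦ (f x).re) x (V.re x)
      - mvfderiv (𝓡 4) (fun x ↦ (f x).im) x (V.im x) : ℝ)) : ℂ)
    + Complex.I * ((mvfderiv (𝓡 4) (fun x ↦ (f x).im) x (V.re x)
      + mvfderiv (𝓡 4) (fun x ↦ (f x).re) x (V.im x) : ℝ) : ℂ) := by
  funext x
  simp only [deriv, hf.mvfderiv_eq]
  apply Complex.ext <;> simp
  ring

theorem IsSmooth.deriv (hV : V.IsSmooth) (hf : Smooth f) : Smooth (V.deriv f) := by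
  rw [deriv_eq V hf]
  exact Smooth.mk_re_im ((hf.re.deriv hV.re).sub (hf.im.deriv hV.im))
    ((hf.im.deriv hV.re).add (hf.re.deriv hV.im))

theorem deriv_add (V : ComplexField M) (hf : Smooth f) (hh : Smooth h) :
    V.deriv (f + h) = V.deriv f + V.deriv h := by
  funext x
  simp only [deriv, hf.mvfderiv_add hh, Pi.add_apply]
  ring

theorem deriv_mul (V : ComplexField M) (hf : Smooth f) (hh : Smooth h) :
    V.deriv (f * h) = f * V.deriv h + h * V.deriv f := by
  funext x
  simp only [deriv, hf.mvfderiv_mul hh, Pi.add_apply, Pi.mul_apply]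
  ring

theorem deriv_const (V : ComplexField M) (c : ℂ) : V.deriv (fun _ ↦ c) = 0 := by
  funext x
  simp [deriv, mvfderiv_const]

theorem deriv_bar (V : ComplexField M) (hf : Smooth f) :
    V.conj.deriv (bar f) = bar (V.deriv f) := by
  have hb : Smooth (bar f) := by
    have h1 : bar f = fun x ↦ (((f x).re : ℝ) : ℂ)
        + Complex.I * (((-1 : ℝ) * (f x).im : ℝ) : ℂ) := by
      funext x; apply Complex.ext <;> simp [bar]
    rw [h1]
    exact Smooth.mk_re_im hf.re (RSmooth.mul (f := fun _ ↦ (-1 : ℝ)) contMDiff_const hf.im)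
  rw [deriv_eq _ hb]
  funext x
  simp only [bar]
  rw [deriv_eq _ hf]
  have h2 : (fun x ↦ ((starRingEnd ℂ) (f x)).im) = fun x ↦ -(f x).im := by funext y; simp
  have h3 : mvfderiv (𝓡 4) (fun x ↦ -(f x).im) x = -mvfderiv (𝓡 4) (fun x ↦ (f x).im) x :=
    mvfderiv_neg
  simp only [Complex.conj_re, h2, h3, conj]
  apply Complex.ext <;> simp
  ring

theorem bracket_swap (V W : ComplexField M) : V.bracket W = -(W.bracket V) := by
  ext x <;> simp only [bracket, neg_re, neg_im, Pi.neg_apply, Pi.sub_apply, Pi.add_apply] <;>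
  rw [mlieBracket_swap_apply (V := V.re), mlieBracket_swap_apply (V := V.im)] <;> abel

theorem bracket_conj (V W : ComplexField M) (hV : V.IsSmooth) (hW : W.IsSmooth) :
    V.conj.bracket W.conj = (V.bracket W).conj := by
  have e (X : RealField M) : mlieBracket (𝓡 4) (-V.im) X = -mlieBracket (𝓡 4) V.im X := by
    rw [mlieBracket_swap, mlieBracket_swap (V := V.im), lie_neg_right X hV.im]
  ext x
  · simp only [bracket, conj, e, lie_neg_right _ hW.im, neg_neg]
  · simp only [bracket, conj, e, lie_neg_right _ hW.im, neg_neg, Pi.add_apply, Pi.neg_apply]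
    abel

theorem bracket_neg_right (V : ComplexField M) (hW : W.IsSmooth) :
    V.bracket (-W) = -V.bracket W := by
  ext x
  · simp only [bracket, neg_re, neg_im, lie_neg_right _ hW.re, lie_neg_right _ hW.im,
      Pi.neg_apply, Pi.sub_apply]
    abel
  · simp only [bracket, neg_re, neg_im, lie_neg_right _ hW.re, lie_neg_right _ hW.im,
      Pi.neg_apply, Pi.add_apply]
    abel

theorem bracket_add_right (V : ComplexField M) (hW : W.IsSmooth) (hZ : Z.IsSmooth) :
    V.bracket (W + Z) = V.bracket W + V.bracket Z := by
  ext x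
  · simp only [bracket, add_re, add_im, lie_add_right _ hW.re hZ.re, lie_add_right _ hW.im hZ.im,
      Pi.add_apply, Pi.sub_apply]
    abel
  · simp only [bracket, add_re, add_im, lie_add_right _ hW.re hZ.re, lie_add_right _ hW.im hZ.im,
      Pi.add_apply, Pi.sub_apply]
    abel

theorem bracket_smul_right (V : ComplexField M) (hf : Smooth f) (hW : W.IsSmooth) :
    V.bracket (f • W) = V.deriv f • W + f • V.bracket W := by
  rw [deriv_eq V hf]
  ext x
  · simp only [bracket, add_re, smul_re, smul_im,
      lie_sub_right _ (hW.re.smul hf.re) (hW.im.smul hf.im),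
      lie_add_right _ (hW.im.smul hf.re) (hW.re.smul hf.im), lie_smul_right _ hf.re hW.re,
      lie_smul_right _ hf.im hW.re, lie_smul_right _ hf.re hW.im, lie_smul_right _ hf.im hW.im,
      Pi.add_apply, Pi.sub_apply, Pi.smul_apply']
    simp
    module
  · simp only [bracket, add_im, smul_re, smul_im,
      lie_sub_right _ (hW.re.smul hf.re) (hW.im.smul hf.im),
      lie_add_right _ (hW.im.smul hf.re) (hW.re.smul hf.im), lie_smul_right _ hf.re hW.re,
      lie_smul_right _ hf.im hW.re, lie_smul_right _ hf.re hW.im, lie_smul_right _ hf.im hW.im,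
      Pi.add_apply, Pi.sub_apply, Pi.smul_apply']
    simp
    module

theorem lie_sub_left {X Y : RealField M} (hX : SmoothField X) (hY : SmoothField Y)
    (Z : RealField M) :
    mlieBracket (𝓡 4) (X - Y) Z = mlieBracket (𝓡 4) X Z - mlieBracket (𝓡 4) Y Z := by
  rw [mlieBracket_swap, lie_sub_right Z hX hY, mlieBracket_swap (V := X),
    mlieBracket_swap (V := Y)]
  abel

theorem lie_add_left {X Y : RealField M} (hX : SmoothField X) (hY : SmoothField Y)
    (Z : RealField M) :
    mlieBracket (𝓡 4) (X + Y) Z = mlieBracket (𝓡 4) X Z + mlieBracket (𝓡 4) Y Z := by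
  rw [mlieBracket_swap, lie_add_right Z hX hY, mlieBracket_swap (V := X),
    mlieBracket_swap (V := Y)]
  abel

theorem bracket_jacobi (hV : V.IsSmooth) (hW : W.IsSmooth) (hZ : Z.IsSmooth) :
    V.bracket (W.bracket Z) = (V.bracket W).bracket Z + W.bracket (V.bracket Z) := by
  obtain ⟨a, b⟩ := V
  obtain ⟨c, d⟩ := W
  obtain ⟨p, q⟩ := Z
  obtain ⟨ha, hb⟩ := hV
  obtain ⟨hc, hd⟩ := hW
  obtain ⟨hp, hq⟩ := hZ
  simp only at ha hb hc hd hp hq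
  ext x
  · simp only [bracket, add_re, Pi.add_apply, Pi.sub_apply,
      lie_sub_right _ (hc.lie hp) (hd.lie hq), lie_add_right _ (hc.lie hq) (hd.lie hp),
      lie_sub_right _ (ha.lie hp) (hb.lie hq), lie_add_right _ (ha.lie hq) (hb.lie hp),
      lie_sub_left (ha.lie hc) (hb.lie hd), lie_add_left (ha.lie hd) (hb.lie hc),
      ha.jacobi hc hp, ha.jacobi hd hq, hb.jacobi hc hq, hb.jacobi hd hp]
    abel
  · simp only [bracket, add_im, Pi.add_apply, Pi.sub_apply,
      lie_sub_right _ (hc.lie hp) (hd.lie hq), lie_add_right _ (hc.lie hq) (hd.lie hp),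
      lie_sub_right _ (ha.lie hp) (hb.lie hq), lie_add_right _ (ha.lie hq) (hb.lie hp),
      lie_sub_left (ha.lie hc) (hb.lie hd), lie_add_left (ha.lie hd) (hb.lie hc),
      ha.jacobi hc hq, ha.jacobi hd hp, hb.jacobi hc hp, hb.jacobi hd hq]
    abel

variable (g : LorentzMetric M)

theorem inner_add_left (V W Z : ComplexField M) :
    g.inner (V + W) Z = g.inner V Z + g.inner W Z := by
  funext x
  simp only [LorentzMetric.inner, add_re, add_im, Pi.add_apply, map_add,
    _root_.add_apply]
  push_cast
  ring

theorem inner_neg_left (V Z : ComplexField M) : g.inner (-V) Z = -g.inner V Z := by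
  funext x
  simp only [LorentzMetric.inner, neg_re, neg_im, Pi.neg_apply, map_neg,
    _root_.neg_apply]
  push_cast
  ring

theorem inner_smul_left (f : M → ℂ) (V Z : ComplexField M) :
    g.inner (f • V) Z = f * g.inner V Z := by
  funext x
  simp only [LorentzMetric.inner, smul_re, smul_im, Pi.add_apply, Pi.sub_apply, Pi.smul_apply',
    map_add, map_sub, map_smul, _root_.add_apply, _root_.sub_apply,
    _root_.smul_apply, Pi.mul_apply, smul_eq_mul]
  apply Complex.ext <;> simp <;> ring

theorem inner_conj (V W : ComplexField M) : g.inner V.conj W.conj = bar (g.inner V W) := by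
  funext x
  simp only [LorentzMetric.inner, conj, bar, Pi.neg_apply, map_neg,
    _root_.neg_apply]
  apply Complex.ext <;> simp
  ring

theorem deriv_add_left (V W : ComplexField M) (f : M → ℂ) :
    (V + W).deriv f = V.deriv f + W.deriv f := by
  funext x
  simp only [deriv, add_re, add_im, Pi.add_apply, map_add]
  ring

theorem deriv_smul_left (f : M → ℂ) (V : ComplexField M) (h : M → ℂ) :
    (f • V).deriv h = f * V.deriv h := by
  funext x
  simp only [deriv, smul_re, smul_im, Pi.add_apply, Pi.sub_apply, Pi.smul_apply', map_add,
    map_sub, map_smul, Pi.mul_apply]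
  rw [← Complex.re_add_im (f x)]
  simp only [Complex.real_smul, Complex.re_add_im]
  linear_combination (-(f x).im * mvfderiv (𝓡 4) h x (V.im x) : ℂ) * Complex.I_sq
    + (mvfderiv (𝓡 4) h x (V.re x) + Complex.I * mvfderiv (𝓡 4) h x (V.im x))
      * Complex.re_add_im (f x)

theorem IsSmooth.inner (hV : V.IsSmooth) (hW : W.IsSmooth) : Smooth (g.inner V W) :=
  Smooth.mk_re_im ((g.smooth_val hV.re hW.re).sub (g.smooth_val hV.im hW.im))
    ((g.smooth_val hV.re hW.im).add (g.smooth_val hV.im hW.re))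

/-- The Lie bracket acts on functions as the commutator, provided that some field `X` has an
invertible component: apply the Jacobi identity to `V`, `W` and `f X`. -/
theorem deriv_bracket {X Y : ComplexField M} (hV : V.IsSmooth) (hW : W.IsSmooth)
    (hX : X.IsSmooth) (hXY : g.inner X Y = 1) (hf : Smooth f) :
    (V.bracket W).deriv f = V.deriv (W.deriv f) - W.deriv (V.deriv f) := by
  have key := congrArg (fun U ↦ g.inner U Y) (bracket_jacobi hV hW (hX.smul hf))
  have j2 := congrArg (fun U ↦ f * g.inner U Y) (bracket_jacobi hV hW hX)
  have hVX := hV.bracket hX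
  have hWX := hW.bracket hX
  simp only [bracket_smul_right _ hf hX,
    bracket_add_right _ (hX.smul (hW.deriv hf)) (hWX.smul hf),
    bracket_add_right _ (hX.smul (hV.deriv hf)) (hVX.smul hf),
    bracket_smul_right _ hf hVX, bracket_smul_right _ hf hWX,
    bracket_smul_right _ (hW.deriv hf) hX, bracket_smul_right _ (hV.deriv hf) hX,
    inner_add_left, inner_smul_left, hXY] at key j2
  linear_combination -key + j2

end ComplexField

end

section

section

variable {M : Type*} [TopologicalSpace M] [ChartedSpace (EuclideanSpace ℝ (Fin 4)) M]
  [IsManifold (𝓡 4) ∞ M]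

/-- The metric is nondegenerate. -/
theorem LorentzMetric.eq_zero_of_forall (g : LorentzMetric M) {x : M}
    {v : TangentSpace (𝓡 4) x} (h : ∀ w, g.val x v w = 0) : v = 0 := by
  obtain ⟨t, -, ht⟩ := g.signature x
  by_contra hv
  have := ht v hv (by rw [g.symm, h])
  rw [h] at this
  exact lt_irrefl _ this

namespace NullTetrad

variable {g : LorentzMetric M} (t : NullTetrad g)

theorem real_inner (x : M) :
    g.val x (t.l x) (t.l x) = 0 ∧ g.val x (t.n x) (t.n x) = 0 ∧ g.val x (t.l x) (t.n x) = 1 ∧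
    g.val x (t.l x) (t.mRe x) = 0 ∧ g.val x (t.l x) (t.mIm x) = 0 ∧
    g.val x (t.n x) (t.mRe x) = 0 ∧ g.val x (t.n x) (t.mIm x) = 0 ∧
    g.val x (t.mRe x) (t.mIm x) = 0 ∧ g.val x (t.mRe x) (t.mRe x) = -1 / 2 ∧
    g.val x (t.mIm x) (t.mIm x) = -1 / 2 := by
  have h1 := t.ll x
  have h2 := t.nn x
  have h3 := t.ln x
  have h4 := t.lm x
  have h5 := t.nm x
  have h6 := t.mm x
  have h7 := t.mmbar x
  simp only [LorentzMetric.inner, ComplexField.ofReal, ComplexField.conj, Pi.zero_apply,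
    Pi.neg_apply, map_neg, map_zero, zero_apply, g.symm x (t.mIm x) (t.mRe x)]
    at h1 h2 h3 h4 h5 h6 h7
  simp only [Complex.ext_iff] at h1 h2 h3 h4 h5 h6 h7
  simp at h1 h2 h3 h4 h5 h6 h7
  refine ⟨h1, h2, h3, h4.1, h4.2, h5.1, h5.2, ?_, ?_, ?_⟩ <;> linarith [h6.1, h6.2]

theorem eq_zero_of_real_inner {x : M} {v : TangentSpace (𝓡 4) x}
    (hl : g.val x v (t.l x) = 0) (hn : g.val x v (t.n x) = 0)
    (hr : g.val x v (t.mRe x) = 0) (hi : g.val x v (t.mIm x) = 0) : v = 0 := by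
  obtain ⟨ll, nn, ln, lr, li, nr, ni, ri, rr, ii⟩ := t.real_inner x
  let b : Fin 4 → TangentSpace (𝓡 4) x := ![t.l x, t.n x, t.mRe x, t.mIm x]
  have hb : LinearIndependent ℝ b := by
    rw [Fintype.linearIndependent_iff]
    intro c hc
    simp only [Fin.sum_univ_four, b, Matrix.cons_val] at hc
    have e (w : TangentSpace (𝓡 4) x) := congrArg (g.val x w) hc
    simp only [map_add, map_smul, smul_eq_mul, map_zero] at e
    have h1 := e (t.n x)
    have h2 := e (t.l x)
    have h3 := e (t.mRe x)
    have h4 := e (t.mIm x)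
    simp only [g.symm x (t.n x) (t.l x), g.symm x (t.mRe x) (t.l x), g.symm x (t.mRe x) (t.n x),
      g.symm x (t.mIm x) (t.l x), g.symm x (t.mIm x) (t.n x), g.symm x (t.mIm x) (t.mRe x),
      ll, nn, ln, lr, li, nr, ni, ri, rr, ii] at h1 h2 h3 h4
    intro i
    fin_cases i <;> simp <;> linarith
  have hs : Submodule.span ℝ (Set.range b) = ⊤ :=
    hb.span_eq_top_of_card_eq_finrank
      (finrank_euclideanSpace_fin (𝕜 := ℝ) (n := 4)).symm
  apply g.eq_zero_of_forall
  intro w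
  have hw : w ∈ Submodule.span ℝ (Set.range b) := hs ▸ Submodule.mem_top
  induction hw using Submodule.span_induction with
  | mem w hw =>
    obtain ⟨i, rfl⟩ := hw
    fin_cases i <;> simpa [b]
  | zero => simp
  | add u w _ _ hu hw => simp [hu, hw]
  | smul c w _ hw => simp [hw]

theorem e_smooth (a : Fin 4) : (t.e a).IsSmooth := by
  fin_cases a
  · exact ⟨t.smooth_l, smoothField_zero⟩
  · exact ⟨t.smooth_n, smoothField_zero⟩
  · exact ⟨t.smooth_mRe, t.smooth_mIm⟩
  · exact ⟨t.smooth_mRe, t.smooth_mIm.neg⟩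

/-- Complex conjugation on tetrad indices. -/
def cj : Fin 4 → Fin 4 := ![0, 1, 3, 2]

theorem e_conj (a : Fin 4) : (t.e a).conj = t.e (cj a) := by
  fin_cases a <;> ext x <;> simp [e, cj, ComplexField.conj, ComplexField.ofReal]

theorem inner_e (a b : Fin 4) : g.inner (t.e a) (t.e b) = fun _ ↦ eta a b := by
  funext x
  obtain ⟨ll, nn, ln, lr, li, nr, ni, ri, rr, ii⟩ := t.real_inner x
  fin_cases a <;> fin_cases b <;>
  simp [e, m, LorentzMetric.inner, ComplexField.conj, ComplexField.ofReal, eta,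
      g.symm x (t.n x) (t.l x), g.symm x (t.mRe x) (t.l x), g.symm x (t.mRe x) (t.n x),
      g.symm x (t.mIm x) (t.l x), g.symm x (t.mIm x) (t.n x), g.symm x (t.mIm x) (t.mRe x),
      ll, nn, ln, lr, li, nr, ni, ri, rr, ii]

theorem eta_eq (a b : Fin 4) : eta a b = if b = dual a then (sgn a : ℂ) else 0 := by
  fin_cases a <;> fin_cases b <;> simp [eta, dual, sgn]

theorem sum_eta {E : Type*} [AddCommGroup E] [Module ℂ E] (a : Fin 4) (v : Fin 4 → E) :
    ∑ b, eta a b • v b = (sgn a : ℂ) • v (dual a) := by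
  simp [eta_eq]

/-- Expansion of a field in the tetrad. -/
theorem expand (V : ComplexField M) :
    V = (g.inner V (t.e 1)) • t.e 0 + (g.inner V (t.e 0)) • t.e 1
      + (-g.inner V (t.e 3)) • t.e 2 + (-g.inner V (t.e 2)) • t.e 3 := by
  rw [← sub_eq_zero]
  set U := V - _ with hU
  have h (a : Fin 4) : g.inner U (t.e a) = 0 := by
    rw [hU, sub_eq_add_neg]
    simp only [ComplexField.inner_add_left, ComplexField.inner_neg_left,
      ComplexField.inner_smul_left, inner_e]
    funext x
    fin_cases a <;> simp [eta]
  have h0 (x) := congrFun (h 0) x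
  have h1 (x) := congrFun (h 1) x
  have h2 (x) := congrFun (h 2) x
  have h3 (x) := congrFun (h 3) x
  simp [e, m, LorentzMetric.inner, ComplexField.conj, ComplexField.ofReal, Complex.ext_iff]
    at h0 h1 h2 h3
  ext x
  · exact t.eq_zero_of_real_inner (h0 x).1 (h1 x).1 (by linarith [(h2 x).1, (h3 x).1])
      (by linarith [(h2 x).2, (h3 x).2])
  · exact t.eq_zero_of_real_inner (h0 x).2 (h1 x).2 (by linarith [(h2 x).2, (h3 x).2])
      (by linarith [(h2 x).1, (h3 x).1])

end NullTetrad

end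

end

section

/-- The algebra of smooth complex functions. -/
def smoothFns (M : Type*) [TopologicalSpace M] [ChartedSpace (EuclideanSpace ℝ (Fin 4)) M] :
    Subalgebra ℂ (M → ℂ) where
  carrier := {f | Smooth f}
  mul_mem' := Smooth.mul
  add_mem' := Smooth.add
  algebraMap_mem' := smooth_const

variable {M : Type*} [TopologicalSpace M] [ChartedSpace (EuclideanSpace ℝ (Fin 4)) M]
  [IsManifold (𝓡 4) ∞ M]

theorem Smooth.smul (c : ℂ) {f : M → ℂ} (h : Smooth f) : Smooth (c • f) :=
  (smoothFns M).smul_mem h c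

namespace NullTetrad

variable {g : LorentzMetric M} (t : NullTetrad g)

/-- The components `g([e_a, e_b], e_c)`. -/
def B (a b c : Fin 4) : M → ℂ := g.inner ((t.e a).bracket (t.e b)) (t.e c)

theorem B_smooth (a b c : Fin 4) : Smooth (t.B a b c) :=
  ((t.e_smooth a).bracket (t.e_smooth b)).inner g (t.e_smooth c)

theorem B_swap (a b c : Fin 4) : t.B a b c = -t.B b a c := by
  rw [B, ComplexField.bracket_swap, ComplexField.inner_neg_left]; rfl

theorem gam_eq (a b c : Fin 4) :
    t.gam a b c = (1 / 2 : ℂ) • (t.B a b c - t.B a c b - t.B b c a) := by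
  simp only [gam, LorentzMetric.nabla, inner_e, ComplexField.deriv_const, B]
  congr 1
  abel

theorem gam_smooth (a b c : Fin 4) : Smooth (t.gam a b c) := by
  rw [gam_eq]
  exact (((t.B_smooth _ _ _).sub (t.B_smooth _ _ _)).sub (t.B_smooth _ _ _)).smul _

theorem gam_swap (a b c : Fin 4) : t.gam a b c = -t.gam a c b := by
  rw [gam_eq, gam_eq, t.B_swap c b a]
  module

theorem torsion (a b c : Fin 4) : t.gam a b c - t.gam b a c = t.B a b c := by
  rw [gam_eq, gam_eq, t.B_swap b a c]
  module

theorem Gam_eq (a b c : Fin 4) : t.Gam a b c = (sgn c : ℂ) • t.gam a b (dual c) :=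
  sum_eta c _

theorem strc_eq_B (a b c : Fin 4) : t.strc a b c = (sgn c : ℂ) • t.B a b (dual c) :=
  sum_eta c _

theorem strc_eq (a b c : Fin 4) : t.strc a b c = t.Gam a b c - t.Gam b a c := by
  rw [strc_eq_B, Gam_eq, Gam_eq, ← torsion, smul_sub]

theorem strc_smooth (a b c : Fin 4) : Smooth (t.strc a b c) := by
  rw [strc_eq_B]; exact (t.B_smooth _ _ _).smul _

theorem D_smooth (a : Fin 4) {f : M → ℂ} (hf : Smooth f) : Smooth (t.D a f) :=
  (t.e_smooth a).deriv hf

theorem bracket_expand (a b : Fin 4) : (t.e a).bracket (t.e b)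
    = t.strc a b 0 • t.e 0 + t.strc a b 1 • t.e 1 + t.strc a b 2 • t.e 2
      + t.strc a b 3 • t.e 3 := by
  rw [t.expand ((t.e a).bracket (t.e b))]
  simp [strc_eq_B, sgn, dual, B]

theorem D_comm (a b : Fin 4) {f : M → ℂ} (hf : Smooth f) :
    t.D a (t.D b f) - t.D b (t.D a f) = ∑ h, t.strc a b h * t.D h f := by
  have hX : g.inner (t.e 0) (t.e 1) = 1 := by rw [inner_e]; funext x; simp [eta]
  have := ComplexField.deriv_bracket g (t.e_smooth a) (t.e_smooth b) (t.e_smooth 0) hX hf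
  rw [bracket_expand] at this
  simp only [ComplexField.deriv_add_left, ComplexField.deriv_smul_left] at this
  rw [Fin.sum_univ_four]
  exact this.symm

theorem inner_bracket_bracket (a b c d : Fin 4) :
    (sgn d : ℂ) • g.inner ((t.e a).bracket ((t.e b).bracket (t.e c))) (t.e (dual d))
      = t.D a (t.strc b c d) + ∑ h, t.strc b c h * t.strc a h d := by
  have hs (h : Fin 4) := (t.e_smooth h).smul (t.strc_smooth b c h)
  rw [bracket_expand t b c]
  rw [ComplexField.bracket_add_right _ (((hs 0).add (hs 1)).add (hs 2)) (hs 3),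
    ComplexField.bracket_add_right _ ((hs 0).add (hs 1)) (hs 2),
    ComplexField.bracket_add_right _ (hs 0) (hs 1)]
  simp only [ComplexField.bracket_smul_right _ (t.strc_smooth b c _) (t.e_smooth _),
    ComplexField.inner_add_left, ComplexField.inner_smul_left, inner_e, Fin.sum_univ_four,
    strc_eq_B t a]
  funext x
  simp only [Pi.smul_apply, Pi.add_apply, Pi.mul_apply, smul_eq_mul, B, D]
  fin_cases d <;> simp [eta, dual, sgn] <;> ring

theorem jacobi_strc (a b c d : Fin 4) :
    t.D a (t.strc b c d) + t.D b (t.strc c a d) + t.D c (t.strc a b d)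
      + ∑ h, (t.strc b c h * t.strc a h d + t.strc c a h * t.strc b h d
        + t.strc a b h * t.strc c h d) = 0 := by
  have key := congrArg (fun U ↦ (sgn d : ℂ) • g.inner U (t.e (dual d)))
    (ComplexField.bracket_jacobi (t.e_smooth a) (t.e_smooth b) (t.e_smooth c))
  have h1 : ((t.e a).bracket (t.e b)).bracket (t.e c)
      = -(t.e c).bracket ((t.e a).bracket (t.e b)) := ComplexField.bracket_swap _ _
  have h2 : (t.e b).bracket ((t.e a).bracket (t.e c))
      = -(t.e b).bracket ((t.e c).bracket (t.e a)) := by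
    rw [ComplexField.bracket_swap (t.e a) (t.e c),
      ComplexField.bracket_neg_right _ ((t.e_smooth c).bracket (t.e_smooth a))]
  simp only [h1, h2, ComplexField.inner_add_left, ComplexField.inner_neg_left, smul_add,
    smul_neg, inner_bracket_bracket] at key
  simp only [Finset.sum_add_distrib]
  linear_combination key

theorem D_add (a : Fin 4) {f h : M → ℂ} (hf : Smooth f) (hh : Smooth h) :
    t.D a (f + h) = t.D a f + t.D a h := ComplexField.deriv_add _ hf hh

theorem D_mul (a : Fin 4) {f h : M → ℂ} (hf : Smooth f) (hh : Smooth h) :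
    t.D a (f * h) = f * t.D a h + h * t.D a f := ComplexField.deriv_mul _ hf hh

/-- The tetrad algebra of a null tetrad. -/
def alg : TetradAlgebra (smoothFns M) where
  D a := Derivation.mk' (AddMonoidHom.toIntLinearMap
    { toFun f := ⟨t.D a f, t.D_smooth a f.2⟩
      map_zero' := Subtype.ext (ComplexField.deriv_const _ 0)
      map_add' f h := Subtype.ext (t.D_add a f.2 h.2) })
    fun f h ↦ Subtype.ext (t.D_mul a f.2 h.2)
  gam a b c := ⟨t.gam a b c, t.gam_smooth a b c⟩
  gam_symm a b c := Subtype.ext (t.gam_swap a b c)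
  gam_self a b := Subtype.ext (by
    have := t.gam_swap a b b
    funext x
    have h := congrFun this x
    simp only [Pi.neg_apply] at h
    exact self_eq_neg.1 h)
  comm a b f := Subtype.ext (by
    refine (t.D_comm a b f.2).trans ?_
    simp only [strc_eq, Gam_eq, AddSubmonoidClass.coe_finsetSum]
    rfl)
  jacobi a b c d := by
    intro C
    have hC : C = fun a b h ↦ ⟨t.strc a b h, t.strc_smooth a b h⟩ := by
      funext a b h
      apply Subtype.ext
      simp only [strc_eq, Gam_eq]
      rfl
    rw [hC]
    apply Subtype.ext
    refine Eq.trans ?_ (t.jacobi_strc a b c d)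
    simp only [Subalgebra.coe_add, Subalgebra.coe_mul, AddSubmonoidClass.coe_finsetSum]
    rfl

end NullTetrad

end

section

theorem bar_zero {M : Type*} : bar (0 : M → ℂ) = 0 := by funext x; simp [bar]

variable {M : Type*} [TopologicalSpace M] [ChartedSpace (EuclideanSpace ℝ (Fin 4)) M]
  [IsManifold (𝓡 4) ∞ M]

theorem eq_zero_of_natCast_mul {n : ℕ} (hn : n ≠ 0) {f : smoothFns M}
    (h : (n : smoothFns M) * f = 0) : f = 0 := by
  apply Subtype.ext
  funext x
  have := congrFun (congrArg Subtype.val h) x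
  have h2 : (n : ℂ) * (f : M → ℂ) x = 0 := this
  simpa [hn] using h2

namespace NullTetrad

variable {g : LorentzMetric M} (t : NullTetrad g)

theorem coe_D (a : Fin 4) (f : smoothFns M) : ((t.alg.D a f : smoothFns M) : M → ℂ) = t.D a f :=
  rfl

theorem coe_gam (a b c : Fin 4) : ((t.alg.gam a b c : smoothFns M) : M → ℂ) = t.gam a b c := rfl

theorem coe_Gam (a b c : Fin 4) : ((t.alg.Gam a b c : smoothFns M) : M → ℂ) = t.Gam a b c := by
  rw [Gam_eq]; rfl

theorem coe_strc (a b c : Fin 4) : ((t.alg.strc a b c : smoothFns M) : M → ℂ) = t.strc a b c := by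
  rw [strc_eq, ← coe_Gam, ← coe_Gam]; rfl

theorem coe_riemUp (a b c d : Fin 4) :
    ((t.alg.riemUp a b c d : smoothFns M) : M → ℂ) = t.riemUp a b c d := by
  simp only [TetradAlgebra.riemUp, riemUp, Subalgebra.coe_add, Subalgebra.coe_sub,
    Subalgebra.coe_mul, AddSubmonoidClass.coe_finsetSum, coe_D, coe_Gam, coe_strc]

theorem coe_riem (a b c d : Fin 4) :
    ((t.alg.riem a b c d : smoothFns M) : M → ℂ) = t.riem a b c d := by
  rw [riem, sum_eta, ← coe_riemUp]; rfl

theorem coe_ricci (a b : Fin 4) :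
    ((t.alg.ricci a b : smoothFns M) : M → ℂ) = t.ricci a b := by
  simp only [TetradAlgebra.ricci, ricci, AddSubmonoidClass.coe_finsetSum, coe_riemUp]

/-! ### Complex conjugation -/

theorem bar_B (a b c : Fin 4) : bar (t.B a b c) = t.B (cj a) (cj b) (cj c) := by
  rw [B, ← ComplexField.inner_conj, ← ComplexField.bracket_conj _ _ (t.e_smooth a) (t.e_smooth b),
    e_conj, e_conj, e_conj, B]

theorem bar_gam (a b c : Fin 4) : bar (t.gam a b c) = t.gam (cj a) (cj b) (cj c) := by
  rw [gam_eq, gam_eq, ← bar_B, ← bar_B, ← bar_B]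
  funext x
  simp [bar, Complex.conj_ofNat]

theorem bar_Gam (a b c : Fin 4) : bar (t.Gam a b c) = t.Gam (cj a) (cj b) (cj c) := by
  have h1 : sgn (cj c) = sgn c := by fin_cases c <;> rfl
  have h2 : dual (cj c) = cj (dual c) := by fin_cases c <;> rfl
  rw [Gam_eq, Gam_eq, h1, h2, ← bar_gam]
  funext x
  simp [bar]

theorem bar_strc (a b c : Fin 4) : bar (t.strc a b c) = t.strc (cj a) (cj b) (cj c) := by
  rw [strc_eq, strc_eq, ← bar_Gam, ← bar_Gam]
  funext x
  simp [bar]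

theorem bar_D (a : Fin 4) {f : M → ℂ} (hf : Smooth f) : bar (t.D a f) = t.D (cj a) (bar f) := by
  rw [D, ← ComplexField.deriv_bar _ hf, e_conj, D]

theorem Gam_smooth (a b c : Fin 4) : Smooth (t.Gam a b c) := by
  rw [Gam_eq]; exact (t.gam_smooth _ _ _).smul _

theorem sum_cj {E : Type*} [AddCommMonoid E] (v : Fin 4 → E) : ∑ h, v (cj h) = ∑ h, v h := by
  simp only [Fin.sum_univ_four, cj, Matrix.cons_val]
  rw [add_assoc, add_comm (v 3), ← add_assoc]

theorem bar_riemUp (a b c d : Fin 4) :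
    bar (t.riemUp a b c d) = t.riemUp (cj a) (cj b) (cj c) (cj d) := by
  have h1 := t.bar_D a (t.Gam_smooth b c d)
  have h2 := t.bar_D b (t.Gam_smooth a c d)
  rw [bar_Gam] at h1 h2
  rw [riemUp, riemUp, ← h1, ← h2]
  conv_rhs => rw [← sum_cj, ← sum_cj (fun h ↦ t.strc _ _ h * _)]
  simp only [← bar_Gam, ← bar_strc]
  funext x
  simp [bar]

theorem bar_riem (a b c d : Fin 4) :
    bar (t.riem a b c d) = t.riem (cj a) (cj b) (cj c) (cj d) := by
  have h1 : sgn (cj d) = sgn d := by fin_cases d <;> rfl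
  have h2 : dual (cj d) = cj (dual d) := by fin_cases d <;> rfl
  rw [riem, riem, sum_eta, sum_eta, h1, h2, ← bar_riemUp]
  funext x
  simp [bar]

/-! ### Einstein spacetimes of type II -/

variable {t} {Λ : ℝ}

/-- The constant `2Λ` as a smooth function. -/
def lam (M : Type*) [TopologicalSpace M] [ChartedSpace (EuclideanSpace ℝ (Fin 4)) M] (Λ : ℝ) :
    smoothFns M := algebraMap ℂ _ (2 * Λ)

theorem IsEinstein.ricci_eq (hE : t.IsEinstein Λ) (a b : Fin 4) :
    t.ricci a b = fun _ ↦ eta a b * (6 * Λ) := by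
  funext x
  linear_combination hE.tracefree a b x + eta a b / 4 * hE.scal_eq x

theorem IsEinstein.scal_eq' (hE : t.IsEinstein Λ) : t.scal = fun _ ↦ (24 * Λ : ℂ) :=
  funext hE.scal_eq

theorem IsEinstein.Psi0_eq (hE : t.IsEinstein Λ) : t.Psi0 = t.riem 0 2 0 2 := by
  funext x
  simp [Psi0, weyl, hE.ricci_eq, hE.scal_eq', eta]

theorem IsEinstein.Psi1_eq (hE : t.IsEinstein Λ) : t.Psi1 = t.riem 0 2 0 1 := by
  funext x
  simp [Psi1, weyl, hE.ricci_eq, hE.scal_eq', eta]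

theorem IsEinstein.Psi2_eq (hE : t.IsEinstein Λ) :
    t.Psi2 = ((-t.alg.riem 0 2 1 3 - lam M Λ : smoothFns M) : M → ℂ) := by
  rw [t.alg.riem_swap_right, neg_neg, Subalgebra.coe_sub, coe_riem]
  funext x
  simp [Psi2, weyl, hE.ricci_eq, hE.scal_eq', eta, lam]
  ring

theorem IsEinstein.special (hE : t.IsEinstein Λ) (hII : t.IsTypeII) :
    t.alg.Special (lam M Λ) where
  two f hf := eq_zero_of_natCast_mul (n := 2) two_ne_zero hf
  ricci_eq a b := by
    apply Subtype.ext
    rw [coe_ricci, hE.ricci_eq]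
    funext x
    rw [eta_eq]
    split_ifs
    · change _ = ((sgn a : ℂ) * (3 * (2 * Λ)))
      ring
    · simp
  psi0 := Subtype.ext (by rw [coe_riem, ← hE.Psi0_eq]; exact funext hII.psi0)
  psi0b := Subtype.ext (by
    rw [coe_riem]
    refine (t.bar_riem 0 2 0 2).symm.trans ?_
    rw [← hE.Psi0_eq, show t.Psi0 = 0 from funext hII.psi0, bar_zero]
    rfl)
  psi1 := Subtype.ext (by rw [coe_riem, ← hE.Psi1_eq]; exact funext hII.psi1)
  psi1b := Subtype.ext (by
    rw [coe_riem]
    refine (t.bar_riem 0 2 0 1).symm.trans ?_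
    rw [← hE.Psi1_eq, show t.Psi1 = 0 from funext hII.psi1, bar_zero]
    rfl)
  D_L a := Subtype.ext (ComplexField.deriv_const _ _)

theorem IsEinstein.kappa_sigma (hE : t.IsEinstein Λ) (hII : t.IsTypeII) :
    t.alg.gam 0 0 2 = 0 ∧ t.alg.gam 2 0 2 = 0 := by
  refine (hE.special hII).kappa_sigma (fun f hf ↦ ?_)
    fun f hf ↦ eq_zero_of_natCast_mul (n := 3) three_ne_zero hf
  apply Subtype.ext
  funext x
  have h := congrFun (congrArg Subtype.val hf) x
  have h2 : t.Psi2 x * (f : M → ℂ) x = 0 := by rw [hE.Psi2_eq]; exact h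
  exact (mul_eq_zero.1 h2).resolve_left (hII.psi2 x)

/-- The tetrad algebra of an Einstein spacetime of Petrov type II is of type II. -/
def IsEinstein.typeII (hE : t.IsEinstein Λ) (hII : t.IsTypeII) : t.alg.TypeII :=
  (hE.special hII).typeII (hE.kappa_sigma hII).1
    (Subtype.ext ((t.bar_gam 0 0 2).symm.trans (by
      rw [← coe_gam, (hE.kappa_sigma hII).1]; exact bar_zero)))
    (hE.kappa_sigma hII).2
    (Subtype.ext ((t.bar_gam 2 0 2).symm.trans (by
      rw [← coe_gam, (hE.kappa_sigma hII).2]; exact bar_zero)))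

theorem IsEinstein.coe_psi2 (hE : t.IsEinstein Λ) (hII : t.IsTypeII) :
    (((hE.typeII hII).psi2 : smoothFns M) : M → ℂ) = t.Psi2 := hE.Psi2_eq.symm

theorem IsEinstein.typeII_L (hE : t.IsEinstein Λ) (hII : t.IsTypeII) :
    (hE.typeII hII).L = lam M Λ := rfl

end NullTetrad

end

section

namespace NullTetrad

variable {M : Type*} [TopologicalSpace M] [ChartedSpace (EuclideanSpace ℝ (Fin 4)) M]
  [IsManifold (𝓡 4) ∞ M] {g : LorentzMetric M} {t : NullTetrad g}

/-- A compatible map from a module with derivations to functions on the manifold. -/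
structure Realizes {V : Type*} [AddCommGroup V] [Module (smoothFns M) V] (N : t.alg.Conn V)
    (φ : V →+ (M → ℂ)) : Prop where
  D (a : Fin 4) (v : V) : φ (N.D a v) = t.D a (φ v)
  smul (f : smoothFns M) (v : V) : φ (f • v) = (f : M → ℂ) * φ v

variable (t) in
theorem bar_coeffs :
    bar t.rho = t.alg.gam 2 0 3 ∧ bar t.tau = t.alg.gam 1 0 3 ∧ bar t.rho' = t.alg.gam 3 1 2 ∧
    bar t.tau' = t.alg.gam 0 1 2 ∧ bar t.sigma' = t.alg.gam 2 1 2 :=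
  ⟨t.bar_gam 3 0 2, t.bar_gam 1 0 2, t.bar_gam 2 1 3, t.bar_gam 0 1 3, t.bar_gam 3 1 3⟩

variable (t) in
theorem coeffs : t.rho = t.alg.gam 3 0 2 ∧ t.tau = t.alg.gam 1 0 2 ∧ t.rho' = t.alg.gam 2 1 3 ∧
    t.tau' = t.alg.gam 0 1 3 := ⟨rfl, rfl, rfl, rfl⟩

theorem bar_half_smul {M : Type*} (f h : M → ℂ) :
    bar ((1 / 2 : ℂ) • (f + h)) = (1 / 2 : ℂ) • (bar f + bar h) := by
  funext x
  simp [bar, Complex.conj_ofNat]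

variable {V : Type*} [AddCommGroup V] [Module (smoothFns M) V] {N : t.alg.Conn V}
  {φ : V →+ (M → ℂ)}

namespace Realizes

theorem d (r : Realizes N φ) (p q : ℤ) (a : Fin 4) (v : V) : φ (N.d p q a v)
    = t.D a (φ v) - ((p : M → ℂ) * t.gam a 0 1 + (q : M → ℂ) * t.gam a 3 2) * φ v := by
  rw [TetradAlgebra.Conn.d, map_sub, r.D, r.smul]
  rfl

theorem tho (r : Realizes N φ) {P Q : ℤ} (p q : ℤ) (v : V) (hP : P = p + q := by norm_num)
    (hQ : Q = p - q := by norm_num) : t.tho P Q (φ v) = φ (N.d p q 0 v) := by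
  rw [hP, hQ, r.d, NullTetrad.tho, eps, bar_half_smul, bar_gam, bar_gam]
  funext x
  simp only [cj, Matrix.cons_val, t.gam_swap 0 2 3]
  simp only [Pi.sub_apply, Pi.add_apply, Pi.mul_apply, Pi.smul_apply, Pi.neg_apply,
    Pi.intCast_apply, smul_eq_mul, Int.cast_add, Int.cast_sub]
  ring

theorem tho' (r : Realizes N φ) {P Q : ℤ} (p q : ℤ) (v : V) (hP : P = p + q := by norm_num)
    (hQ : Q = p - q := by norm_num) : t.tho' P Q (φ v) = φ (N.d p q 1 v) := by
  rw [hP, hQ, r.d, NullTetrad.tho', eps', bar_half_smul, bar_gam, bar_gam]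
  funext x
  simp only [cj, Matrix.cons_val, t.gam_swap 1 2 3, t.gam_swap 1 1 0]
  simp only [Pi.sub_apply, Pi.add_apply, Pi.mul_apply, Pi.smul_apply, Pi.neg_apply,
    Pi.intCast_apply, smul_eq_mul, Int.cast_add, Int.cast_sub]
  ring

theorem edt (r : Realizes N φ) {P Q : ℤ} (p q : ℤ) (v : V) (hP : P = p + q := by norm_num)
    (hQ : Q = p - q := by norm_num) : t.edt P Q (φ v) = φ (N.d p q 2 v) := by
  rw [hP, hQ, r.d, NullTetrad.edt, beta, beta', bar_half_smul, bar_gam, bar_gam]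
  funext x
  simp only [cj, Matrix.cons_val, t.gam_swap 2 1 0]
  simp only [Pi.sub_apply, Pi.add_apply, Pi.mul_apply, Pi.smul_apply, Pi.neg_apply,
    Pi.intCast_apply, smul_eq_mul, Int.cast_add, Int.cast_sub]
  ring

theorem edt' (r : Realizes N φ) {P Q : ℤ} (p q : ℤ) (v : V) (hP : P = p + q := by norm_num)
    (hQ : Q = p - q := by norm_num) : t.edt' P Q (φ v) = φ (N.d p q 3 v) := by
  rw [hP, hQ, r.d, NullTetrad.edt', beta, beta', bar_half_smul, bar_gam, bar_gam]
  funext x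
  simp only [cj, Matrix.cons_val, t.gam_swap 3 1 0, t.gam_swap 3 2 3]
  simp only [Pi.sub_apply, Pi.add_apply, Pi.mul_apply, Pi.smul_apply, Pi.neg_apply,
    Pi.intCast_apply, smul_eq_mul, Int.cast_add, Int.cast_sub]
  ring

theorem S (r : Realizes N φ) (x : Fin 4 → Fin 4 → V) :
    t.S (fun a b ↦ φ (x a b)) = φ (N.S x) := by
  obtain ⟨b1, -, -, b4, b5⟩ := t.bar_coeffs
  obtain ⟨c1, c2, -, -⟩ := t.coeffs
  have y : (t.tho 2 0 (φ (x 0 2)) - 2 * bar t.rho * φ (x 0 2))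
      - (t.edt 2 2 (φ (x 0 0)) - bar t.tau' * φ (x 0 0)) = φ (N.Sy x) := by
    rw [show t.tho 2 0 _ = _ from r.tho 1 1 _, show t.edt 2 2 _ = _ from r.edt 2 0 _, b1, b4]
    simp only [TetradAlgebra.Conn.Sy, map_sub, r.smul]
    rfl
  have z : bar t.sigma' * φ (x 0 0) + (t.edt 2 0 (φ (x 0 2)) - 2 * bar t.tau' * φ (x 0 2))
      - (t.tho 2 (-2) (φ (x 2 2)) - bar t.rho * φ (x 2 2)) = φ (N.Sz x) := by
    rw [show t.edt 2 0 _ = _ from r.edt 1 1 _, show t.tho 2 (-2) _ = _ from r.tho 0 2 _, b1, b4, b5]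
    simp only [TetradAlgebra.Conn.Sz, map_add, map_sub, r.smul]
    rfl
  simp only [NullTetrad.S, y, z]
  rw [show t.edt 3 1 _ = _ from r.edt 2 1 _, show t.tho 3 (-1) _ = _ from r.tho 1 2 _, b1, b4,
    c1, c2]
  simp only [TetradAlgebra.Conn.S, map_add, map_sub, r.smul]
  rfl

theorem O {Λ : ℝ} (r : Realizes N φ) (hE : t.IsEinstein Λ) (hII : t.IsTypeII) (v : V) :
    t.O (φ v) = φ ((hE.typeII hII).O N v) := by
  obtain ⟨b1, -, -, b4, b5⟩ := t.bar_coeffs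
  obtain ⟨c1, c2, c3, c4⟩ := t.coeffs
  have y : t.tho' 4 0 (φ v) - t.rho' * φ v = φ (N.d 2 2 1 v - t.alg.gam 2 1 3 • v) := by
    rw [show t.tho' 4 0 _ = _ from r.tho' 2 2 _, c3, map_sub, r.smul]
  have z : t.edt' 4 0 (φ v) - t.tau' * φ v = φ (N.d 2 2 3 v - t.alg.gam 0 1 3 • v) := by
    rw [show t.edt' 4 0 _ = _ from r.edt' 2 2 _, c4, map_sub, r.smul]
  simp only [NullTetrad.O, y, z]
  rw [show t.edt 3 1 _ = _ from r.edt 2 1 _, show t.tho 3 (-1) _ = _ from r.tho 1 2 _, b1, b4,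
    c1, c2, ← hE.coe_psi2 hII]
  simp only [TetradAlgebra.TypeII.O, map_sub, r.smul]
  rfl

end Realizes

end NullTetrad

end

section

namespace NullTetrad

variable {M : Type*} [TopologicalSpace M] [ChartedSpace (EuclideanSpace ℝ (Fin 4)) M]
  [IsManifold (𝓡 4) ∞ M] {g : LorentzMetric M} (t : NullTetrad g)

/-- The inclusion of smooth functions into all functions. -/
def incl (M : Type*) [TopologicalSpace M] [ChartedSpace (EuclideanSpace ℝ (Fin 4)) M] :
    smoothFns M →+ (M → ℂ) where
  toFun f := f
  map_zero' := rfl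
  map_add' _ _ := rfl

theorem realizes_incl : Realizes t.alg.fn (incl M) := ⟨fun _ _ ↦ rfl, fun _ _ ↦ rfl⟩

theorem incl_zsmul (n : ℤ) (f : smoothFns M) : incl M (n • f) = (n : ℂ) • incl M f := by
  rw [map_zsmul, Int.cast_smul_eq_zsmul]

variable (X : Fin 4 → Fin 4 → smoothFns M)

theorem coe_cov2 (c a b : Fin 4) :
    t.cov2 (fun a b ↦ incl M (X a b)) c a b = incl M (t.alg.fn.cov2 X c a b) := by
  simp only [TetradAlgebra.Conn.cov2, map_sub, map_sum, t.realizes_incl.smul, coe_Gam]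
  rfl

theorem coe_cov22 (d c a b : Fin 4) : t.cov22 (fun a b ↦ incl M (X a b)) d c a b
    = incl M (t.alg.fn.cov3 (t.alg.fn.cov2 X) d c a b) := by
  simp only [cov22, coe_cov2, TetradAlgebra.Conn.cov3, map_sub, map_sum, t.realizes_incl.smul,
    coe_Gam]
  rfl

theorem coe_hess (f : smoothFns M) (a b : Fin 4) :
    t.hess (incl M f) a b = incl M (t.alg.fn.hess f a b) := by
  simp only [TetradAlgebra.Conn.hess, map_sub, map_sum, t.realizes_incl.smul, coe_Gam]
  rfl

theorem coe_tr : tr (fun a b ↦ incl M (X a b)) = incl M (TetradAlgebra.Conn.tr X) := by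
  simp only [tr, sum_eta, TetradAlgebra.Conn.tr, map_sum, incl_zsmul]

theorem coe_E (Λ : ℝ) (a b : Fin 4) : t.E Λ (fun a b ↦ incl M (X a b)) a b
    = (1 / 2 : ℂ) • incl M (t.alg.fn.E2 (lam M Λ) X a b) := by
  have e : ((if b = dual a then sgn a else 0 : ℤ) : ℂ) = eta a b := by
    rw [eta_eq]; split_ifs <;> simp
  have e2 (f : smoothFns M) : incl M ((6 * lam M Λ) • f) = (6 * (2 * Λ) : ℂ) • incl M f := rfl
  simp only [E, coe_tr, coe_hess, coe_cov22, sum_eta, mul_smul (eta _ _), ← Finset.smul_sum,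
    TetradAlgebra.Conn.E2, map_add, map_sub, map_neg, map_sum, incl_zsmul, e, Int.cast_mul, e2,
    mul_smul (sgn _ : ℂ)]
  module

theorem coe_T : t.T (fun a b ↦ incl M (X a b))
    = (1 / 2 : ℂ) • incl M (t.alg.fn.T2 X) := by
  have r := t.realizes_incl
  obtain ⟨b1, -, -, b4, b5⟩ := t.bar_coeffs
  have u : t.edt 2 2 (incl M (X 0 0)) = incl M (t.alg.fn.d 2 0 2 (X 0 0)) := r.edt 2 0 _
  have v : t.tho 2 (-2) (incl M (X 2 2)) = incl M (t.alg.fn.d 0 2 0 (X 2 2)) := r.tho 0 2 _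
  have b1 : bar t.rho = incl M (t.alg.gam 2 0 3) := b1
  have b4 : bar t.tau' = incl M (t.alg.gam 0 1 2) := b4
  have b5 : bar t.sigma' = incl M (t.alg.gam 2 1 2) := b5
  have e (f h : smoothFns M) : incl M f * incl M h = incl M (f * h) := rfl
  have e2 : (2 : M → ℂ) = incl M 2 := rfl
  have w : t.edt 2 0 (incl M (X 0 2)) = incl M (t.alg.fn.d 1 1 2 (X 0 2)) := r.edt 1 1 _
  have hs : t.tho 1 (-3) (incl M (t.alg.gam 2 1 2))
      = incl M (t.alg.fn.d (-1) 2 0 (t.alg.gam 2 1 2)) := r.tho (-1) 2 _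
  have hr : t.edt 1 1 (incl M (t.alg.gam 2 0 3))
      = incl M (t.alg.fn.d 1 0 2 (t.alg.gam 2 0 3)) := r.edt 1 0 _
  have z1 (f : smoothFns M) : t.edt 3 1 (incl M f) = incl M (t.alg.fn.d 2 1 2 f) := r.edt 2 1 f
  have z2 (f : smoothFns M) : t.tho 2 2 (incl M f) = incl M (t.alg.fn.d 2 0 0 f) := r.tho 2 0 f
  have z3 (f : smoothFns M) : t.tho 3 (-1) (incl M f) = incl M (t.alg.fn.d 1 2 0 f) :=
    r.tho 1 2 f
  simp only [T, b1, b4, b5, u, v, w, hs, hr, z1, z2, z3, e, e2, ← map_sub]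
  have hs' : t.alg.fn.d (-1) 2 0 (t.alg.gam 2 1 2) = t.alg.D 0 (t.alg.gam 2 1 2)
      + t.alg.gam 0 0 1 * t.alg.gam 2 1 2 - 2 * t.alg.gam 0 3 2 * t.alg.gam 2 1 2 := by
    change t.alg.D 0 (t.alg.gam 2 1 2) - (((-1 : ℤ) : smoothFns M) * t.alg.gam 0 0 1
      + ((2 : ℤ) : smoothFns M) * t.alg.gam 0 3 2) * t.alg.gam 2 1 2 = _
    push_cast
    ring
  have hr' : t.alg.fn.d 1 0 2 (t.alg.gam 2 0 3) = t.alg.D 2 (t.alg.gam 2 0 3)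
      - t.alg.gam 2 0 1 * t.alg.gam 2 0 3 := by
    change t.alg.D 2 (t.alg.gam 2 0 3) - (((1 : ℤ) : smoothFns M) * t.alg.gam 2 0 1
      + ((0 : ℤ) : smoothFns M) * t.alg.gam 2 3 2) * t.alg.gam 2 0 3 = _
    push_cast
    ring
  rw [hs', hr']
  have e3 (f : smoothFns M) : incl M f = (1 / 2 : ℂ) • incl M ((2 : smoothFns M) • f) := by
    rw [smul_eq_mul, ← e, ← e2]
    funext y
    simp
  rw [e3 (t.alg.fn.d 1 2 0 _ - _ - _), ← smul_add, ← smul_sub, ← map_add, ← map_sub]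
  rfl

end NullTetrad

end

section

namespace NullTetrad

variable {M : Type*} [TopologicalSpace M] [ChartedSpace (EuclideanSpace ℝ (Fin 4)) M]
  [IsManifold (𝓡 4) ∞ M] {g : LorentzMetric M} (t : NullTetrad g)

/-! ### The adjoint operators -/

theorem coe_Sdag (χ : smoothFns M) (a b : Fin 4) :
    t.Sdag (incl M χ) a b = incl M (TetradAlgebra.TypeII.Sdag t.alg χ a b) := by
  have r := t.realizes_incl
  obtain ⟨-, -, -, b4, b5⟩ := t.bar_coeffs
  have b4 : bar t.tau' = incl M (t.alg.gam 0 1 2) := b4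
  have b5 : bar t.sigma' = incl M (t.alg.gam 2 1 2) := b5
  have c1 : t.rho = incl M (t.alg.gam 3 0 2) := rfl
  have c2 : t.tau = incl M (t.alg.gam 1 0 2) := rfl
  have e (f h : smoothFns M) : incl M f * incl M h = incl M (f * h) := rfl
  have e2 : (2 : M → ℂ) = incl M 2 := rfl
  have z1 : t.tho (-4) 0 (incl M χ) = incl M (t.alg.fn.d (-2) (-2) 0 χ) := r.tho (-2) (-2) χ
  have z2 : t.edt (-4) 0 (incl M χ) = incl M (t.alg.fn.d (-2) (-2) 2 χ) := r.edt (-2) (-2) χ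
  have z3 (f : smoothFns M) : t.edt (-3) (-1) (incl M f) = incl M (t.alg.fn.d (-2) (-1) 2 f) :=
    r.edt (-2) (-1) f
  have z4 (f : smoothFns M) : t.tho (-3) (-1) (incl M f) = incl M (t.alg.fn.d (-2) (-1) 0 f) :=
    r.tho (-2) (-1) f
  have z5 (f : smoothFns M) : t.tho (-3) 1 (incl M f) = incl M (t.alg.fn.d (-1) (-2) 0 f) :=
    r.tho (-1) (-2) f
  have h1 : t.hnn (incl M χ) = incl M (TetradAlgebra.TypeII.hnn t.alg χ) := by
    simp only [hnn, z1, z2, z3, b5, c2, e, e2, ← map_add, ← map_neg, ← map_sub,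
      TetradAlgebra.TypeII.hnn]
  have h2 : t.hnmbar (incl M χ) = incl M (TetradAlgebra.TypeII.hnmbar t.alg χ) := by
    simp only [hnmbar, z1, z2, z4, b4, c1, c2, e, ← map_add, ← map_neg, ← map_sub,
      TetradAlgebra.TypeII.hnmbar]
  have h3 : t.hmbarmbar (incl M χ) = incl M (TetradAlgebra.TypeII.hmbarmbar t.alg χ) := by
    simp only [hmbarmbar, z1, z5, c1, e, e2, ← map_add, ← map_neg,
      TetradAlgebra.TypeII.hmbarmbar]
  fin_cases a <;> fin_cases b <;>
    simp [Sdag, TetradAlgebra.TypeII.Sdag, h1, h2, h3]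

variable {t} {Λ : ℝ}

theorem coe_Odag (hE : t.IsEinstein Λ) (hII : t.IsTypeII) (χ : smoothFns M) :
    t.Odag (incl M χ) = incl M ((hE.typeII hII).Odag χ) := by
  have r := t.realizes_incl
  obtain ⟨-, b2, b3, -, -⟩ := t.bar_coeffs
  have b2 : bar t.tau = incl M (t.alg.gam 1 0 3) := b2
  have b3 : bar t.rho' = incl M (t.alg.gam 3 1 2) := b3
  have c1 : t.rho = incl M (t.alg.gam 3 0 2) := rfl
  have c2 : t.tau = incl M (t.alg.gam 1 0 2) := rfl
  have hp : t.Psi2 = incl M (hE.typeII hII).psi2 := (hE.coe_psi2 hII).symm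
  have e (f h : smoothFns M) : incl M f * incl M h = incl M (f * h) := rfl
  have e2 : (2 : M → ℂ) = incl M 2 := rfl
  have e3 : (3 : M → ℂ) = incl M 3 := rfl
  have z1 : t.tho (-4) 0 (incl M χ) = incl M (t.alg.fn.d (-2) (-2) 0 χ) := r.tho (-2) (-2) χ
  have z2 : t.edt (-4) 0 (incl M χ) = incl M (t.alg.fn.d (-2) (-2) 2 χ) := r.edt (-2) (-2) χ
  have z3 (f : smoothFns M) : t.tho' (-3) 1 (incl M f) = incl M (t.alg.fn.d (-1) (-2) 1 f) :=
    r.tho' (-1) (-2) f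
  have z4 (f : smoothFns M) : t.edt' (-3) (-1) (incl M f) = incl M (t.alg.fn.d (-2) (-1) 3 f) :=
    r.edt' (-2) (-1) f
  simp only [Odag, b2, b3]
  simp only [c1, c2, hp, e, e2, e3, z1, z2, ← map_add, z3, z4, ← map_sub,
    TetradAlgebra.TypeII.Odag]

/-! ### The identity `S E = O T` and the Debye construction -/

theorem S_two {V : Type*} [AddCommGroup V] [Module (smoothFns M) V] (N : t.alg.Conn V)
    (y : Fin 4 → Fin 4 → V) : N.S (fun a b ↦ y a b + y a b) = N.S y + N.S y := by
  simp only [TetradAlgebra.Conn.S, TetradAlgebra.Conn.Sy, TetradAlgebra.Conn.Sz,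
    TetradAlgebra.Conn.d, map_add, map_sub, N.leibniz]
  module

theorem O_two {V : Type*} [AddCommGroup V] [Module (smoothFns M) V] (N : t.alg.Conn V)
    (H : t.alg.TypeII) (v : V) : H.O N (v + v) = H.O N v + H.O N v := by
  simp only [TetradAlgebra.TypeII.O, TetradAlgebra.Conn.d, map_add, map_sub, N.leibniz]
  module

theorem half_add_half (f : smoothFns M) : (1 / 2 : ℂ) • f + (1 / 2 : ℂ) • f = f := by
  rw [← add_smul]; norm_num

theorem S_E (hE : t.IsEinstein Λ) (hII : t.IsTypeII) (x : Tensor2 M)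
    (hx : ∀ a b, x a b = x b a) (hs : ∀ a b, Smooth (x a b)) : t.S (t.E Λ x) = t.O (t.T x) := by
  let X : Fin 4 → Fin 4 → smoothFns M := fun a b ↦ ⟨x a b, hs a b⟩
  have r := t.realizes_incl
  have h1 : t.E Λ x = fun a b ↦ incl M ((1 / 2 : ℂ) • t.alg.fn.E2 (lam M Λ) X a b) := by
    funext a b
    exact t.coe_E X Λ a b
  have h2 : t.T x = incl M ((1 / 2 : ℂ) • t.alg.fn.T2 X) := t.coe_T X
  rw [h1, h2, r.S, r.O hE hII]
  congr 1
  have key := (hE.typeII hII).S_E2 t.alg.fn (x := X) fun a b ↦ Subtype.ext (hx a b)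
  rw [hE.typeII_L] at key
  set Y : Fin 4 → Fin 4 → smoothFns M := fun a b ↦ (1 / 2 : ℂ) • t.alg.fn.E2 (lam M Λ) X a b
  set Z := (1 / 2 : ℂ) • t.alg.fn.T2 X with hZ
  have hY : t.alg.fn.E2 (lam M Λ) X = fun a b ↦ Y a b + Y a b := by
    funext a b
    exact (half_add_half _).symm
  rw [hY, S_two, ← half_add_half (t.alg.fn.T2 X), ← hZ, O_two] at key
  rw [← sub_eq_zero]
  apply eq_zero_of_natCast_mul (n := 2) two_ne_zero
  push_cast
  linear_combination key

theorem E_Sdag (hE : t.IsEinstein Λ) (hII : t.IsTypeII) (χ : M → ℂ) (hs : Smooth χ)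
    (hχ : t.Odag χ = 0) : t.E Λ (t.Sdag χ) = 0 := by
  let X : smoothFns M := ⟨χ, hs⟩
  have h0 : (hE.typeII hII).Odag X = 0 := by
    apply Subtype.ext
    exact (coe_Odag hE hII X).symm.trans hχ
  have h1 : t.Sdag χ = fun a b ↦ incl M (TetradAlgebra.TypeII.Sdag t.alg X a b) := by
    funext a b
    exact t.coe_Sdag X a b
  rw [h1]
  funext a b
  rw [coe_E]
  have := (hE.typeII hII).E2_Sdag
    (fun f hf ↦ eq_zero_of_natCast_mul (n := 2) two_ne_zero hf) h0 a b
  rw [hE.typeII_L] at this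
  rw [this, map_zero, smul_zero]
  rfl

end NullTetrad

end

section

/-- The ideal of smooth functions with compact support. -/
def compactFns (M : Type*) [TopologicalSpace M] [ChartedSpace (EuclideanSpace ℝ (Fin 4)) M] :
    Ideal (smoothFns M) where
  carrier := {f | HasCompactSupport (f : M → ℂ)}
  zero_mem' := HasCompactSupport.zero
  add_mem' := HasCompactSupport.add
  smul_mem' _ _ h := HasCompactSupport.mul_left h

/-- The type of smooth functions with compact support. -/
def CompactFns (M : Type*) [TopologicalSpace M] [ChartedSpace (EuclideanSpace ℝ (Fin 4)) M] :
    Type _ := compactFns M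

instance (M : Type*) [TopologicalSpace M] [ChartedSpace (EuclideanSpace ℝ (Fin 4)) M] :
    AddCommGroup (CompactFns M) := Submodule.addCommGroup (compactFns M)

instance (M : Type*) [TopologicalSpace M] [ChartedSpace (EuclideanSpace ℝ (Fin 4)) M] :
    Module (smoothFns M) (CompactFns M) := Submodule.module (compactFns M)

namespace NullTetrad

variable {M : Type*} [TopologicalSpace M] [ChartedSpace (EuclideanSpace ℝ (Fin 4)) M]
  [IsManifold (𝓡 4) ∞ M] {g : LorentzMetric M} (t : NullTetrad g)

theorem hasCompactSupport_D (a : Fin 4) {f : M → ℂ} (hf : HasCompactSupport f) :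
    HasCompactSupport (t.D a f) := by
  refine hf.mono' fun x hx ↦ ?_
  by_contra h
  apply hx
  have h0 : f =ᶠ[nhds x] fun _ ↦ (0 : ℂ) := notMem_tsupport_iff_eventuallyEq.1 h
  have h1 : mvfderiv (𝓡 4) f x = 0 := by
    rw [← mvfderiv_const (I := 𝓡 4) (0 : ℂ) (x := x)]
    exact h0.mfderiv_eq
  simp [D, ComplexField.deriv, h1]

/-- The derivations act on compactly supported functions. -/
def compactConn : t.alg.Conn (CompactFns M) where
  D a :=
    { toFun v := ⟨t.alg.D a v.1, t.hasCompactSupport_D a v.2⟩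
      map_zero' := Subtype.ext (map_zero _)
      map_add' v w := Subtype.ext (map_add (t.alg.D a) v.1 w.1) }
  leibniz a f v := Subtype.ext (t.alg.fn.leibniz a f v.1)
  comm a b v := by
    have h := t.alg.fn.comm a b v.1
    rw [Fin.sum_univ_four] at h ⊢
    exact Subtype.ext h

/-- The inclusion of compactly supported smooth functions into all functions. -/
def compactIncl (M : Type*) [TopologicalSpace M] [ChartedSpace (EuclideanSpace ℝ (Fin 4)) M] :
    CompactFns M →+ (M → ℂ) where
  toFun f := f.1
  map_zero' := rfl
  map_add' _ _ := rfl

theorem realizes_compactIncl : Realizes t.compactConn (compactIncl M) :=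
  ⟨fun _ _ ↦ rfl, fun _ _ ↦ rfl⟩

/-- The divergence of compactly supported fields. -/
def compactDiv : (Fin 4 → CompactFns M) →+ CompactFns M :=
  ∑ a, (t.compactConn.D a + DistribSMul.toAddMonoidHom (CompactFns M) (t.alg.dv a)).comp
    (Pi.evalAddMonoidHom _ a)

theorem compactDiv_apply (w : Fin 4 → CompactFns M) :
    t.compactDiv w = ∑ a, (t.compactConn.D a (w a) + t.alg.dv a • w a) := by
  simp [compactDiv, AddMonoidHom.finsetSum_apply]

theorem coe_compactDiv (w : Fin 4 → CompactFns M) :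
    compactIncl M (t.compactDiv w) = t.div (fun a ↦ compactIncl M (w a)) := by
  have e (a : Fin 4) : ((t.alg.dv a : smoothFns M) : M → ℂ) = ∑ b, t.Gam b a b := by
    simp only [TetradAlgebra.dv, AddSubmonoidClass.coe_finsetSum, coe_Gam]
  simp only [compactDiv_apply, map_sum, map_add, t.realizes_compactIncl.D,
    t.realizes_compactIncl.smul, e, div, Finset.sum_mul]

/-- The class of a compactly supported function modulo divergences. -/
def integral : CompactFns M →+ CompactFns M ⧸ t.compactDiv.range :=
  QuotientAddGroup.mk' _

theorem isIntegral_integral : t.compactConn.IsIntegral t.integral := fun a v ↦ by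
  rw [eq_neg_iff_add_eq_zero, ← map_add]
  refine (QuotientAddGroup.eq_zero_iff _).2 ⟨Pi.single a v, ?_⟩
  rw [compactDiv_apply, Finset.sum_eq_single a]
  · simp
  · intro b _ hb
    simp [hb]
  · simp

theorem isCompactDivergence_of_integral_eq {v w : CompactFns M}
    (h : t.integral v = t.integral w) :
    t.IsCompactDivergence (compactIncl M v - compactIncl M w) := by
  rw [← sub_eq_zero, ← map_sub] at h
  obtain ⟨u, hu⟩ := (QuotientAddGroup.eq_zero_iff _).1 h
  exact ⟨fun a ↦ compactIncl M (u a), fun a ↦ ⟨(u a).1.2, (u a).2⟩, by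
    rw [← coe_compactDiv, hu, map_sub]⟩

variable {t} {Λ : ℝ}

theorem isScalarAdjoint_O (hE : t.IsEinstein Λ) (hII : t.IsTypeII) :
    t.IsScalarAdjoint t.O t.Odag := by
  intro Φ χ hΦ hχ hc
  let X : smoothFns M := ⟨χ, hχ⟩
  let v : CompactFns M := ⟨⟨Φ, hΦ⟩, hc⟩
  have key := t.isCompactDivergence_of_integral_eq
    ((hE.typeII hII).O_adjoint t.isIntegral_integral X v)
  rw [t.realizes_compactIncl.smul, t.realizes_compactIncl.smul,
    ← t.realizes_compactIncl.O hE hII] at key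
  have h1 : (((hE.typeII hII).Odag X : smoothFns M) : M → ℂ) = t.Odag χ :=
    (coe_Odag hE hII X).symm
  rw [h1] at key
  exact key

theorem isTensorAdjoint_S (hE : t.IsEinstein Λ) (hII : t.IsTypeII) :
    t.IsTensorAdjoint t.S t.Sdag := by
  intro x χ hx hs hχ hc
  let X : smoothFns M := ⟨χ, hχ⟩
  let y : Fin 4 → Fin 4 → CompactFns M := fun a b ↦ ⟨⟨x a b, hs a b⟩, hc a b⟩
  have hy (a b : Fin 4) : y a b = y b a := Subtype.ext (Subtype.ext (hx a b))
  have key := t.isCompactDivergence_of_integral_eq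
    ((hE.typeII hII).S_adjoint t.isIntegral_integral X hy)
  have e (a b : Fin 4) (v : CompactFns M) : compactIncl M
      (LinearMap.lsmul (smoothFns M) (CompactFns M) (TetradAlgebra.TypeII.Sdag t.alg X a b) v)
      = t.Sdag χ a b * compactIncl M v := by
    rw [LinearMap.lsmul_apply, t.realizes_compactIncl.smul]
    exact congrArg (· * _) (t.coe_Sdag X a b).symm
  have ez (n : ℤ) (f : M → ℂ) : n • f = (n : ℂ) • f := (Int.cast_smul_eq_zsmul ℂ n f).symm
  rw [t.realizes_compactIncl.smul, ← t.realizes_compactIncl.S] at key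
  simp only [TetradAlgebra.Conn.con2, map_sum, map_zsmul, e, ez] at key
  convert key using 1
  refine congrArg (χ * t.S x - ·) ?_
  simp only [mul_smul, ← Finset.smul_sum, sum_eta]
  simp only [Fin.sum_univ_four, sgn, dual, Matrix.cons_val, compactIncl, AddMonoidHom.coe_mk,
    ZeroHom.coe_mk, y]
  push_cast
  module

end NullTetrad

end

end GHP

end

theorem wald_identity_and_debye_construction {M : Type*} [TopologicalSpace M]
    [ChartedSpace (EuclideanSpace ℝ (Fin 4)) M] [IsManifold (𝓡 4) ∞ M]
    (g : GHP.LorentzMetric M) (t : GHP.NullTetrad g) (Λ : ℝ)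
    (hE : t.IsEinstein Λ) (hII : t.IsTypeII) :
    (∀ x : GHP.Tensor2 M, (∀ a b, x a b = x b a) → (∀ a b, GHP.Smooth (x a b)) →
      t.S (t.E Λ x) = t.O (t.T x)) ∧
    t.IsScalarAdjoint t.O t.Odag ∧
    t.IsTensorAdjoint t.S t.Sdag ∧
    (∀ χ : M → ℂ, GHP.Smooth χ → t.Odag χ = 0 → t.E Λ (t.Sdag χ) = 0) :=
  ⟨GHP.NullTetrad.S_E hE hII, GHP.NullTetrad.isScalarAdjoint_O hE hII,
    GHP.NullTetrad.isTensorAdjoint_S hE hII, GHP.NullTetrad.E_Sdag hE hII⟩
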